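/- arXiv:2404.19196 — 7 statements merged into one kernel-verified Lean document; each statement's English description precedes it below -/
import Mathlib

section
/- Let C' > 0, L > 0, γ > 0, β' ∈ ℝ. Suppose Ḡ : ℝ → ℝ satisfies Ḡ(u)/(C'·u^{β'}·exp(−L·u^γ)) → 1 as u → ∞, and U : (1,∞) → ℝ satisfies U(t) → ∞ as t → ∞ and Ḡ(U(t)) = 1/t for all sufficiently large t. Then, as t → ∞, (log t)^{1−1/γ} · [ U(t) − (log t / L)^{1/γ} − (1/(γ·L))·(log t / L)^{1/γ−1}·( log C' + (β'/γ)·(log log t − log L) ) ] → 0. -/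
open Filter Real

lemma weib_aux (l : Filter ℝ) (x V : ℝ → ℝ) (b c p : ℝ)
    (hx : Tendsto x l atTop) (hV : Tendsto V l atTop)
    (he : Tendsto (fun t => V t - x t - c - b * Real.log (V t)) l (nhds 0)) :
    Tendsto (fun t => x t * (Real.exp (p * (Real.log (V t) - Real.log (x t))) - 1)
      - p * (c + b * Real.log (x t))) l (nhds 0) := by
  have hVpos : ∀ᶠ t in l, 0 < V t := hV.eventually_gt_atTop 0
  have hxpos : ∀ᶠ t in l, 0 < x t := hx.eventually_gt_atTop 0
  have hlogdiv : Tendsto (fun y : ℝ => Real.log y / y) atTop (nhds 0) :=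
    Real.isLittleO_log_id_atTop.tendsto_div_nhds_zero
  have hlogsq : Tendsto (fun y : ℝ => Real.log y / y ^ (1/2 : ℝ)) atTop (nhds 0) :=
    (isLittleO_log_rpow_atTop (by norm_num)).tendsto_div_nhds_zero
  have hratio : Tendsto (fun t => x t / V t) l (nhds 1) := by
    have h1 : Tendsto (fun t => 1 - (c + (V t - x t - c - b * Real.log (V t))) * (V t)⁻¹
        - b * (Real.log (V t) / V t)) l (nhds (1 - (c + 0) * 0 - b * 0)) :=
      (tendsto_const_nhds.sub ((tendsto_const_nhds.add he).mul
        (tendsto_inv_atTop_zero.comp hV))).sub (tendsto_const_nhds.mul (hlogdiv.comp hV))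
    simp only [mul_zero, sub_zero] at h1
    refine h1.congr' ?_
    filter_upwards [hVpos] with t ht
    field_simp
    ring
  have hl : Tendsto (fun t => Real.log (V t) - Real.log (x t)) l (nhds 0) := by
    have h1 := (hratio.log one_ne_zero).neg
    simp only [Real.log_one, neg_zero] at h1
    refine h1.congr' ?_
    filter_upwards [hVpos, hxpos] with t ht hxt
    rw [Real.log_div hxt.ne' ht.ne']; ring
  have hD : Tendsto (fun t => V t - x t - c - b * Real.log (x t)) l (nhds 0) := by
    have h1 := he.add (hl.const_mul b)
    simp only [mul_zero, add_zero] at h1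
    refine h1.congr fun t => ?_
    ring
  have hsq : Tendsto (fun t => (V t - x t) ^ 2 / x t) l (nhds 0) := by
    have hi : Tendsto (fun t => ((x t) ^ (1/2 : ℝ))⁻¹) l (nhds 0) :=
      tendsto_inv_atTop_zero.comp ((tendsto_rpow_atTop (by norm_num)).comp hx)
    have h1 := ((((hD.add_const c).mul hi).add ((hlogsq.comp hx).const_mul b))).pow 2
    simp only [mul_zero, add_zero, ne_eq, OfNat.ofNat_ne_zero, not_false_eq_true, zero_pow] at h1
    refine h1.congr' ?_
    filter_upwards [hxpos] with t ht
    have h2 : ((x t) ^ (1/2 : ℝ)) ^ 2 = x t := by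
      rw [← Real.rpow_natCast, ← Real.rpow_mul ht.le]; norm_num
    have h3 : (0:ℝ) < (x t) ^ (1/2 : ℝ) := Real.rpow_pos_of_pos ht _
    have : (V t - x t - c - b * Real.log (x t) + c) * (x t ^ (1/2:ℝ))⁻¹ +
        b * (Real.log ∘ x) t / x t ^ (1/2:ℝ) = (V t - x t) / x t ^ (1/2:ℝ) := by
      simp only [Function.comp]
      field_simp
      ring
    simp only [Function.comp] at this ⊢
    rw [← mul_div_assoc, this, div_pow, h2]
  -- the main remainder
  have hR : Tendsto (fun t => x t * (Real.exp (p * (Real.log (V t) - Real.log (x t))) - 1)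
      - p * (V t - x t)) l (nhds 0) := by
    have hb : Tendsto (fun t => (p ^ 2 + |p|) * (4 * ((V t - x t) ^ 2 / x t))) l (nhds 0) := by
      simpa using (hsq.const_mul 4).const_mul (p ^ 2 + |p|)
    refine squeeze_zero_norm' ?_ hb
    have ha1 : ∀ᶠ t in l, |Real.log (V t) - Real.log (x t)| < 1 / 2 := by
      have := hl.abs
      rw [abs_zero] at this
      exact this.eventually_lt_const (by norm_num)
    have ha2 : ∀ᶠ t in l, |p * (Real.log (V t) - Real.log (x t))| < 1 := by
      have := (hl.const_mul p).abs
      rw [mul_zero, abs_zero] at this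
      exact this.eventually_lt_const (by norm_num)
    filter_upwards [hVpos, hxpos, ha1, ha2] with t hVt hxt h1 h2
    set d := Real.log (V t) - Real.log (x t) with hd
    have hVx : V t - x t = x t * (Real.exp d - 1) := by
      rw [hd, Real.exp_sub, Real.exp_log hVt, Real.exp_log hxt]
      field_simp
    have e1 := Real.abs_exp_sub_one_sub_id_le (x := d) (by linarith)
    have e2 := Real.abs_exp_sub_one_sub_id_le (x := p * d) h2.le
    have hdd : d ^ 2 ≤ 4 * (Real.exp d - 1) ^ 2 := by
      have k1 : |d| ≤ 2 * |Real.exp d - 1| := by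
        have k2 : |d| ≤ |Real.exp d - 1| + |Real.exp d - 1 - d| := by
          have := abs_sub (Real.exp d - 1) (Real.exp d - 1 - d)
          simpa using this
        have k3 : d ^ 2 ≤ |d| / 2 := by
          rw [← sq_abs]; nlinarith [abs_nonneg d]
        linarith
      have := pow_le_pow_left₀ (abs_nonneg d) k1 2
      rw [mul_pow, sq_abs, sq_abs] at this
      linarith
    have hq : (V t - x t) ^ 2 / x t = x t * (Real.exp d - 1) ^ 2 := by
      rw [hVx]; field_simp
    rw [hq, hVx, Real.norm_eq_abs]
    have r : x t * (Real.exp (p * d) - 1) - p * (x t * (Real.exp d - 1)) =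
      x t * ((Real.exp (p * d) - 1 - p * d) - p * (Real.exp d - 1 - d)) := by ring
    rw [r, abs_mul, abs_of_pos hxt]
    have f1 : |(Real.exp (p * d) - 1 - p * d) - p * (Real.exp d - 1 - d)| ≤
        (p * d) ^ 2 + |p| * d ^ 2 := by
      refine (abs_sub _ _).trans ?_
      rw [abs_mul p]
      gcongr
    calc _ ≤ x t * ((p * d) ^ 2 + |p| * d ^ 2) := by gcongr
      _ = x t * ((p ^ 2 + |p|) * d ^ 2) := by ring
      _ ≤ x t * ((p ^ 2 + |p|) * (4 * (Real.exp d - 1) ^ 2)) := by gcongr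
      _ = _ := by ring
  have h := hR.add (hD.const_mul p)
  simp only [mul_zero, add_zero] at h
  refine h.congr fun t => ?_
  ring

/-- Asymptotic expansion of the quantile function of a Weibullian-tailed distribution. -/
theorem weibullian_quantile_expansion
    (C' L γ β' : ℝ) (hC' : 0 < C') (hL : 0 < L) (hγ : 0 < γ)
    (G : ℝ → ℝ)
    (hG : Tendsto (fun u => G u / (C' * u ^ β' * Real.exp (-L * u ^ γ))) atTop (nhds 1))
    (U : ℝ → ℝ)
    (hUtop : Tendsto U atTop atTop)
    (hUq : ∀ᶠ t in atTop, G (U t) = 1 / t) :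
    Tendsto
      (fun t =>
        (Real.log t) ^ (1 - 1 / γ) *
          (U t - (Real.log t / L) ^ (1 / γ) -
            (1 / (γ * L)) * (Real.log t / L) ^ (1 / γ - 1) *
              (Real.log C' + (β' / γ) * (Real.log (Real.log t) - Real.log L))))
      atTop (nhds 0) := by
  have hUpos : ∀ᶠ t in atTop, 0 < U t := hUtop.eventually_gt_atTop 0
  have hx : Tendsto (fun t => Real.log t / L) atTop atTop :=
    Real.tendsto_log_atTop.atTop_div_const hL
  have hV : Tendsto (fun t => U t ^ γ) atTop atTop := (tendsto_rpow_atTop hγ).comp hUtop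
  have he : Tendsto (fun t => U t ^ γ - Real.log t / L - Real.log C' / L
      - β' / (γ * L) * Real.log (U t ^ γ)) atTop (nhds 0) := by
    have h1 := ((hG.comp hUtop).log one_ne_zero).div_const L
    rw [Real.log_one, zero_div] at h1
    refine h1.congr' ?_
    filter_upwards [hUpos, hUq, eventually_gt_atTop 0] with t ht hq h0
    have hp : 0 < U t ^ β' := Real.rpow_pos_of_pos ht _
    simp only [Function.comp]
    rw [hq, Real.log_div (by positivity) (by positivity), Real.log_mul (by positivity)
      (by positivity), Real.log_mul hC'.ne' hp.ne', Real.log_exp, Real.log_rpow ht,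
      Real.log_rpow ht, one_div, Real.log_inv]
    field_simp
    ring
  have h := (weib_aux atTop _ _ _ _ (1 / γ) hx hV he).const_mul (L ^ (1 - 1 / γ))
  rw [mul_zero] at h
  refine h.congr' ?_
  filter_upwards [hUpos, hx.eventually_gt_atTop 0, eventually_gt_atTop 1] with t ht hxt h1
  have hlog : 0 < Real.log t := Real.log_pos h1
  have e1 : Real.log t = L * (Real.log t / L) := by field_simp
  have e2 : Real.log (Real.log t) - Real.log L = Real.log (Real.log t / L) := by
    rw [Real.log_div hlog.ne' hL.ne']
  rw [e2]
  have e3 : (Real.log t) ^ (1 - 1 / γ) = L ^ (1 - 1 / γ) * (Real.log t / L) ^ (1 - 1 / γ) := by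
    rw [← Real.mul_rpow hL.le hxt.le, ← e1]
  rw [e3]
  generalize Real.log t / L = x at hxt
  have e4 : Real.exp (1 / γ * (Real.log (U t ^ γ) - Real.log x)) = U t / x ^ (1 / γ) := by
    rw [Real.log_rpow ht, mul_sub, Real.exp_sub, ← mul_assoc, one_div_mul_cancel hγ.ne', one_mul,
      Real.exp_log ht, Real.rpow_def_of_pos hxt, mul_comm (Real.log x)]
  rw [e4, Real.rpow_sub hxt, Real.rpow_sub hxt, Real.rpow_one]
  have hp : 0 < x ^ (1 / γ) := Real.rpow_pos_of_pos hxt _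
  generalize x ^ (1 / γ) = y at hp
  generalize L ^ (1 - 1 / γ) = z
  field_simp
end

section
/- Let d ≥ 1 and let Σ ∈ ℝ^{d×d} be a positive definite matrix with unit diagonal (Σ_{ii} = 1 for all i), i.e., a correlation matrix. Then for every x ∈ ℝ^d with x ≥ 1 componentwise, x^⊤ Σ⁻¹ x ≥ 1. In particular, the minimum value λ(Σ) = min_{x ≥ 1} x^⊤ Σ⁻¹ x satisfies λ(Σ) ≥ 1. -/
open Matrix

/-- For a positive definite correlation matrix `Σ` (unit diagonal), the quadratic form
`x ⬝ Σ⁻¹ x` is at least `1` on the set `{x : x ≥ 1}`; in particular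
`λ(Σ) = min_{x ≥ 1} x ⬝ Σ⁻¹ x ≥ 1`. -/
theorem quadratic_programming_correlation_ge_one
    (d : ℕ) (hd : 1 ≤ d) (S : Matrix (Fin d) (Fin d) ℝ) (hS : S.PosDef)
    (hdiag : ∀ i, S i i = 1) :
    ∀ x : Fin d → ℝ, (∀ i, 1 ≤ x i) → 1 ≤ x ⬝ᵥ (S⁻¹ *ᵥ x) := by
  intro x hx
  have hu : IsUnit S.det := (Matrix.isUnit_iff_isUnit_det S).mp hS.isUnit
  have hT : Sᵀ = S := by
    have h := hS.isHermitian
    rwa [Matrix.IsHermitian, Matrix.conjTranspose_eq_transpose_of_trivial] at h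
  let k : Fin d := ⟨0, hd⟩
  obtain ⟨y, hy⟩ : ∃ y, y = S⁻¹ *ᵥ x := ⟨_, rfl⟩
  have hSy : S *ᵥ y = x := by
    rw [hy, Matrix.mulVec_mulVec, Matrix.mul_nonsing_inv S hu, Matrix.one_mulVec]
  rw [← hy]
  have h := hS.posSemidef.dotProduct_mulVec_nonneg (y - Pi.single k 1)
  have hsymm : y ⬝ᵥ (S *ᵥ Pi.single k 1) = x k := by
    rw [Matrix.dotProduct_mulVec, ← Matrix.mulVec_transpose, hT, hSy]
    simp
  have hkk : (Pi.single k 1 : Fin d → ℝ) ⬝ᵥ (S *ᵥ Pi.single k 1) = 1 := by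
    simp [hdiag]
  have hkx : (Pi.single k 1 : Fin d → ℝ) ⬝ᵥ x = x k := by simp
  rw [star_trivial, Matrix.mulVec_sub, sub_dotProduct, dotProduct_sub, dotProduct_sub,
    hSy, hsymm, hkk, hkx, dotProduct_comm y x] at h
  linarith [hx k]
end

section
/- Let d ≥ 1 and let Σ ∈ ℝ^{d×d} be a positive definite matrix such that all entries of the vector Σ⁻¹·1 are nonnegative, where 1 = (1,…,1)^⊤. Then for every x ∈ ℝ^d with x ≥ 1 componentwise, 1^⊤ Σ⁻¹ 1 ≤ x^⊤ Σ⁻¹ x, with equality if and only if x = 1. Hence the unique solution of the quadratic programming problem 𝒫(Σ⁻¹) is e* = 1. -/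
open Matrix

/-- If all entries of `Σ⁻¹ 1` are nonnegative, then `e* = 1` is the unique solution of
the quadratic programming problem `𝒫(Σ⁻¹)`: for every `x ≥ 1` componentwise,
`1 ⬝ Σ⁻¹ 1 ≤ x ⬝ Σ⁻¹ x` with equality iff `x = 1`. -/
theorem quadratic_programming_solution_one
    (d : ℕ) (hd : 1 ≤ d) (S : Matrix (Fin d) (Fin d) ℝ) (hS : S.PosDef)
    (hpos : ∀ i, 0 ≤ (S⁻¹ *ᵥ (1 : Fin d → ℝ)) i) :
    ∀ x : Fin d → ℝ, (∀ i, 1 ≤ x i) →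
      (1 : Fin d → ℝ) ⬝ᵥ (S⁻¹ *ᵥ (1 : Fin d → ℝ)) ≤ x ⬝ᵥ (S⁻¹ *ᵥ x) ∧
        (x ⬝ᵥ (S⁻¹ *ᵥ x) = (1 : Fin d → ℝ) ⬝ᵥ (S⁻¹ *ᵥ (1 : Fin d → ℝ)) ↔ x = 1) := by
  intro x hx
  have hP : (S⁻¹).PosDef := hS.inv
  have hT : (S⁻¹)ᵀ = S⁻¹ := by
    have h := hP.isHermitian.eq
    rwa [Matrix.conjTranspose_eq_transpose_of_trivial] at h
  generalize S⁻¹ = A at *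
  obtain ⟨y, rfl⟩ : ∃ y : Fin d → ℝ, x = 1 + y := ⟨x - 1, by simp⟩
  have hsym : (1 : Fin d → ℝ) ⬝ᵥ (A *ᵥ y) = y ⬝ᵥ (A *ᵥ 1) := by
    rw [Matrix.dotProduct_mulVec, ← Matrix.mulVec_transpose, hT, dotProduct_comm]
  have hexp : (1 + y) ⬝ᵥ (A *ᵥ (1 + y))
      = (1 : Fin d → ℝ) ⬝ᵥ (A *ᵥ 1) + 2 * (y ⬝ᵥ (A *ᵥ 1)) + y ⬝ᵥ (A *ᵥ y) := by
    rw [Matrix.mulVec_add, add_dotProduct, dotProduct_add, dotProduct_add, hsym]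
    ring
  have hy : 0 ≤ y ⬝ᵥ (A *ᵥ 1) :=
    Finset.sum_nonneg fun i _ => mul_nonneg (by simpa using hx i) (hpos i)
  have hq : y ≠ 0 → 0 < y ⬝ᵥ (A *ᵥ y) := fun h => by
    simpa using hP.dotProduct_mulVec_pos h
  rw [hexp]
  by_cases h0 : y = 0
  · subst h0
    simp
  · have := hq h0
    refine ⟨by linarith, fun h => by linarith, fun h => absurd (by simpa using h) h0⟩
end

section
/- Let κ > 0, d ≥ 1 (a real parameter), C > 0, and define h(r) := C·r^{d−1}·exp(−r^{2κ}/2) for r > 0. Then for every r > 0, ∫_r^∞ h(u) du ≥ (r / (κ·(r^{2κ} + 2)))·h(r). -/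
open MeasureTheory Real

lemma mills_aux_deriv (κ d : ℝ) (hκ : 0 < κ) (x : ℝ) (hx : 0 < x) :
    HasDerivAt (fun x : ℝ => -(x ^ d * Real.exp (-(x ^ (2 * κ)) / 2) / (κ * (x ^ (2 * κ) + 2))))
      (x ^ (d - 1) * Real.exp (-(x ^ (2 * κ)) / 2) *
        ((-d + κ * x ^ (2 * κ) + 2 * κ * x ^ (2 * κ) / (x ^ (2 * κ) + 2)) /
          (κ * (x ^ (2 * κ) + 2)))) x := by
  have ht : 0 < x ^ (2 * κ) := rpow_pos_of_pos hx _
  have h1 : HasDerivAt (fun x : ℝ => x ^ (2 * κ)) (2 * κ * x ^ (2 * κ - 1)) x :=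
    Real.hasDerivAt_rpow_const (Or.inl hx.ne')
  have h2 : HasDerivAt (fun x : ℝ => x ^ d) (d * x ^ (d - 1)) x :=
    Real.hasDerivAt_rpow_const (Or.inl hx.ne')
  have h3 := (h1.neg.div_const 2).exp
  have h4 := (h1.add_const 2).const_mul κ
  have h5 := ((h2.mul h3).div h4 (by positivity)).neg
  refine h5.congr_deriv ?_
  have e1 : x ^ (2 * κ - 1) = x ^ (2 * κ) / x := by rw [rpow_sub hx, rpow_one]
  have e2 : x ^ (d - 1) = x ^ d / x := by rw [rpow_sub hx, rpow_one]
  simp only [Pi.neg_apply, Pi.mul_apply]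
  rw [e1, e2]
  field_simp
  ring

lemma mills_aux_tendsto (κ d : ℝ) (hκ : 0 < κ) :
    Filter.Tendsto (fun x : ℝ => x ^ d * Real.exp (-(x ^ (2 * κ)) / 2) / (κ * (x ^ (2 * κ) + 2)))
      Filter.atTop (nhds 0) := by
  have h := (tendsto_rpow_mul_exp_neg_mul_atTop_nhds_zero (d / (2 * κ)) (1 / 2)
    (by norm_num)).comp (tendsto_rpow_atTop (show 0 < 2 * κ by positivity))
  have h' := h.div_const (2 * κ)
  rw [zero_div] at h'
  refine squeeze_zero' ?_ ?_ h'
  · filter_upwards [Filter.eventually_gt_atTop 0] with x hx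
    positivity
  · filter_upwards [Filter.eventually_gt_atTop 0] with x hx
    have ht : 0 < x ^ (2 * κ) := rpow_pos_of_pos hx _
    simp only [Function.comp]
    rw [← rpow_mul hx.le, mul_div_cancel₀ d (by positivity : 2 * κ ≠ 0),
      show -(x ^ (2 * κ)) / 2 = -(1 / 2) * x ^ (2 * κ) by ring]
    apply div_le_div_of_nonneg_left <;> first | positivity | nlinarith

/-- Lower Mills'-ratio bound for the Weibullian-type density
`h(r) = C r^(d-1) exp(-r^(2κ)/2)`. -/
theorem mills_ratio_lower_bound
    (κ d C : ℝ) (hκ : 0 < κ) (hd : 1 ≤ d) (hC : 0 < C) :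
    ∀ r > (0 : ℝ),
      (r / (κ * (r ^ (2 * κ) + 2))) * (C * r ^ (d - 1) * Real.exp (-(r ^ (2 * κ)) / 2)) ≤
        ∫ u in Set.Ioi r, C * u ^ (d - 1) * Real.exp (-(u ^ (2 * κ)) / 2) := by
  intro r hr
  have hint : IntegrableOn (fun u : ℝ => u ^ (d - 1) * Real.exp (-(u ^ (2 * κ)) / 2))
      (Set.Ioi r) := by
    have := integrableOn_rpow_mul_exp_neg_mul_rpow (p := 2 * κ) (s := d - 1) (b := 1 / 2)
      (by linarith) (by positivity) (by norm_num)
    refine (this.mono_set (Set.Ioi_subset_Ioi hr.le)).congr_fun (fun x _ => ?_) measurableSet_Ioi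
    simp only
    congr 2
    ring
  simp only [mul_assoc C]
  rw [integral_const_mul]
  have key : r ^ d * Real.exp (-(r ^ (2 * κ)) / 2) / (κ * (r ^ (2 * κ) + 2)) ≤
      ∫ u in Set.Ioi r, u ^ (d - 1) * Real.exp (-(u ^ (2 * κ)) / 2) := by
    have hl := intervalIntegral_tendsto_integral_Ioi r hint Filter.tendsto_id
    have hr' := ((mills_aux_tendsto κ d hκ).neg).sub_const
      (-(r ^ d * Real.exp (-(r ^ (2 * κ)) / 2) / (κ * (r ^ (2 * κ) + 2))))
    simp only [neg_zero, zero_sub, neg_neg] at hr'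
    refine le_of_tendsto_of_tendsto hr' hl ?_
    filter_upwards [Filter.eventually_gt_atTop r] with y hy
    have hsub : Set.Icc r y ⊆ Set.Ioi 0 := fun x hx => lt_of_lt_of_le hr hx.1
    refine intervalIntegral.sub_le_integral_of_hasDeriv_right_of_le hy.le
      (g := fun x : ℝ => -(x ^ d * Real.exp (-(x ^ (2 * κ)) / 2) / (κ * (x ^ (2 * κ) + 2))))
      (fun x hx => (mills_aux_deriv κ d hκ x (hsub hx)).continuousAt.continuousWithinAt)
      (fun x hx => (mills_aux_deriv κ d hκ x (hr.trans hx.1)).hasDerivWithinAt) ?_ ?_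
    · rw [integrableOn_Icc_iff_integrableOn_Ioc]
      exact hint.mono_set Set.Ioc_subset_Ioi_self
    · intro x hx
      have hx0 : 0 < x := hr.trans hx.1
      have ht : 0 < x ^ (2 * κ) := rpow_pos_of_pos hx0 _
      apply mul_le_of_le_one_right (by positivity)
      rw [div_le_one (by positivity)]
      have : 2 * κ * x ^ (2 * κ) / (x ^ (2 * κ) + 2) ≤ 2 * κ := by
        rw [div_le_iff₀ (by positivity)]
        nlinarith
      linarith
  have e : r ^ d = r ^ (d - 1) * r := by
    rw [rpow_sub hr, rpow_one]; field_simp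
  calc _ = C * (r ^ d * Real.exp (-(r ^ (2 * κ)) / 2) / (κ * (r ^ (2 * κ) + 2))) := by
        rw [e]; ring
    _ ≤ _ := mul_le_mul_of_nonneg_left key hC.le
end

section
/- Let d ≥ 2 be an integer, C > 0, L > 0, γ > 0, β ∈ ℝ, and let F̄ : ℝ → [0,1] be nonincreasing with F̄(u)/(C·u^β·exp(−L·u^γ)) → 1 as u → ∞. Then lim_{u→∞} [ (Γ(d/2)/(Γ(1/2)·Γ((d−1)/2))) · ∫_0^1 F̄(u·b^{−1/2})·b^{−1/2}·(1−b)^{(d−3)/2} db ] / [ (Γ(d/2)/Γ(1/2)) · C · (γ·L/2)^{−(d−1)/2} · u^{β − γ(d−1)/2} · exp(−L·u^γ) ] = 1. -/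
open MeasureTheory Real Filter

/-- Power times stretched exponential is bounded on `[1, ∞)`. -/
lemma aux_bound (L γ p : ℝ) (hL : 0 < L) (hγ : 0 < γ) :
    ∃ M : ℝ, 0 < M ∧ ∀ x : ℝ, 1 ≤ x → x ^ p * Real.exp (-(L / 2) * (x ^ γ - 1)) ≤ M := by
  set q := |p| / γ + 1 with hq
  have hq0 : 0 < q := by positivity
  set ε := L / (2 * q) with hε
  have hε0 : 0 < ε := by positivity
  refine ⟨Real.exp (q * (-1 - Real.log ε) + L / 2), Real.exp_pos _, fun x hx => ?_⟩
  have hx0 : 0 < x := by linarith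
  rw [Real.rpow_def_of_pos hx0, ← Real.exp_add]
  apply Real.exp_le_exp.mpr
  have hy : 0 < x ^ γ := Real.rpow_pos_of_pos hx0 γ
  have h1 : Real.log (ε * x ^ γ) ≤ ε * x ^ γ - 1 := Real.log_le_sub_one_of_pos (by positivity)
  rw [Real.log_mul hε0.ne' hy.ne', Real.log_rpow hx0] at h1
  have hlog : 0 ≤ Real.log x := Real.log_nonneg hx
  have h2 : Real.log x * p ≤ q * (γ * Real.log x) := by
    have : q * (γ * Real.log x) = |p| * Real.log x + γ * Real.log x := by
      rw [hq]; field_simp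
    rw [this]
    have h3 : p * Real.log x ≤ |p| * Real.log x :=
      mul_le_mul_of_nonneg_right (le_abs_self p) hlog
    have : 0 ≤ γ * Real.log x := by positivity
    linarith
  have h4 : q * (Real.log ε + γ * Real.log x) ≤ q * (ε * x ^ γ - 1) :=
    mul_le_mul_of_nonneg_left h1 hq0.le
  have h5 : q * (ε * x ^ γ) = L / 2 * x ^ γ := by
    rw [hε]; field_simp
  linarith

/-- Convexity bound. -/
lemma aux_conv (γ b : ℝ) (hγ : 0 < γ) (hb : 0 < b) :
    γ / 2 * (1 - b) ≤ (b ^ (-(1 : ℝ) / 2)) ^ γ - 1 := by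
  rw [← Real.rpow_mul hb.le, Real.rpow_def_of_pos hb]
  have h1 := Real.add_one_le_exp (Real.log b * (-1 / 2 * γ))
  have h2 := Real.log_le_sub_one_of_pos hb
  nlinarith

lemma aux_x (t : ℝ) : Tendsto (fun s : ℝ => (1 - t / s) ^ (-(1 : ℝ) / 2)) atTop (nhds 1) := by
  have h : Tendsto (fun s : ℝ => 1 - t / s) atTop (nhds (1 - 0)) :=
    tendsto_const_nhds.sub (tendsto_const_nhds.div_atTop tendsto_id)
  rw [sub_zero] at h
  have := h.rpow_const (p := -(1 : ℝ) / 2) (Or.inl one_ne_zero)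
  simpa using this

lemma aux_deriv (γ t : ℝ) :
    Tendsto (fun s : ℝ => s * (((1 - t / s) ^ (-(1 : ℝ) / 2)) ^ γ - 1)) atTop
      (nhds (γ * t / 2)) := by
  have h0 : HasDerivAt (fun y : ℝ => 1 - t * y) (-t) 0 := by
    simpa using ((hasDerivAt_id (0 : ℝ)).const_mul t).const_sub 1
  have h1 := h0.rpow_const (p := -(1 : ℝ) / 2) (Or.inl (by simp))
  have h2 := h1.rpow_const (p := γ) (Or.inl (by simp))
  have h3 := h2.tendsto_slope_zero_right
  have h4 := h3.comp tendsto_inv_atTop_nhdsGT_zero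
  refine (h4.congr fun s => ?_).trans_eq ?_
  · simp [div_eq_mul_inv]
  · congr 1; simp; ring

lemma aux_cov (g : ℝ → ℝ) (s : ℝ) (hs : 0 < s) :
    ∫ b in Set.Ioo (0 : ℝ) 1, g b =
      s⁻¹ * ∫ t in Set.Ioi (0 : ℝ), (Set.Ioo (0 : ℝ) s).indicator (fun t => g (1 - t / s)) t := by
  have h := intervalIntegral.integral_comp_sub_div (a := 0) (b := s) g hs.ne' 1
  rw [div_self hs.ne', zero_div, sub_self, sub_zero] at h
  rw [intervalIntegral.integral_of_le hs.le, intervalIntegral.integral_of_le zero_le_one,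
    integral_Ioc_eq_integral_Ioo, integral_Ioc_eq_integral_Ioo, smul_eq_mul] at h
  rw [setIntegral_indicator measurableSet_Ioo]
  have : Set.Ioi (0 : ℝ) ∩ Set.Ioo 0 s = Set.Ioo 0 s := by
    ext x; simp
  rw [this, h]
  field_simp

/-- The normalized integrand. -/
lemma aux_factor (C L γ β a u x t Fv : ℝ) (hC : 0 < C) (hu : 0 < u) (hx : 0 < x) :
    Fv * x * t ^ (a - 1) / (C * u ^ β * Real.exp (-L * u ^ γ)) =
      (Fv / (C * (u * x) ^ β * Real.exp (-L * (u * x) ^ γ))) * x ^ (β + 1) *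
        Real.exp (-L * (u ^ γ * (x ^ γ - 1))) * t ^ (a - 1) := by
  rw [Real.mul_rpow hu.le hx.le, Real.mul_rpow hu.le hx.le, Real.rpow_add hx, Real.rpow_one]
  have h : Real.exp (-L * (u ^ γ * x ^ γ)) =
      Real.exp (-L * (u ^ γ * (x ^ γ - 1))) * Real.exp (-L * u ^ γ) := by
    rw [← Real.exp_add]; congr 1; ring
  rw [h]
  have h1 := (Real.rpow_pos_of_pos hu β).ne'
  have h2 := (Real.rpow_pos_of_pos hx β).ne'
  have h3 := (Real.exp_pos (-L * (u ^ γ * (x ^ γ - 1)))).ne'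
  have h4 := (Real.exp_pos (-L * u ^ γ)).ne'
  generalize Real.exp (-L * (u ^ γ * (x ^ γ - 1))) = e1 at *
  generalize Real.exp (-L * u ^ γ) = e2 at *
  field_simp

lemma aux_main (a C L γ β : ℝ) (ha : 0 < a) (hC : 0 < C) (hL : 0 < L) (hγ : 0 < γ)
    (F : ℝ → ℝ) (hFmono : Antitone F) (hFrange : ∀ u, F u ∈ Set.Icc (0 : ℝ) 1)
    (hF : Tendsto (fun u => F u / (C * u ^ β * Real.exp (-L * u ^ γ))) atTop (nhds 1)) :
    Tendsto (fun u : ℝ => ∫ t in Set.Ioi (0 : ℝ), (Set.Ioo (0 : ℝ) (u ^ γ)).indicator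
        (fun t => F (u * (1 - t / u ^ γ) ^ (-(1 : ℝ) / 2)) * (1 - t / u ^ γ) ^ (-(1 : ℝ) / 2) *
          t ^ (a - 1) / (C * u ^ β * Real.exp (-L * u ^ γ))) t)
      atTop (nhds ((1 / (L * γ / 2)) ^ a * Real.Gamma a)) := by
  rw [← Real.integral_rpow_mul_exp_neg_mul_Ioi ha (by positivity : 0 < L * γ / 2)]
  obtain ⟨M, hM0, hM⟩ := aux_bound L γ (β + 1) hL hγ
  have hs : Tendsto (fun u : ℝ => u ^ γ) atTop atTop := tendsto_rpow_atTop hγ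
  refine tendsto_integral_filter_of_dominated_convergence
    (fun t => 2 * M * (t ^ (a - 1) * Real.exp (-(L * γ / 4 * t)))) ?_ ?_ ?_ ?_
  · refine Eventually.of_forall fun u => ?_
    refine Measurable.aestronglyMeasurable ?_
    refine Measurable.indicator ?_ measurableSet_Ioo
    have hm := hFmono.measurable
    fun_prop
  · obtain ⟨u0, hu0⟩ := eventually_atTop.mp (hF.eventually (gt_mem_nhds (by norm_num : (1 : ℝ) < 2)))
    filter_upwards [eventually_ge_atTop u0, eventually_ge_atTop 1] with u hu hu1
    refine (ae_restrict_mem measurableSet_Ioi).mono fun t ht => ?_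
    have ht0 : 0 < t := ht
    by_cases hts : t ∈ Set.Ioo (0 : ℝ) (u ^ γ)
    · rw [Set.indicator_of_mem hts]
      have hu00 : 0 < u := by linarith
      have hs1 : 1 ≤ u ^ γ := Real.one_le_rpow hu1 hγ.le
      have hspos : 0 < u ^ γ := by linarith
      set b := 1 - t / u ^ γ with hb
      have hb0 : 0 < b := by
        rw [hb, sub_pos, div_lt_one hspos]; exact hts.2
      have hb1 : b ≤ 1 := by
        have : 0 ≤ t / u ^ γ := by positivity
        linarith
      have hconv := aux_conv γ b hγ hb0
      have hx1 : 1 ≤ b ^ (-(1 : ℝ) / 2) :=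
        Real.one_le_rpow_of_pos_of_le_one_of_nonpos hb0 hb1 (by norm_num)
      set x := b ^ (-(1 : ℝ) / 2) with hx
      have hx0 : 0 < x := by linarith
      rw [aux_factor C L γ β a u x t _ hC hu00 hx0]
      have hR2 := (hu0 (u * x) (by nlinarith)).le
      have hR0 : 0 ≤ F (u * x) / (C * (u * x) ^ β * Real.exp (-L * (u * x) ^ γ)) :=
        div_nonneg (hFrange _).1 (by positivity)
      generalize F (u * x) / (C * (u * x) ^ β * Real.exp (-L * (u * x) ^ γ)) = R at *
      have hx3 := hM x hx1
      have hexp : Real.exp (-L * (u ^ γ * (x ^ γ - 1))) ≤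
          Real.exp (-(L / 2) * (x ^ γ - 1)) * Real.exp (-(L * γ / 4 * t)) := by
        rw [← Real.exp_add]
        apply Real.exp_le_exp.mpr
        have e1 : u ^ γ * (γ / 2 * (1 - b)) = γ / 2 * t := by
          rw [hb]; field_simp; ring
        have e2 : γ / 2 * t ≤ u ^ γ * (x ^ γ - 1) := by
          rw [← e1]; exact mul_le_mul_of_nonneg_left hconv hspos.le
        have e3 : 0 ≤ x ^ γ - 1 := by
          have : 0 ≤ γ / 2 * (1 - b) := mul_nonneg (by positivity) (by linarith)
          linarith
        have e4 : x ^ γ - 1 ≤ u ^ γ * (x ^ γ - 1) := le_mul_of_one_le_left e3 hs1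
        nlinarith
      rw [Real.norm_of_nonneg (by positivity)]
      calc R * x ^ (β + 1) * Real.exp (-L * (u ^ γ * (x ^ γ - 1))) * t ^ (a - 1)
          ≤ 2 * x ^ (β + 1) * (Real.exp (-(L / 2) * (x ^ γ - 1)) * Real.exp (-(L * γ / 4 * t)))
              * t ^ (a - 1) := by gcongr
        _ = 2 * (x ^ (β + 1) * Real.exp (-(L / 2) * (x ^ γ - 1))) *
              (t ^ (a - 1) * Real.exp (-(L * γ / 4 * t))) := by ring
        _ ≤ _ := by gcongr
    · rw [Set.indicator_of_notMem hts, norm_zero]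
      positivity
  · have h := (integrableOn_rpow_mul_exp_neg_mul_rpow (s := a - 1) (p := 1) (b := L * γ / 4)
      (by linarith) one_pos (by positivity))
    refine Integrable.const_mul ?_ _
    refine h.congr_fun (fun t _ => ?_) measurableSet_Ioi
    simp
  · refine (ae_restrict_mem measurableSet_Ioi).mono fun t ht => ?_
    have ht0 : 0 < t := ht
    have hX : Tendsto (fun u : ℝ => (1 - t / u ^ γ) ^ (-(1 : ℝ) / 2)) atTop (nhds 1) :=
      (aux_x t).comp hs
    have hD : Tendsto (fun u : ℝ => u ^ γ * (((1 - t / u ^ γ) ^ (-(1 : ℝ) / 2)) ^ γ - 1)) atTop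
      (nhds (γ * t / 2)) := (aux_deriv γ t).comp hs
    have hV : Tendsto (fun u : ℝ => u * (1 - t / u ^ γ) ^ (-(1 : ℝ) / 2)) atTop atTop :=
      tendsto_id.atTop_mul_pos one_pos hX
    have hR := hF.comp hV
    have hXp := hX.rpow_const (p := β + 1) (Or.inl one_ne_zero)
    have hE := (Real.continuous_exp.tendsto _).comp (hD.const_mul (-L))
    have hall := ((hR.mul hXp).mul hE).mul_const (t ^ (a - 1))
    have hlim : (1 * (1 : ℝ) ^ (β + 1) * Real.exp (-L * (γ * t / 2))) * t ^ (a - 1) =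
        t ^ (a - 1) * Real.exp (-(L * γ / 2 * t)) := by
      rw [Real.one_rpow, one_mul, one_mul, mul_comm]; congr 2; ring
    rw [hlim] at hall
    refine hall.congr' ?_
    filter_upwards [hs.eventually (eventually_gt_atTop t), eventually_gt_atTop 0] with u hu hu0
    have hts : t ∈ Set.Ioo (0 : ℝ) (u ^ γ) := ⟨ht0, hu⟩
    rw [Set.indicator_of_mem hts]
    have hb0 : 0 < 1 - t / u ^ γ := by
      rw [sub_pos, div_lt_one (by linarith)]; exact hu
    rw [aux_factor C L γ β a u _ t _ hC hu0 (Real.rpow_pos_of_pos hb0 _)]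
    rfl

/-- The survival function `P(R √B > u)` of the product of a positive random variable `R`
with Weibullian-tailed survival function `F̄` and an independent `Beta(1/2, (d-1)/2)`
variable `B` is asymptotically
`(Γ(d/2)/Γ(1/2)) C (γL/2)^{-(d-1)/2} u^{β-γ(d-1)/2} exp(-L u^γ)` as `u → ∞`. -/
theorem weibullian_times_beta_tail
    (d : ℕ) (hd : 2 ≤ d) (C L γ β : ℝ) (hC : 0 < C) (hL : 0 < L) (hγ : 0 < γ)
    (F : ℝ → ℝ) (hFmono : Antitone F) (hFrange : ∀ u, F u ∈ Set.Icc (0 : ℝ) 1)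
    (hF : Tendsto (fun u => F u / (C * u ^ β * Real.exp (-L * u ^ γ))) atTop (nhds 1)) :
    Tendsto
      (fun u : ℝ =>
        ((Real.Gamma ((d : ℝ) / 2) / (Real.Gamma (1 / 2) * Real.Gamma (((d : ℝ) - 1) / 2))) *
            ∫ b in Set.Ioo (0 : ℝ) 1,
              F (u * b ^ (-(1 : ℝ) / 2)) * b ^ (-(1 : ℝ) / 2) *
                (1 - b) ^ (((d : ℝ) - 3) / 2)) /
          ((Real.Gamma ((d : ℝ) / 2) / Real.Gamma (1 / 2)) * C *
            (γ * L / 2) ^ (-((d : ℝ) - 1) / 2) * u ^ (β - γ * ((d : ℝ) - 1) / 2) *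
            Real.exp (-L * u ^ γ)))
      atTop (nhds 1) := by
  have hd' : (2 : ℝ) ≤ d := by exact_mod_cast hd
  obtain ⟨a, ha⟩ : ∃ a : ℝ, a = ((d : ℝ) - 1) / 2 := ⟨_, rfl⟩
  have ha0 : 0 < a := by rw [ha]; linarith
  have e1 : ((d : ℝ) - 3) / 2 = a - 1 := by rw [ha]; ring
  have e2 : -((d : ℝ) - 1) / 2 = -a := by rw [ha]; ring
  have e3 : γ * ((d : ℝ) - 1) / 2 = γ * a := by rw [ha]; ring
  rw [e1, e2, e3, ← ha]
  have hmain := aux_main a C L γ β ha0 hC hL hγ F hFmono hFrange hF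
  have hG1 : 0 < Real.Gamma ((d : ℝ) / 2) := Real.Gamma_pos_of_pos (by linarith)
  have hG2 : 0 < Real.Gamma (1 / 2) := Real.Gamma_pos_of_pos (by norm_num)
  have hG3 : 0 < Real.Gamma a := Real.Gamma_pos_of_pos ha0
  have hP : 0 < (1 / (L * γ / 2)) ^ a := by positivity
  have h := hmain.div_const ((1 / (L * γ / 2)) ^ a * Real.Gamma a)
  rw [div_self (by positivity)] at h
  refine h.congr' ?_
  filter_upwards [eventually_gt_atTop 0] with u hu
  have hs : 0 < u ^ γ := Real.rpow_pos_of_pos hu γ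
  rw [aux_cov _ _ hs]
  have hint : ∫ t in Set.Ioi (0 : ℝ), (Set.Ioo (0 : ℝ) (u ^ γ)).indicator
        (fun t => F (u * (1 - t / u ^ γ) ^ (-(1 : ℝ) / 2)) * (1 - t / u ^ γ) ^ (-(1 : ℝ) / 2) *
          (1 - (1 - t / u ^ γ)) ^ (a - 1)) t =
      (C * u ^ β * Real.exp (-L * u ^ γ) * (u ^ γ) ^ (-(a - 1))) *
      ∫ t in Set.Ioi (0 : ℝ), (Set.Ioo (0 : ℝ) (u ^ γ)).indicator
        (fun t => F (u * (1 - t / u ^ γ) ^ (-(1 : ℝ) / 2)) * (1 - t / u ^ γ) ^ (-(1 : ℝ) / 2) *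
          t ^ (a - 1) / (C * u ^ β * Real.exp (-L * u ^ γ))) t := by
    rw [← integral_const_mul]
    congr 1
    ext t
    by_cases hts : t ∈ Set.Ioo (0 : ℝ) (u ^ γ)
    · rw [Set.indicator_of_mem hts, Set.indicator_of_mem hts, sub_sub_cancel,
        Real.div_rpow hts.1.le hs.le, Real.rpow_neg hs.le]
      have := (Real.rpow_pos_of_pos hs (a - 1)).ne'
      have := (Real.rpow_pos_of_pos hu β).ne'
      have := (Real.exp_pos (-L * u ^ γ)).ne'
      generalize Real.exp (-L * u ^ γ) = e at *
      field_simp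
    · rw [Set.indicator_of_notMem hts, Set.indicator_of_notMem hts, mul_zero]
  rw [hint]
  generalize (∫ t in Set.Ioi (0 : ℝ), (Set.Ioo (0 : ℝ) (u ^ γ)).indicator
        (fun t => F (u * (1 - t / u ^ γ) ^ (-(1 : ℝ) / 2)) * (1 - t / u ^ γ) ^ (-(1 : ℝ) / 2) *
          t ^ (a - 1) / (C * u ^ β * Real.exp (-L * u ^ γ))) t) = J
  have e4 : (γ * L / 2) ^ (-a) = (1 / (L * γ / 2)) ^ a := by
    rw [Real.rpow_neg (by positivity), one_div, Real.inv_rpow (by positivity), mul_comm γ L]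
  have e5 : (u ^ γ) ^ (-(a - 1)) = u ^ γ * u ^ (-(γ * a)) := by
    rw [← Real.rpow_mul hu.le, ← Real.rpow_add hu]; congr 1; ring
  have e6 : u ^ (β - γ * a) = u ^ β * u ^ (-(γ * a)) := by
    rw [← Real.rpow_add hu]; congr 1
  rw [e4, e5, e6]
  have k1 := (Real.rpow_pos_of_pos hu β).ne'
  have k2 := (Real.rpow_pos_of_pos hu (-(γ * a))).ne'
  have k3 := (Real.exp_pos (-L * u ^ γ)).ne'
  have k4 := hs.ne'
  generalize Real.exp (-L * u ^ γ) = E at *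
  generalize u ^ (-(γ * a)) = U1 at *
  generalize u ^ β = U2 at *
  generalize u ^ γ = U3 at *
  generalize (1 / (L * γ / 2)) ^ a = U4 at *
  have k5 := hP.ne'
  field_simp
end

section
/- Let d ≥ 2 be an integer and let (Ω, 𝔽, ℙ) be a probability space carrying: a random variable R : Ω → ℝ with ℙ(R > 0) = 1 whose survival function u ↦ ℙ(R > u) has a Weibullian tail with parameters (C, β, L, γ); and a random vector G : Ω → ℝ^d, independent of R, whose law is the d-dimensional standard Gaussian measure. Define Z₁(ω) := R(ω)·G₁(ω)/‖G(ω)‖, where G₁ is the first coordinate of G and ‖·‖ is the Euclidean norm (Z₁ is defined ℙ-a.s. since G ≠ 0 a.s.). Then lim_{u→∞} ℙ(Z₁ > u) / [ (1/2)·(Γ(d/2)/Γ(1/2)) · C · (γ·L/2)^{−(d−1)/2} · u^{β − γ(d−1)/2} · exp(−L·u^γ) ] = 1. In particular, the margins of a d-dimensional elliptical random vector with Weibullian radius R again have Weibullian tails, with parameters C' = (Γ(d/2)/(2Γ(1/2)))·C·(γL/2)^{−(d−1)/2}, β' = β − γ(d−1)/2, and the same L and γ. -/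
open MeasureTheory ProbabilityTheory Real Filter

lemma aux_pi_gauss (n : ℕ) : Measure.pi (fun _ : Fin n => gaussianReal 0 1) =
    (volume : Measure (Fin n → ℝ)).withDensity
      (fun x => ENNReal.ofReal (∏ i, gaussianPDFReal 0 1 (x i))) := by
  refine Measure.pi_eq fun s hs => ?_
  rw [withDensity_apply _ (MeasurableSet.univ_pi hs), volume_pi, Measure.restrict_pi_pi,
    ← ofReal_integral_eq_lintegral_ofReal]
  · rw [integral_fintype_prod_eq_prod (fun _ x => gaussianPDFReal 0 1 x),
      ENNReal.ofReal_prod_of_nonneg]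
    · refine Finset.prod_congr rfl fun i _ => ?_
      rw [gaussianReal_apply_eq_integral _ (by simp)]
    · intro i _
      exact integral_nonneg fun x => gaussianPDFReal_nonneg _ _ _
  · exact Integrable.fintype_prod (f := fun _ x => gaussianPDFReal 0 1 x)
      (fun i => (integrable_gaussianPDFReal 0 1).restrict)
  · exact ae_of_all _ fun x => Finset.prod_nonneg fun i _ => gaussianPDFReal_nonneg _ _ _

lemma aux_meas_prod (n : ℕ) :
    Measurable (fun x : Fin n → ℝ => ∏ i, gaussianPDFReal 0 1 (x i)) :=
  Finset.measurable_prod _ fun i _ => (measurable_gaussianPDFReal 0 1).comp (measurable_pi_apply i)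

lemma aux_pi_int (n : ℕ) (f : (Fin n → ℝ) → ℝ) :
    ∫ x, f x ∂(Measure.pi (fun _ : Fin n => gaussianReal 0 1)) =
      ∫ x, (∏ i, gaussianPDFReal 0 1 (x i)) * f x := by
  rw [aux_pi_gauss, integral_withDensity_eq_integral_toReal_smul
    (aux_meas_prod n).ennreal_ofReal (by simp)]
  refine integral_congr_ae (ae_of_all _ fun x => ?_)
  simp only [smul_eq_mul]
  rw [ENNReal.toReal_ofReal (Finset.prod_nonneg fun i _ => gaussianPDFReal_nonneg _ _ _)]

/-- key exponent limit -/
lemma aux_slope (a s : ℝ) :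
    Tendsto (fun U : ℝ => U * ((1 + s / U) ^ a - 1)) atTop (nhds (a * s)) := by
  have h : HasDerivAt (fun t : ℝ => (1 + s * t) ^ a) (a * s) 0 := by
    have h1 : HasDerivAt (fun t : ℝ => 1 + s * t) s 0 := by
      simpa using ((hasDerivAt_id (0:ℝ)).const_mul s).const_add 1
    have := h1.rpow_const (p := a) (Or.inl (by simp))
    simpa [mul_comm] using this
  have h2 := hasDerivAt_iff_tendsto_slope_zero.1 h
  have h3 : Tendsto (fun U : ℝ => U⁻¹) atTop (nhdsWithin 0 {0}ᶜ) := by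
    refine tendsto_nhdsWithin_iff.2 ⟨tendsto_inv_atTop_zero, ?_⟩
    filter_upwards [eventually_gt_atTop 0] with U hU
    simpa using hU.ne'
  refine (h2.comp h3).congr fun U => ?_
  simp [div_eq_mul_inv]

/-- elementary bound -/
lemma aux_bound_s14 (L a β : ℝ) (hL : 0 < L) (ha : 0 < a) (n : ℕ) (hn : 1 ≤ n) (U s : ℝ) (hs : 0 ≤ s)
    (hU : 0 < U) (hU1 : |β| ≤ L * a / 2 * U) (hU2 : n ≤ L * a / 2 * U) :
    (1 + s / U) ^ β * exp (-L * (U * ((1 + s / U) ^ a - 1))) ≤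
      ((1 + L * a / 2 * s / n) ^ n)⁻¹ := by
  set x := s / U with hx
  have hx0 : 0 ≤ x := by positivity
  have hn0 : (0:ℝ) < n := by exact_mod_cast hn
  have h1 : 1 ≤ 1 + x := by linarith
  have h1' : 0 < 1 + x := by linarith
  have e1 : a * log (1 + x) ≤ (1 + x) ^ a - 1 := by
    rw [rpow_def_of_pos h1', mul_comm]
    linarith [add_one_le_exp (log (1 + x) * a)]
  have e2 : exp (-L * (U * ((1 + x) ^ a - 1))) ≤ (1 + x) ^ (-(L * U * a)) := by
    rw [rpow_def_of_pos h1' (-(L * U * a)), exp_le_exp]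
    nlinarith [mul_le_mul_of_nonneg_left e1 (mul_pos hL hU).le]
  have e3 : (1 + x) ^ β * exp (-L * (U * ((1 + x) ^ a - 1))) ≤ (1 + x) ^ (-(L * a / 2 * U)) := by
    calc _ ≤ (1 + x) ^ β * (1 + x) ^ (-(L * U * a)) := by gcongr
      _ = (1 + x) ^ (β - L * U * a) := by rw [← rpow_add h1']; rfl
      _ ≤ _ := by
        apply rpow_le_rpow_of_exponent_le h1
        linarith [le_abs_self β]
  refine e3.trans ?_
  rw [rpow_neg h1'.le]
  apply inv_anti₀ (by positivity)
  have e4 : 1 + (L * a / 2 * U / n) * x ≤ (1 + x) ^ (L * a / 2 * U / n) :=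
    one_add_mul_self_le_rpow_one_add (by linarith) (by rwa [le_div_iff₀ hn0, one_mul])
  have e5 : (1 + x) ^ (L * a / 2 * U) = ((1 + x) ^ (L * a / 2 * U / n)) ^ n := by
    rw [← rpow_mul_natCast h1'.le]; congr 1; field_simp
  rw [e5]
  have e6 : L * a / 2 * s / n = (L * a / 2 * U / n) * x := by rw [hx]; field_simp
  rw [e6]
  gcongr

lemma aux_dom (c : ℝ) (hc : 0 < c) (n : ℕ) :
    Integrable (fun y : Fin n → ℝ => ((1 + c * ∑ i, y i ^ 2) ^ n)⁻¹) := by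
  have h1 : Integrable (fun t : ℝ => (1 + c * t ^ 2)⁻¹) := by
    have := integrable_inv_one_add_sq.comp_mul_left' (R := √c) (by positivity)
    simpa [mul_pow, Real.sq_sqrt hc.le] using this
  have h2 : Integrable (fun y : Fin n → ℝ => ∏ i, (1 + c * y i ^ 2)⁻¹) :=
    Integrable.fintype_prod (f := fun _ t => (1 + c * t ^ 2)⁻¹) (fun _ => h1)
  refine h2.mono' (Measurable.aestronglyMeasurable (by fun_prop)) (ae_of_all _ fun y => ?_)
  have hS : 0 ≤ ∑ i, y i ^ 2 := Finset.sum_nonneg fun i _ => sq_nonneg _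
  rw [Real.norm_of_nonneg (by positivity), Finset.prod_inv_distrib]
  apply inv_anti₀ (Finset.prod_pos fun i _ => by positivity)
  calc ∏ i, (1 + c * y i ^ 2) ≤ ∏ _i : Fin n, (1 + c * ∑ i, y i ^ 2) := by
        apply Finset.prod_le_prod
        · intro i _; positivity
        · intro i _
          have : y i ^ 2 ≤ ∑ i, y i ^ 2 :=
            Finset.single_le_sum (f := fun i => y i ^ 2) (fun i _ => sq_nonneg _) (Finset.mem_univ i)
          gcongr
    _ = _ := by simp

lemma aux_ratio_eq (Fb : ℝ → ℝ) (C L γ β : ℝ) (hC : 0 < C) 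
    (u s : ℝ) (hs : 0 ≤ s) (hu : 0 < u) :
    Fb (u * √(1 + s / u ^ γ)) / (C * u ^ β * exp (-L * u ^ γ)) =
     Fb (u * √(1 + s / u ^ γ)) / (C * (u * √(1 + s / u ^ γ)) ^ β *
        exp (-L * (u * √(1 + s / u ^ γ)) ^ γ)) *
     ((1 + s / u ^ γ) ^ (β / 2) * exp (-L * (u ^ γ * ((1 + s / u ^ γ) ^ (γ / 2) - 1)))) := by
  have hU : 0 < u ^ γ := rpow_pos_of_pos hu _
  have h1 : 0 < 1 + s / u ^ γ := by positivity
  have k : ∀ b : ℝ, (u * √(1 + s / u ^ γ)) ^ b = u ^ b * (1 + s / u ^ γ) ^ (b / 2) := by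
    intro b
    rw [mul_rpow hu.le (by positivity), sqrt_eq_rpow, ← rpow_mul h1.le]
    congr 2; ring
  rw [k β, k γ]
  have : exp (-L * u ^ γ) * exp (-L * (u ^ γ * ((1 + s / u ^ γ) ^ (γ / 2) - 1)))
     = exp (-L * (u ^ γ * (1 + s / u ^ γ) ^ (γ / 2))) := by
    rw [← exp_add]; congr 1; ring
  rw [← this]
  have := rpow_pos_of_pos h1 (β / 2)
  have := rpow_pos_of_pos hu β
  field_simp

lemma aux_ge (u s γ : ℝ) (hs : 0 ≤ s) (hu : 0 < u) : u ≤ u * √(1 + s / u ^ γ) := by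
  have hU : 0 < u ^ γ := rpow_pos_of_pos hu _
  have : 1 ≤ √(1 + s / u ^ γ) := by
    rw [one_le_sqrt]; have : 0 ≤ s / u ^ γ := by positivity
    linarith
  nlinarith

lemma aux_lim (Fb : ℝ → ℝ) (C L γ β : ℝ) (hC : 0 < C) (hγ : 0 < γ)
    (htail : Tendsto (fun u => Fb u / (C * u ^ β * exp (-L * u ^ γ))) atTop (nhds 1))
    (s : ℝ) (hs : 0 ≤ s) :
    Tendsto (fun u => Fb (u * √(1 + s / u ^ γ)) / (C * u ^ β * exp (-L * u ^ γ))) atTop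
      (nhds (exp (-L * (γ / 2 * s)))) := by
  have hU := tendsto_rpow_atTop hγ
  have h1 : Tendsto (fun u : ℝ => u * √(1 + s / u ^ γ)) atTop atTop := by
    refine tendsto_atTop_mono' _ ?_ tendsto_id
    filter_upwards [eventually_gt_atTop 0] with u hu
    exact aux_ge u s γ hs hu
  have h2 : Tendsto (fun u : ℝ => (1 + s / u ^ γ) ^ (β / 2)) atTop (nhds 1) := by
    have : Tendsto (fun u : ℝ => 1 + s / u ^ γ) atTop (nhds 1) := by
      simpa using (hU.const_div_atTop s).const_add 1
    simpa using this.rpow_const (p := β / 2) (Or.inl one_ne_zero)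
  have h3 := (aux_slope (γ / 2) s).comp hU
  have h4 := (continuous_exp.tendsto _).comp (h3.const_mul (-L))
  have h5 := (htail.comp h1).mul (h2.mul h4)
  simp only [one_mul] at h5
  refine h5.congr' ?_
  filter_upwards [eventually_gt_atTop 0] with u hu
  rw [aux_ratio_eq Fb C L γ β hC u s hs hu]
  rfl

lemma aux_unif (Fb : ℝ → ℝ) (C L γ β : ℝ) (hC : 0 < C) (hL : 0 < L) (hγ : 0 < γ)
    (htail : Tendsto (fun u => Fb u / (C * u ^ β * exp (-L * u ^ γ))) atTop (nhds 1))
    (n : ℕ) (hn : 1 ≤ n) :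
    ∀ᶠ u in atTop, ∀ s, 0 ≤ s → 
      Fb (u * √(1 + s / u ^ γ)) / (C * u ^ β * exp (-L * u ^ γ)) ≤
        2 * ((1 + L * (γ / 2) / 2 / n * s) ^ n)⁻¹ := by
  have hU := tendsto_rpow_atTop hγ
  have hU' : Tendsto (fun u : ℝ => L * (γ / 2) / 2 * u ^ γ) atTop atTop :=
    hU.const_mul_atTop (by positivity)
  obtain ⟨u0, hu0⟩ := eventually_atTop.1 (htail.eventually (eventually_le_nhds (b := 2) (by norm_num)))
  filter_upwards [eventually_ge_atTop u0, eventually_gt_atTop 0,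
    hU'.eventually_ge_atTop |β / 2|, hU'.eventually_ge_atTop (n:ℝ)] with u h0 hu h1 h2 s hs
  rw [aux_ratio_eq Fb C L γ β hC u s hs hu]
  have hp : 0 < u ^ γ := rpow_pos_of_pos hu _
  have hb := aux_bound_s14 L (γ / 2) (β / 2) hL (by positivity) n hn (u ^ γ) s hs hp h1 h2
  have e : L * (γ / 2) / 2 / n * s = L * (γ / 2) / 2 * s / n := by ring
  rw [e]
  have h3 := hu0 _ (h0.trans (aux_ge u s γ hs hu))
  exact (mul_le_mul_of_nonneg_right h3 (by positivity)).trans 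
    (mul_le_mul_of_nonneg_left hb (by norm_num))

lemma aux_rep (n : ℕ) (Ω : Type*) [MeasurableSpace Ω] (P : Measure Ω) [IsProbabilityMeasure P]
    (R : Ω → ℝ) (G : Ω → Fin (n + 1) → ℝ)
    (hRmeas : Measurable R) (hGmeas : Measurable G)
    (hRpos : P {ω | 0 < R ω} = 1)
    (hGlaw : Measure.map G P = Measure.pi (fun _ : Fin (n + 1) => gaussianReal 0 1))
    (hindep : IndepFun R G P) (hFb : Measurable (fun t => (P {ω | t < R ω}).toReal))
    (u : ℝ) (hu : 0 < u) :
    (P {ω | u < R ω * G ω 0 / √(∑ i, (G ω i) ^ 2)}).toReal =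
      ∫ g in Set.Ioi 0, gaussianPDFReal 0 1 g * ∫ x : Fin n → ℝ,
        (∏ i, gaussianPDFReal 0 1 (x i)) *
          (P {ω | u * √(g ^ 2 + ∑ i, x i ^ 2) / g < R ω}).toReal := by
  have hprod := hindep.map_prod_eq_prod_map_map hRmeas.aemeasurable hGmeas.aemeasurable
  have : IsProbabilityMeasure (Measure.map R P) := Measure.isProbabilityMeasure_map hRmeas.aemeasurable
  set S : Set (ℝ × (Fin (n + 1) → ℝ)) := {p | u < p.1 * p.2 0 / √(∑ i, (p.2 i) ^ 2)} with hS
  have hSm : MeasurableSet S := measurableSet_lt measurable_const (by fun_prop)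
  have hRae : ∀ᵐ ω ∂P, 0 < R ω := by
    rw [← prob_compl_eq_zero_iff (measurableSet_lt measurable_const hRmeas)] at hRpos
    exact hRpos
  have e1 : P {ω | u < R ω * G ω 0 / √(∑ i, (G ω i) ^ 2)} =
      ∫⁻ y, Measure.map R P ((fun x => (x, y)) ⁻¹' S)
        ∂(Measure.pi (fun _ : Fin (n + 1) => gaussianReal 0 1)) := by
    rw [← hGlaw, ← Measure.prod_apply_symm hSm, ← hprod,
      Measure.map_apply (hRmeas.prodMk hGmeas) hSm]
    rfl
  have e2 : ∀ y : Fin (n + 1) → ℝ, Measure.map R P ((fun x => (x, y)) ⁻¹' S) =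
      (if 0 < y 0 then P {ω | u * √(∑ i, (y i) ^ 2) / y 0 < R ω} else 0) := by
    intro y
    rw [Measure.map_apply hRmeas (measurable_prodMk_right hSm)]
    split_ifs with hy
    · have hpos : 0 < √(∑ i, (y i) ^ 2) := by
        apply sqrt_pos.2
        exact Finset.sum_pos' (fun i _ => sq_nonneg _) ⟨0, Finset.mem_univ _, by positivity⟩
      congr 1
      ext ω
      simp only [hS, Set.mem_preimage, Set.mem_ofPred_eq]
      rw [lt_div_iff₀ hpos, div_lt_iff₀ hy]
    · have : ∀ᵐ ω ∂P, ¬ (ω ∈ R ⁻¹' ((fun x => (x, y)) ⁻¹' S)) := by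
        filter_upwards [hRae] with ω hω
        simp only [hS, Set.mem_preimage, Set.mem_ofPred_eq, not_lt]
        refine le_trans ?_ hu.le
        exact div_nonpos_of_nonpos_of_nonneg
          (mul_nonpos_of_nonneg_of_nonpos hω.le (not_lt.1 hy)) (sqrt_nonneg _)
      rw [ae_iff] at this
      simp only [not_not] at this
      exact this
  set H : (ℝ × (Fin n → ℝ)) → ℝ := fun p =>
    if 0 < p.1 then (P {ω | u * √(p.1 ^ 2 + ∑ i, p.2 i ^ 2) / p.1 < R ω}).toReal else 0 with hH
  have hHm : Measurable H := by
    refine Measurable.ite (measurableSet_lt measurable_const measurable_fst) ?_ measurable_const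
    exact hFb.comp (g := fun t => (P {ω | t < R ω}).toReal) 
      (f := fun p : ℝ × (Fin n → ℝ) => u * √(p.1 ^ 2 + ∑ i, p.2 i ^ 2) / p.1) (by fun_prop)
  have hHb : ∀ p, ‖H p‖ ≤ 1 := by
    intro p
    simp only [hH]
    split_ifs
    · rw [Real.norm_of_nonneg ENNReal.toReal_nonneg]
      exact ENNReal.toReal_le_of_le_ofReal zero_le_one (by simpa using prob_le_one)
    · simp
  have e3 : (P {ω | u < R ω * G ω 0 / √(∑ i, (G ω i) ^ 2)}).toReal =
      ∫ y, H (MeasurableEquiv.piFinSuccAbove (fun _ => ℝ) 0 y)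
        ∂(Measure.pi (fun _ : Fin (n + 1) => gaussianReal 0 1)) := by
    rw [e1, ← integral_toReal (measurable_measure_prodMk_right hSm).aemeasurable
      (ae_of_all _ fun y => measure_lt_top _ _)]
    refine integral_congr_ae (ae_of_all _ fun y => ?_)
    simp only [e2, hH, MeasurableEquiv.piFinSuccAbove_apply, Fin.insertNthEquiv_symm_apply,
      Fin.removeNth_zero, Fin.tail, Fin.sum_univ_succ]
    split_ifs <;> simp
  have hmp := measurePreserving_piFinSuccAbove (fun _ : Fin (n + 1) => gaussianReal 0 1) 0
  rw [e3, hmp.integral_comp' (g := H), integral_prod _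
    ((integrable_const (1:ℝ)).mono' hHm.aestronglyMeasurable (ae_of_all _ hHb)),
    integral_gaussianReal_eq_integral_smul (by simp), ← integral_indicator measurableSet_Ioi]
  refine integral_congr_ae (ae_of_all _ fun g => ?_)
  simp only [smul_eq_mul, aux_pi_int, Set.indicator, Set.mem_Ioi, hH]
  split_ifs <;> simp

lemma aux_rep2 (n : ℕ) (Fb : ℝ → ℝ) (u k g : ℝ) (hk : 0 < k) (hg : 0 < g) :
    ∫ x : Fin n → ℝ, (∏ i, gaussianPDFReal 0 1 (x i)) * Fb (u * √(g ^ 2 + ∑ i, x i ^ 2) / g) =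
     g ^ n * k ^ n * ∫ y : Fin n → ℝ, (∏ i, gaussianPDFReal 0 1 (g * k * y i)) *
       Fb (u * √(1 + k ^ 2 * ∑ i, y i ^ 2)) := by
  have h := Measure.integral_comp_smul (volume : Measure (Fin n → ℝ))
    (fun x : Fin n → ℝ => (∏ i, gaussianPDFReal 0 1 (x i)) * Fb (u * √(g ^ 2 + ∑ i, x i ^ 2) / g))
    (g * k)
  have e : ∀ y : Fin n → ℝ, u * √(g ^ 2 + ∑ i, ((g * k) • y) i ^ 2) / g =
      u * √(1 + k ^ 2 * ∑ i, y i ^ 2) := by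
    intro y
    have : g ^ 2 + ∑ i, ((g * k) • y) i ^ 2 = g ^ 2 * (1 + k ^ 2 * ∑ i, y i ^ 2) := by
      simp only [Pi.smul_apply, smul_eq_mul, mul_pow, ← Finset.mul_sum]; ring
    rw [this, sqrt_mul (by positivity), sqrt_sq hg.le]
    field_simp
  simp only [e] at h
  simp only [Pi.smul_apply, smul_eq_mul, Module.finrank_fin_fun] at h
  rw [h, abs_of_pos (by positivity)]
  field_simp
  ring

lemma aux_pdf_le (x : ℝ) : gaussianPDFReal 0 1 x ≤ (√(2 * π))⁻¹ := by
  rw [gaussianPDFReal]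
  simp only [NNReal.coe_one, mul_one]
  have : exp (-(x - 0) ^ 2 / 2) ≤ 1 := by
    rw [exp_le_one_iff]; nlinarith [sq_nonneg (x - 0)]
  exact mul_le_of_le_one_right (by positivity) this

lemma aux_pdf_prod_le (n : ℕ) (x : Fin n → ℝ) :
    ∏ i, gaussianPDFReal 0 1 (x i) ≤ (√(2 * π))⁻¹ ^ n := by
  calc _ ≤ ∏ _i : Fin n, (√(2 * π))⁻¹ := Finset.prod_le_prod
        (fun i _ => gaussianPDFReal_nonneg _ _ _) (fun i _ => aux_pdf_le _)
    _ = _ := by simp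

lemma aux_gauss_int (n : ℕ) (b : ℝ) :
    ∫ y : Fin n → ℝ, exp (-b * ∑ i, y i ^ 2) = √(π / b) ^ n := by
  rw [← integral_gaussian]
  have := integral_fintype_prod_volume_eq_pow (ι := Fin n) (fun t : ℝ => exp (-b * t ^ 2))
  simp only [Fintype.card_fin] at this
  rw [← this]
  congr 1; ext y
  rw [← exp_sum, Finset.mul_sum]

lemma aux_moment (n : ℕ) : IntegrableOn (fun g => gaussianPDFReal 0 1 g * g ^ n) (Set.Ioi 0) ∧
    ∫ g in Set.Ioi 0, gaussianPDFReal 0 1 g * g ^ n =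
      (√(2 * π))⁻¹ * ((1 / 2 : ℝ) ^ (-((n:ℝ) + 1) / 2) * (1 / 2) * Gamma (((n:ℝ) + 1) / 2)) := by
  have hn : (-1 : ℝ) < n := by have : (0:ℝ) ≤ n := n.cast_nonneg
                               linarith
  have e : Set.EqOn (fun g : ℝ => gaussianPDFReal 0 1 g * g ^ n)
      (fun g => (√(2 * π))⁻¹ * (g ^ (n:ℝ) * exp (-(1 / 2) * g ^ (2:ℝ)))) (Set.Ioi 0) := by
    intro g _
    simp only [gaussianPDFReal, NNReal.coe_one, mul_one, rpow_natCast, sub_zero]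
    rw [show g ^ (2:ℝ) = g ^ 2 by norm_cast, show -g ^ 2 / 2 = -(1/2) * g ^ 2 by ring]
    ring
  constructor
  · refine IntegrableOn.congr_fun ?_ e.symm measurableSet_Ioi
    exact (integrableOn_rpow_mul_exp_neg_mul_rpow hn (by norm_num) (by norm_num)).const_mul _
  · rw [setIntegral_congr_fun measurableSet_Ioi e, integral_const_mul,
      integral_rpow_mul_exp_neg_mul_rpow (by norm_num) hn (by norm_num)]

lemma aux_const (n : ℕ) (L γ : ℝ) (hL : 0 < L) (hγ : 0 < γ) :
    (√(2 * π))⁻¹ * ((1 / 2 : ℝ) ^ (-((n:ℝ) + 1) / 2) * (1 / 2) * Gamma (((n:ℝ) + 1) / 2)) *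
      ((√(2 * π))⁻¹ ^ n * √(π / (L * (γ / 2))) ^ n) =
    (1 / 2) * (Gamma (((n:ℝ) + 1) / 2) / Gamma (1 / 2)) * (γ * L / 2) ^ (-(n:ℝ) / 2) := by
  have h1 : (√(2 * π))⁻¹ ^ n * √(π / (L * (γ / 2))) ^ n = (1/2 : ℝ) ^ ((n:ℝ) / 2) *
      (γ * L / 2) ^ (-(n:ℝ) / 2) := by
    rw [← mul_pow, ← sqrt_inv, ← sqrt_mul (by positivity), sqrt_eq_rpow, ← rpow_mul_natCast (by positivity)]
    rw [show (-(n:ℝ) / 2) = -((n:ℝ) / 2) by ring, rpow_neg (by positivity), ← inv_rpow (by positivity),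
      ← mul_rpow (by positivity) (by positivity)]
    congr 1
    · field_simp
    · ring
  have h2 : (1 / 2 : ℝ) ^ (-((n:ℝ) + 1) / 2) * (1/2 : ℝ) ^ ((n:ℝ) / 2) = √2 := by
    rw [← rpow_add (by norm_num), show -((n:ℝ) + 1) / 2 + (n:ℝ) / 2 = -(1/2) by ring,
      one_div, inv_rpow (by norm_num), rpow_neg (by norm_num), inv_inv, sqrt_eq_rpow, one_div]
  have h3 : (√(2 * π))⁻¹ * √2 = (√π)⁻¹ := by
    rw [sqrt_mul (by norm_num)]; field_simp
  rw [h1, Gamma_one_half_eq, div_eq_mul_inv _ (√π), ← h3, ← h2]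
  ring

lemma aux_meas_J (n : ℕ) (Fb : ℝ → ℝ) (hFb : Measurable Fb) (u k D : ℝ) :
    Measurable (fun p : ℝ × (Fin n → ℝ) => (∏ i, gaussianPDFReal 0 1 (p.1 * k * p.2 i)) *
       (Fb (u * √(1 + (∑ i, p.2 i ^ 2) / u ^ D)))) := by
  refine Measurable.mul ?_ ?_
  · refine Finset.measurable_prod _ fun i _ => ?_
    exact (measurable_gaussianPDFReal 0 1).comp (by fun_prop)
  · exact hFb.comp (by fun_prop)

lemma aux_main_s14 (n : ℕ) (hn : 1 ≤ n) (Fb : ℝ → ℝ) (hFb : Measurable Fb) (hF0 : ∀ t, 0 ≤ Fb t)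
    (C L γ β : ℝ) (hC : 0 < C) (hL : 0 < L) (hγ : 0 < γ)
    (htail : Tendsto (fun u => Fb u / (C * u ^ β * exp (-L * u ^ γ))) atTop (nhds 1)) :
    Tendsto (fun u : ℝ => ∫ g in Set.Ioi 0, (gaussianPDFReal 0 1 g * g ^ n) *
      ∫ y : Fin n → ℝ, (∏ i, gaussianPDFReal 0 1 (g * u ^ (-γ / 2) * y i)) *
       (Fb (u * √(1 + (∑ i, y i ^ 2) / u ^ γ)) / (C * u ^ β * exp (-L * u ^ γ)))) atTop
      (nhds ((1 / 2) * (Gamma (((n:ℝ) + 1) / 2) / Gamma (1 / 2)) *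
        (γ * L / 2) ^ (-(n:ℝ) / 2))) := by
  have hn0 : (0:ℝ) < n := by exact_mod_cast hn
  rw [← aux_const n L γ hL hγ, ← (aux_moment n).2, ← integral_mul_const]
  have hdom := aux_dom (L * (γ / 2) / 2 / n) (by positivity) n
  have hunif := aux_unif Fb C L γ β hC hL hγ htail n hn
  set M : ℝ := (√(2 * π))⁻¹ ^ n with hM
  have hM0 : 0 ≤ M := by positivity
  set B : (Fin n → ℝ) → ℝ := fun y => M * (2 * ((1 + L * (γ / 2) / 2 / n * ∑ i, y i ^ 2) ^ n)⁻¹)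
    with hB
  have hBint : Integrable B := (hdom.const_mul 2).const_mul M
  have hS : ∀ y : Fin n → ℝ, 0 ≤ ∑ i, y i ^ 2 := fun y => Finset.sum_nonneg fun i _ => sq_nonneg _
  have hmeas : ∀ u : ℝ, Measurable (fun p : ℝ × (Fin n → ℝ) =>
      (∏ i, gaussianPDFReal 0 1 (p.1 * u ^ (-γ / 2) * p.2 i)) *
       (Fb (u * √(1 + (∑ i, p.2 i ^ 2) / u ^ γ)) / (C * u ^ β * exp (-L * u ^ γ)))) := by
    intro u
    simp only [← mul_div_assoc]
    exact (aux_meas_J n Fb hFb u (u ^ (-γ / 2)) γ).div_const _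
  -- pointwise bound
  have hbd : ∀ᶠ u in atTop, ∀ (g : ℝ) (y : Fin n → ℝ),
      ‖(∏ i, gaussianPDFReal 0 1 (g * u ^ (-γ / 2) * y i)) *
       (Fb (u * √(1 + (∑ i, y i ^ 2) / u ^ γ)) / (C * u ^ β * exp (-L * u ^ γ)))‖ ≤ B y := by
    filter_upwards [hunif, eventually_gt_atTop 0] with u hu hu0 g y
    have hp : 0 < u ^ β := rpow_pos_of_pos hu0 _
    have h1 : 0 ≤ ∏ i, gaussianPDFReal 0 1 (g * u ^ (-γ / 2) * y i) :=
      Finset.prod_nonneg fun i _ => gaussianPDFReal_nonneg _ _ _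
    have h2 : 0 ≤ Fb (u * √(1 + (∑ i, y i ^ 2) / u ^ γ)) / (C * u ^ β * exp (-L * u ^ γ)) :=
      div_nonneg (hF0 _) (by positivity)
    rw [Real.norm_of_nonneg (mul_nonneg h1 h2)]
    exact mul_le_mul (aux_pdf_prod_le n _) (hu _ (hS y)) h2 hM0
  -- inner limit
  have hin : ∀ g : ℝ, Tendsto (fun u : ℝ => ∫ y : Fin n → ℝ,
      (∏ i, gaussianPDFReal 0 1 (g * u ^ (-γ / 2) * y i)) *
       (Fb (u * √(1 + (∑ i, y i ^ 2) / u ^ γ)) / (C * u ^ β * exp (-L * u ^ γ)))) atTop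
       (nhds (M * √(π / (L * (γ / 2))) ^ n)) := by
    intro g
    rw [← aux_gauss_int, ← integral_const_mul]
    refine tendsto_integral_filter_of_dominated_convergence B ?_ ?_ hBint ?_
    · exact Eventually.of_forall fun u =>
        ((hmeas u).comp (measurable_prodMk_left (x := g))).aestronglyMeasurable
    · filter_upwards [hbd] with u hu
      exact ae_of_all _ (hu g)
    · refine ae_of_all _ fun y => ?_
      refine Tendsto.mul ?_ ?_
      · have : M = ∏ _i : Fin n, (√(2 * π))⁻¹ := by simp [hM]
        rw [this]
        refine tendsto_finsetProd _ fun i _ => ?_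
        have hk : Tendsto (fun u : ℝ => u ^ (-γ / 2)) atTop (nhds 0) := by
          have := tendsto_rpow_neg_atTop (y := γ / 2) (by positivity)
          simpa [neg_div] using this
        have h1 : Tendsto (fun u : ℝ => g * u ^ (-γ / 2) * y i) atTop (nhds 0) := by
          simpa using (hk.const_mul g).mul_const (y i)
        have hc : Continuous (gaussianPDFReal 0 1) := by
          rw [gaussianPDFReal_def]; fun_prop
        have h2 := (hc.tendsto 0).comp h1
        simpa [gaussianPDFReal, Function.comp_def] using h2
      · have := aux_lim Fb C L γ β hC hγ htail _ (hS y)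
        convert this using 2
        ring_nf
  refine tendsto_integral_filter_of_dominated_convergence
    (fun g => ‖gaussianPDFReal 0 1 g * g ^ n‖ * ∫ y, B y) ?_ ?_ ?_ ?_
  · refine Eventually.of_forall fun u => ?_
    refine AEStronglyMeasurable.mul ?_ ?_
    · exact ((measurable_gaussianPDFReal 0 1).mul (measurable_id.pow_const n)).aestronglyMeasurable
    · exact (hmeas u).stronglyMeasurable.integral_prod_right.aestronglyMeasurable
  · filter_upwards [hbd] with u hu
    refine ae_of_all _ fun g => ?_
    rw [norm_mul]
    gcongr
    exact norm_integral_le_of_norm_le hBint (ae_of_all _ (hu g))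
  · exact (aux_moment n).1.norm.mul_const _
  · exact ae_of_all _ fun g => (hin g).const_mul _

/-- The margins of a `d`-dimensional elliptical random vector with Weibullian radius `R`
have Weibullian tails: if `Z₁ = R G₁ / ‖G‖` with `G` standard Gaussian independent of `R`,
then `P(Z₁ > u) ∼ (Γ(d/2)/(2Γ(1/2))) C (γL/2)^{-(d-1)/2} u^{β-γ(d-1)/2} exp(-L u^γ)`. -/
theorem elliptical_margin_weibullian_tail
    (d : ℕ) (hd : 2 ≤ d)
    (Ω : Type*) [MeasurableSpace Ω] (P : Measure Ω) [IsProbabilityMeasure P]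
    (R : Ω → ℝ) (G : Ω → Fin d → ℝ)
    (hRmeas : Measurable R) (hGmeas : Measurable G)
    (hRpos : P {ω | 0 < R ω} = 1)
    (hGlaw : Measure.map G P = Measure.pi (fun _ : Fin d => gaussianReal 0 1))
    (hindep : IndepFun R G P)
    (C L γ β : ℝ) (hC : 0 < C) (hL : 0 < L) (hγ : 0 < γ)
    (htail :
      Tendsto (fun u => (P {ω | u < R ω}).toReal / (C * u ^ β * Real.exp (-L * u ^ γ)))
        atTop (nhds 1)) :
    Tendsto
      (fun u =>
        (P {ω | u < R ω * G ω ⟨0, by omega⟩ / Real.sqrt (∑ i, (G ω i) ^ 2)}).toReal /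
          ((1 / 2) * (Real.Gamma ((d : ℝ) / 2) / Real.Gamma (1 / 2)) * C *
            (γ * L / 2) ^ (-((d : ℝ) - 1) / 2) * u ^ (β - γ * ((d : ℝ) - 1) / 2) *
            Real.exp (-L * u ^ γ)))
      atTop (nhds 1) := by
  obtain ⟨n, rfl⟩ : ∃ n, d = n + 1 := ⟨d - 1, by omega⟩
  have hn : 1 ≤ n := by omega
  set Fb : ℝ → ℝ := fun t => (P {ω | t < R ω}).toReal with hFbdef
  have hanti : Antitone Fb := by
    intro s t hst
    exact ENNReal.toReal_mono (measure_ne_top _ _)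
      (measure_mono fun ω (hω : t < R ω) => lt_of_le_of_lt hst hω)
  have hFb : Measurable Fb := hanti.measurable
  have hmain := aux_main_s14 n hn Fb hFb (fun t => ENNReal.toReal_nonneg) C L γ β hC hL hγ htail
  set K : ℝ := (1 / 2) * (Gamma (((n:ℝ) + 1) / 2) / Gamma (1 / 2)) *
        (γ * L / 2) ^ (-(n:ℝ) / 2) with hK
  have hK0 : 0 < K := by
    have h1 : 0 < Gamma (((n:ℝ) + 1) / 2) := Gamma_pos_of_pos (by positivity)
    have h2 : 0 < Gamma (1 / 2 : ℝ) := Gamma_pos_of_pos (by norm_num)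
    have h3 : 0 < (γ * L / 2) ^ (-(n:ℝ) / 2) := rpow_pos_of_pos (by positivity) _
    positivity
  have hfin := hmain.div_const K
  rw [div_self hK0.ne'] at hfin
  refine hfin.congr' ?_
  filter_upwards [eventually_gt_atTop 0] with u hu
  have hrep := aux_rep n Ω P R G hRmeas hGmeas hRpos hGlaw hindep hFb u hu
  have hk : 0 < u ^ (-γ / 2) := rpow_pos_of_pos hu _
  have hk2 : (u ^ (-γ / 2)) ^ 2 = (u ^ γ)⁻¹ := by
    rw [← rpow_mul_natCast hu.le, ← rpow_neg hu.le]; congr 1; push_cast; ring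
  have hkn : u ^ (β - γ * n / 2) = u ^ β * (u ^ (-γ / 2)) ^ n := by
    rw [← rpow_mul_natCast hu.le, ← rpow_add hu]; congr 1; ring
  have hub : 0 < u ^ β := rpow_pos_of_pos hu _
  have hstep : (P {ω | u < R ω * G ω 0 / √(∑ i, (G ω i) ^ 2)}).toReal =
      (u ^ (-γ / 2)) ^ n * (C * u ^ β * exp (-L * u ^ γ)) *
      ∫ g in Set.Ioi 0, (gaussianPDFReal 0 1 g * g ^ n) *
      ∫ y : Fin n → ℝ, (∏ i, gaussianPDFReal 0 1 (g * u ^ (-γ / 2) * y i)) *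
       (Fb (u * √(1 + (∑ i, y i ^ 2) / u ^ γ)) / (C * u ^ β * exp (-L * u ^ γ))) := by
    rw [hrep, ← integral_const_mul]
    refine setIntegral_congr_fun measurableSet_Ioi fun g hg => ?_
    have h2 := aux_rep2 n Fb u (u ^ (-γ / 2)) g hk hg
    simp only [hFbdef] at h2 ⊢
    simp only [hk2, inv_mul_eq_div] at h2
    rw [h2]
    have hD : C * u ^ β * exp (-L * u ^ γ) ≠ 0 := by positivity
    generalize C * u ^ β * exp (-L * u ^ γ) = D at hD ⊢
    simp only [← mul_div_assoc, integral_div]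
    rw [eq_div_iff hD]
    ring
  have hcast : (((n + 1 : ℕ) : ℝ)) = (n:ℝ) + 1 := by push_cast; ring
  change _ = (P {ω | u < R ω * G ω 0 / √(∑ i, (G ω i) ^ 2)}).toReal / _
  rw [hstep, hcast, show -((n:ℝ) + 1 - 1) / 2 = -(n:ℝ) / 2 by ring,
    show ((n:ℝ) + 1 - 1) = n by ring, hkn]
  generalize (∫ g in Set.Ioi 0, (gaussianPDFReal 0 1 g * g ^ n) *
      ∫ y : Fin n → ℝ, (∏ i, gaussianPDFReal 0 1 (g * u ^ (-γ / 2) * y i)) *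
       (Fb (u * √(1 + (∑ i, y i ^ 2) / u ^ γ)) / (C * u ^ β * exp (-L * u ^ γ)))) = I
  rw [show 1 / 2 * (Gamma (((n:ℝ) + 1) / 2) / Gamma (1 / 2)) * C * (γ * L / 2) ^ (-(n:ℝ) / 2) *
    (u ^ β * (u ^ (-γ / 2)) ^ n) * exp (-L * u ^ γ) =
    K * ((u ^ (-γ / 2)) ^ n * (C * u ^ β * exp (-L * u ^ γ))) by rw [hK]; ring]
  field_simp
end

section
/- Let d ≥ 2 be an integer and let (Ω, 𝔽, ℙ) be a probability space carrying: a random variable R : Ω → ℝ with ℙ(R > 0) = 1 whose survival function u ↦ ℙ(R > u) has a Weibullian tail with parameters (C, β, L, γ) with γ > 1; and a random vector G : Ω → ℝ^d, independent of R, whose law is the d-dimensional standard Gaussian measure. Let A be an invertible real d×d matrix, set Σ := A·A^⊤, assume Σ has unit diagonal and that every entry of Σ⁻¹·1 is strictly positive, and define Z(ω) := (R(ω)/‖G(ω)‖)·(A·G(ω)). Set λ := 1^⊤ Σ⁻¹ 1, h_j := (Σ⁻¹·1)_j, K := C·(γL)^{1−d}·Γ(d/2)·2^{d/2−1} / ( (2π)^{d/2}·(det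 Σ)^{1/2}·∏_{j=1}^d h_j ), C' := (Γ(d/2)/(2Γ(1/2)))·C·(γL/2)^{−(d−1)/2}, and β' := β − γ(d−1)/2, and let Ḡ₁(u) := ℙ(Z₁ > u) denote the common marginal survival function of Z. Let α > 0, let ℓ : (0,∞) → (0,∞) be slowly varying with (log ℓ(t))/(log t)^{1−1/γ} → 0 as t → ∞, let x_j > 0 and c_j > 0 for j = 1,…,d, and let z_j : (0,∞) → ℝ satisfy z_j(t) → ∞ and Ḡ₁(z_j(t)) = c_j·((t·x_j)^α·ℓ(t·x_j))^{−1} for all sufficiently large t. Then, as t → ∞, ℙ( Z_j > z_j(t) for all j = 1,…,d ) / [ K·λ^{(β + d + γ(1−d))/2}·(α/L)^{β/γ + 1 − d}·(log t)^{β/γ + 1 − d − (β'/γ)·λ^{γ/2}}·( t^α·ℓ(t) )^{−λ^{γ/2}}·( C'·α^{β'/γ}·L^{−β'/γ} )^{−λ^{γ/2}}·∏_{j=1}^d ( c_j^{−1}·x_j^α )^{−h_j·λ^{γ/2−1}} ] → 1. (This is the joint tail probability ℙ(X ∈ t·A_{x}) = ℙ(X_j > t·x_j, j = 1,…,d) for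 a random vector X whose margins satisfy F̄_j(t) = c_j·(t^α ℓ(t))^{−1} and which shares the elliptical copula of Z, since by the copula transform this probability equals ℙ(Z_j > Ḡ₁^←(F̄_j(t·x_j)), j = 1,…,d).) -/
open MeasureTheory ProbabilityTheory Real Filter Matrix

/-- The reference radial density, asymptotically minus the derivative of the Weibullian tail. -/
noncomputable def wdens (C L γ β r : ℝ) : ℝ := C * γ * L * r ^ (β + γ - 1) * Real.exp (-L * r ^ γ)

/-- The Weibullian tail. -/
noncomputable def wtail (C L γ β u : ℝ) : ℝ := C * u ^ β * Real.exp (-L * u ^ γ)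

/-- Squared Euclidean norm. -/
def nsq {d : ℕ} (y : Fin d → ℝ) : ℝ := ∑ j, y j ^ 2

/-- The density as a function of the squared norm. -/
noncomputable def psi (C L γ β : ℝ) (d : ℕ) (s : ℝ) : ℝ :=
  C * γ * L * s ^ ((β + γ - d) / 2) * Real.exp (-L * s ^ (γ / 2))

lemma wtail_tendsto_zero {C L γ β : ℝ} (hL : 0 < L) (hγ : 0 < γ) :
    Tendsto (wtail C L γ β) atTop (nhds 0) := by
  have h1 := tendsto_rpow_mul_exp_neg_mul_atTop_nhds_zero (β / γ) L hL
  have h2 := (h1.comp (tendsto_rpow_atTop hγ)).const_mul C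
  rw [mul_zero] at h2
  refine h2.congr' ?_
  filter_upwards [eventually_gt_atTop 0] with u hu
  simp only [wtail, Function.comp]
  rw [← Real.rpow_mul hu.le, mul_div_cancel₀ _ hγ.ne', mul_assoc]

lemma wtail_hasDerivAt {C L γ β : ℝ} (hγ : 0 < γ) (hL : 0 < L) {r : ℝ} (hr : 0 < r) :
    HasDerivAt (wtail C L γ β) (-(wdens C L γ β r * (1 - β / (γ * L) * r ^ (-γ)))) r := by
  have h1 : HasDerivAt (fun u : ℝ => u ^ β) (β * r ^ (β - 1)) r :=
    Real.hasDerivAt_rpow_const (Or.inl hr.ne')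
  have h2 : HasDerivAt (fun u : ℝ => u ^ γ) (γ * r ^ (γ - 1)) r :=
    Real.hasDerivAt_rpow_const (Or.inl hr.ne')
  have h3 := ((h1.const_mul C).mul (h2.const_mul (-L)).exp)
  refine h3.congr_deriv ?_
  simp only [wdens]
  have e1 : r ^ (β + γ - 1) = r ^ β * r ^ γ / r := by
    rw [Real.rpow_sub_one hr.ne', Real.rpow_add hr]
  rw [e1, Real.rpow_sub_one hr.ne', Real.rpow_sub_one hr.ne', Real.rpow_neg hr.le]
  have := (Real.rpow_pos_of_pos hr γ).ne'
  field_simp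
  ring

lemma wdens_nonneg {C L γ β : ℝ} (hC : 0 < C) (hγ : 0 < γ) (hL : 0 < L) {r : ℝ} (hr : 0 < r) :
    0 ≤ wdens C L γ β r := by
  unfold wdens; positivity

lemma measurable_wdens (C L γ β : ℝ) : Measurable (wdens C L γ β) := by
  unfold wdens; fun_prop

lemma wdens_lintegral {C L γ β : ℝ} (hC : 0 < C) (hγ : 0 < γ) (hL : 0 < L) {θ : ℝ} (hθ : 1 < θ) :
    ∃ a0 > (0 : ℝ), ∀ a ≥ a0,
      ENNReal.ofReal (wtail C L γ β a) ≤
        ENNReal.ofReal θ * ∫⁻ r in Set.Ioi a, ENNReal.ofReal (wdens C L γ β r) ∧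
      ∫⁻ r in Set.Ioi a, ENNReal.ofReal (wdens C L γ β r) ≤
        ENNReal.ofReal θ * ENNReal.ofReal (wtail C L γ β a) := by
  have hlim : Tendsto (fun r : ℝ => 1 - β / (γ * L) * r ^ (-γ)) atTop (nhds 1) := by
    simpa using ((tendsto_rpow_neg_atTop hγ).const_mul (β / (γ * L))).const_sub 1
  have h1 := hlim.eventually (gt_mem_nhds hθ)
  have hθi : θ⁻¹ < 1 := inv_lt_one_of_one_lt₀ hθ
  have h2 := hlim.eventually (lt_mem_nhds hθi)
  obtain ⟨b, hb⟩ := (h1.and h2).exists_forall_of_atTop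
  refine ⟨max b 1, by positivity, fun a ha => ?_⟩
  have ha1 : 1 ≤ a := (le_max_right _ _).trans ha
  have hab : b ≤ a := (le_max_left _ _).trans ha
  have hθ0 : 0 < θ := by linarith
  have key : ∫⁻ r in Set.Ioi a, ENNReal.ofReal (wdens C L γ β r * (1 - β / (γ * L) * r ^ (-γ)))
      = ENNReal.ofReal (wtail C L γ β a) := by
    have hd : ∀ x ∈ Set.Ici a, HasDerivAt (wtail C L γ β)
        (-(wdens C L γ β x * (1 - β / (γ * L) * x ^ (-γ)))) x := fun x hx =>
      wtail_hasDerivAt hγ hL (by linarith [Set.mem_Ici.1 hx])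
    have hpos : ∀ x ∈ Set.Ioi a, 0 ≤ wdens C L γ β x * (1 - β / (γ * L) * x ^ (-γ)) := by
      intro x hx
      have hx' := Set.mem_Ioi.1 hx
      have := (hb x (by linarith)).2
      have h3 : 0 < θ⁻¹ := by positivity
      exact mul_nonneg (wdens_nonneg hC hγ hL (by linarith)) (by linarith)
    have hneg : ∀ x ∈ Set.Ioi a, -(wdens C L γ β x * (1 - β / (γ * L) * x ^ (-γ))) ≤ 0 :=
      fun x hx => by linarith [hpos x hx]
    have hint := integral_Ioi_of_hasDerivAt_of_nonpos' hd hneg (wtail_tendsto_zero hL hγ)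
    have hi := integrableOn_Ioi_deriv_of_nonpos' hd hneg (wtail_tendsto_zero hL hγ)
    rw [integral_neg, zero_sub, neg_inj] at hint
    rw [← ofReal_integral_eq_lintegral_ofReal, hint]
    · simpa using! hi.neg
    · exact (ae_restrict_iff' measurableSet_Ioi).2 (Eventually.of_forall hpos)
  rw [← key]
  rw [← lintegral_const_mul _ (by have := measurable_wdens C L γ β; fun_prop),
    ← lintegral_const_mul _ (by have := measurable_wdens C L γ β; fun_prop)]
  constructor
  · refine setLIntegral_mono' measurableSet_Ioi fun r hr => ?_
    have hr' := Set.mem_Ioi.1 hr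
    rw [← ENNReal.ofReal_mul hθ0.le]
    refine ENNReal.ofReal_le_ofReal ?_
    rw [mul_comm]
    exact mul_le_mul_of_nonneg_right (hb r (by linarith)).1.le
      (wdens_nonneg hC hγ hL (by linarith))
  · refine setLIntegral_mono' measurableSet_Ioi fun r hr => ?_
    have hr' := Set.mem_Ioi.1 hr
    rw [← ENNReal.ofReal_mul hθ0.le]
    refine ENNReal.ofReal_le_ofReal ?_
    have h3 := (hb r (by linarith)).2.le
    have h4 : 1 ≤ θ * (1 - β / (γ * L) * r ^ (-γ)) := by
      calc 1 = θ * θ⁻¹ := by field_simp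
        _ ≤ _ := by gcongr
    have h5 : 0 ≤ wdens C L γ β r := wdens_nonneg hC hγ hL (by linarith)
    nlinarith

/-- comparison of tails -/
lemma tail_compare {C L γ β : ℝ} (hC : 0 < C) (hγ : 0 < γ) (hL : 0 < L)
    (μ : Measure ℝ) [IsFiniteMeasure μ]
    (htail : Tendsto (fun u => (μ (Set.Ioi u)).toReal / wtail C L γ β u) atTop (nhds 1))
    {θ : ℝ} (hθ : 1 < θ) :
    ∃ a0 > (0 : ℝ), ∀ a ≥ a0,
      μ (Set.Ioi a) ≤
        ENNReal.ofReal θ * ∫⁻ r in Set.Ioi a, ENNReal.ofReal (wdens C L γ β r) ∧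
      ∫⁻ r in Set.Ioi a, ENNReal.ofReal (wdens C L γ β r) ≤
        ENNReal.ofReal θ * μ (Set.Ioi a) := by
  have hq : 1 < √θ := by
    rw [Real.lt_sqrt (by norm_num)]; simpa using hθ
  have hqq : √θ * √θ = θ := Real.mul_self_sqrt (by linarith)
  have hq0 : 0 ≤ √θ := Real.sqrt_nonneg _
  obtain ⟨a1, ha1, h1⟩ := wdens_lintegral (β := β) hC hγ hL hq
  have h2 := htail.eventually (gt_mem_nhds hq)
  have h3 := htail.eventually (lt_mem_nhds (inv_lt_one_of_one_lt₀ hq))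
  obtain ⟨b, hb⟩ := (h2.and h3).exists_forall_of_atTop
  refine ⟨max b a1, by positivity, fun a ha => ?_⟩
  have hb' := hb a ((le_max_left _ _).trans ha)
  have h1' := h1 a ((le_max_right _ _).trans ha)
  have hapos : 0 < a := lt_of_lt_of_le ha1 ((le_max_right _ _).trans ha)
  have hW : 0 < wtail C L γ β a := by unfold wtail; positivity
  have e1 : μ (Set.Ioi a) = ENNReal.ofReal (μ (Set.Ioi a)).toReal :=
    (ENNReal.ofReal_toReal (measure_ne_top _ _)).symm
  have u1 : μ (Set.Ioi a) ≤ ENNReal.ofReal √θ * ENNReal.ofReal (wtail C L γ β a) := by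
    rw [e1, ← ENNReal.ofReal_mul hq0]
    refine ENNReal.ofReal_le_ofReal ?_
    exact ((div_lt_iff₀ hW).1 hb'.1).le
  have u2 : ENNReal.ofReal (wtail C L γ β a) ≤ ENNReal.ofReal √θ * μ (Set.Ioi a) := by
    rw [e1, ← ENNReal.ofReal_mul hq0]
    refine ENNReal.ofReal_le_ofReal ?_
    have := ((lt_div_iff₀ hW).1 hb'.2).le
    rw [inv_mul_le_iff₀ (by linarith)] at this
    exact this
  constructor
  · calc _ ≤ _ := u1
      _ ≤ ENNReal.ofReal √θ * (ENNReal.ofReal √θ * _) := mul_le_mul' le_rfl h1'.1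
      _ = _ := by rw [← mul_assoc, ← ENNReal.ofReal_mul hq0, hqq]
  · calc _ ≤ _ := h1'.2
      _ ≤ ENNReal.ofReal √θ * (ENNReal.ofReal √θ * _) := mul_le_mul' le_rfl u2
      _ = _ := by rw [← mul_assoc, ← ENNReal.ofReal_mul hq0, hqq]

lemma upset_eq {J : Set ℝ} (hopen : IsOpen J) (hup : ∀ a ∈ J, ∀ b, a ≤ b → b ∈ J)
    (hbdd : BddBelow J) (hne : J.Nonempty) : J = Set.Ioi (sInf J) := by
  ext r
  constructor
  · intro hr
    obtain ⟨ε, hε, hb⟩ := Metric.isOpen_iff.1 hopen r hr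
    have : r - ε / 2 ∈ J := hb (by
      rw [Metric.mem_ball, Real.dist_eq]; rw [abs_lt]; constructor <;> linarith)
    have := csInf_le hbdd this
    simp only [Set.mem_Ioi]; linarith
  · intro hr
    obtain ⟨a, ha, har⟩ := exists_lt_of_csInf_lt hne hr
    exact hup a ha r har.le

@[fun_prop] lemma measurable_nsq {d : ℕ} : Measurable (nsq (d := d)) := by
  unfold nsq; fun_prop

lemma continuous_nsq {d : ℕ} : Continuous (nsq (d := d)) := by
  unfold nsq; fun_prop

lemma nsq_nonneg {d : ℕ} (y : Fin d → ℝ) : 0 ≤ nsq y := by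
  unfold nsq; positivity

lemma nsq_smul {d : ℕ} (s : ℝ) (y : Fin d → ℝ) : nsq (s • y) = s ^ 2 * nsq y := by
  simp only [nsq, Pi.smul_apply, smul_eq_mul, mul_pow, Finset.mul_sum]

lemma nsq_pos {d : ℕ} {y : Fin d → ℝ} (hy : y ≠ 0) : 0 < nsq y := by
  obtain ⟨j, hj⟩ := Function.ne_iff.1 hy
  refine Finset.sum_pos' (fun i _ => sq_nonneg _) ⟨j, Finset.mem_univ _, ?_⟩
  have : y j ≠ 0 := hj
  positivity

lemma lintegral_affine {d : ℕ} (B : Matrix (Fin d) (Fin d) ℝ) (hB : B.det ≠ 0) (b : Fin d → ℝ)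
    (f : (Fin d → ℝ) → ENNReal) (hf : Measurable f) :
    ∫⁻ y, f y = ENNReal.ofReal |B.det| * ∫⁻ ξ, f (B *ᵥ ξ + b) := by
  have h1 : ∫⁻ ξ, f (B *ᵥ ξ + b) = ∫⁻ y, f (y + b) ∂(Measure.map (toLin' B) volume) := by
    rw [lintegral_map (by fun_prop) (LinearMap.continuous_of_finiteDimensional _).measurable]
    simp [toLin'_apply]
  rw [h1, Real.map_matrix_volume_pi_eq_smul_volume_pi hB, lintegral_smul_measure,
    lintegral_add_right_eq_self, smul_eq_mul, ← mul_assoc, ← ENNReal.ofReal_mul (abs_nonneg _),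
    ← abs_mul, mul_inv_cancel₀ hB]
  simp

lemma lintegral_scale {d : ℕ} {s : ℝ} (hs : 0 < s)
    (f : (Fin d → ℝ) → ENNReal) (hf : Measurable f) :
    ∫⁻ y, f y = ENNReal.ofReal (s⁻¹ ^ d) * ∫⁻ ξ, f (s⁻¹ • ξ) := by
  have h := lintegral_affine (d := d) (s⁻¹ • (1 : Matrix (Fin d) (Fin d) ℝ))
    (by simp [hs.ne']) 0 f hf
  rw [h, Matrix.det_smul]
  simp [Matrix.smul_mulVec, abs_of_pos hs]

lemma pi_gaussian_density (d : ℕ) :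
    Measure.pi (fun _ : Fin d => gaussianReal 0 1) =
      (volume : Measure (Fin d → ℝ)).withDensity
        (fun g => ENNReal.ofReal ((2 * π) ^ (-(d : ℝ) / 2) * Real.exp (-(nsq g) / 2))) := by
  refine Measure.pi_eq fun s hs => ?_
  have e : ∀ g : Fin d → ℝ, (2 * π) ^ (-(d : ℝ) / 2) * Real.exp (-(nsq g) / 2)
      = ∏ j, gaussianPDFReal 0 1 (g j) := by
    intro g
    simp only [gaussianPDFReal, Finset.prod_mul_distrib, ← Real.exp_sum]
    congr 1
    · simp only [NNReal.coe_one, mul_one, Finset.prod_const, Finset.card_univ, Fintype.card_fin]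
      rw [Real.sqrt_eq_rpow, ← Real.rpow_neg (by positivity), ← Real.rpow_mul_natCast (by positivity)]
      congr 1; ring
    · congr 1
      simp [nsq, Finset.sum_div, Finset.sum_neg_distrib, neg_div]
  simp_rw [e]
  rw [withDensity_apply _ (MeasurableSet.univ_pi hs), volume_pi, Measure.restrict_pi_pi,
    ← ofReal_integral_eq_lintegral_ofReal]
  · rw [integral_fintype_prod_eq_prod (fun _ => gaussianPDFReal 0 1),
      ENNReal.ofReal_prod_of_nonneg]
    · refine Finset.prod_congr rfl fun j _ => ?_
      rw [gaussianReal_apply_eq_integral _ one_ne_zero]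
    · intro j _
      exact integral_nonneg fun x => gaussianPDFReal_nonneg _ _ _
  · exact Integrable.fintype_prod fun j => (integrable_gaussianPDFReal 0 1).restrict
  · exact Eventually.of_forall fun g => Finset.prod_nonneg fun j _ => gaussianPDFReal_nonneg _ _ _

lemma lintegral_Ioi_scale {a : ℝ} (ha : 0 < a) (f : ℝ → ENNReal) :
    ∫⁻ r in Set.Ioi 0, f r = ∫⁻ s in Set.Ioi 0, ENNReal.ofReal a * f (a * s) := by
  have h := lintegral_image_eq_lintegral_abs_deriv_mul (s := Set.Ioi (0:ℝ)) (f := fun s => a * s)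
    (f' := fun _ => a) measurableSet_Ioi
    (fun x _ => by simpa using ((hasDerivAt_id x).const_mul a).hasDerivWithinAt)
    (fun x _ y _ h => mul_left_cancel₀ ha.ne' h) f
  have e : (fun s => a * s) '' Set.Ioi (0:ℝ) = Set.Ioi 0 := by
    ext r; simp only [Set.mem_image, Set.mem_Ioi]
    exact ⟨fun ⟨s, hs, h⟩ => h ▸ mul_pos ha hs, fun h => ⟨r / a, div_pos h ha, by field_simp⟩⟩
  rw [e] at h
  rw [h, abs_of_pos ha]

lemma lintegral_Ioi_inv (f : ℝ → ENNReal) :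
    ∫⁻ r in Set.Ioi 0, f r = ∫⁻ s in Set.Ioi 0, ENNReal.ofReal ((s ^ 2)⁻¹) * f s⁻¹ := by
  have h := lintegral_image_eq_lintegral_abs_deriv_mul (s := Set.Ioi (0:ℝ)) (f := fun s => s⁻¹)
    (f' := fun s => -(s ^ 2)⁻¹) measurableSet_Ioi
    (fun x hx => (hasDerivAt_inv (ne_of_gt hx)).hasDerivWithinAt)
    (fun x _ y _ h => inv_injective h) f
  have e : (fun s => s⁻¹) '' Set.Ioi (0:ℝ) = Set.Ioi 0 := by
    ext r; simp only [Set.mem_image, Set.mem_Ioi]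
    exact ⟨fun ⟨s, hs, h⟩ => h ▸ inv_pos.2 hs, fun h => ⟨r⁻¹, inv_pos.2 h, inv_inv r⟩⟩
  rw [e] at h
  rw [h]
  refine setLIntegral_congr_fun measurableSet_Ioi fun s hs => ?_
  simp only [abs_neg, abs_inv, abs_pow]
  rw [abs_of_pos hs]

/-- radial constant -/
noncomputable def cd (d : ℕ) : ℝ :=
  (2 * π) ^ (-(d : ℝ) / 2) * 2 ^ ((d : ℝ) / 2 - 1) * Real.Gamma ((d : ℝ) / 2)

lemma cd_pos {d : ℕ} (hd : 0 < d) : 0 < cd d := by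
  unfold cd
  have : (0:ℝ) < d := by exact_mod_cast hd
  have := Real.Gamma_pos_of_pos (show (0:ℝ) < d / 2 by positivity)
  positivity

lemma radial_inner {d : ℕ} (hd : 0 < d) {ρ : ℝ} (hρ : 0 < ρ) :
    ∫⁻ s in Set.Ioi 0, ENNReal.ofReal (s⁻¹ ^ d * ((2 * π) ^ (-(d : ℝ) / 2) *
      Real.exp (-(s⁻¹ ^ 2 * ρ ^ 2) / 2)) * (s⁻¹ * ρ)) = ENNReal.ofReal (cd d * ρ ^ (1 - (d:ℝ))) := by
  have hd' : (0:ℝ) < d := by exact_mod_cast hd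
  rw [lintegral_Ioi_inv]
  have e : ∀ s ∈ Set.Ioi (0:ℝ), ENNReal.ofReal ((s ^ 2)⁻¹) * ENNReal.ofReal (s⁻¹⁻¹ ^ d *
      ((2 * π) ^ (-(d : ℝ) / 2) * Real.exp (-(s⁻¹⁻¹ ^ 2 * ρ ^ 2) / 2)) * (s⁻¹⁻¹ * ρ)) =
      ENNReal.ofReal (((2 * π) ^ (-(d : ℝ) / 2) * ρ) *
        (s ^ ((d:ℝ) - 1) * Real.exp (-(ρ ^ 2 / 2) * s ^ (2:ℝ)))) := by
    intro s hs
    have hs' : 0 < s := hs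
    rw [← ENNReal.ofReal_mul (by positivity)]
    congr 1
    rw [inv_inv, Real.rpow_sub_one hs'.ne', Real.rpow_natCast, Real.rpow_two]
    have : -(s ^ 2 * ρ ^ 2) / 2 = -(ρ ^ 2 / 2) * s ^ 2 := by ring
    rw [this]
    field_simp
  rw [setLIntegral_congr_fun measurableSet_Ioi e,
    ← ofReal_integral_eq_lintegral_ofReal]
  · congr 1
    rw [integral_const_mul, integral_rpow_mul_exp_neg_mul_rpow (by norm_num) (by linarith)
      (by positivity)]
    simp only [cd]
    have e1 : (ρ ^ 2 / 2) ^ (-((d:ℝ) - 1 + 1) / 2) = ρ ^ (-(d:ℝ)) * 2 ^ ((d:ℝ) / 2) := by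
      rw [Real.div_rpow (by positivity) (by norm_num), ← Real.rpow_two, ← Real.rpow_mul hρ.le,
        div_eq_mul_inv, ← Real.rpow_neg (by norm_num)]
      congr 2 <;> ring
    rw [e1, Real.rpow_sub_one (by norm_num) ((d:ℝ)/2), show (1 - (d:ℝ)) = -(d:ℝ) + 1 by ring,
      Real.rpow_add_one hρ.ne']
    have : ((d:ℝ) - 1 + 1) / 2 = d / 2 := by ring
    rw [this]
    ring
  · exact (integrableOn_rpow_mul_exp_neg_mul_rpow (by linarith) (by norm_num)
      (by positivity)).const_mul _
  · refine (ae_restrict_iff' measurableSet_Ioi).2 (Eventually.of_forall fun s hs => ?_)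
    have hs' : 0 < s := hs
    simp only [Pi.zero_apply]
    positivity

lemma psi_eq {C L γ β : ℝ} {d : ℕ} {ρ : ℝ} (hρ : 0 < ρ) :
    wdens C L γ β ρ * ρ ^ (1 - (d:ℝ)) = psi C L γ β d (ρ ^ 2) := by
  unfold wdens psi
  rw [← Real.rpow_two, ← Real.rpow_mul hρ.le, ← Real.rpow_mul hρ.le]
  have : ρ ^ (2 * ((β + γ - d) / 2)) = ρ ^ (β + γ - 1) * ρ ^ (1 - (d:ℝ)) := by
    rw [← Real.rpow_add hρ]; congr 1; ring
  rw [this, show (2 * (γ / 2)) = γ by ring]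
  ring

/-- polar-type formula -/
lemma polar_formula {C L γ β : ℝ} (hC : 0 < C) (hγ : 0 < γ) (hL : 0 < L) {d : ℕ} (hd : 0 < d)
    {D : Set (Fin d → ℝ)} (hD : MeasurableSet D) :
    ∫⁻ g, (∫⁻ r in Set.Ioi 0, ENNReal.ofReal (wdens C L γ β r) *
        D.indicator 1 ((r / √(nsq g)) • g)) ∂(Measure.pi (fun _ : Fin d => gaussianReal 0 1)) =
      ENNReal.ofReal (cd d) * ∫⁻ y in D, ENNReal.ofReal (psi C L γ β d (nsq y)) := by
  have hχ : Measurable (D.indicator (1 : (Fin d → ℝ) → ENNReal)) := measurable_one.indicator hD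
  have hw := measurable_wdens C L γ β
  have hne : ∀ᵐ y : Fin d → ℝ, y ≠ 0 := by
    have : Nonempty (Fin d) := ⟨⟨0, hd⟩⟩
    exact Measure.ae_ne volume 0
  set φ : (Fin d → ℝ) → ENNReal :=
    (fun g => ENNReal.ofReal ((2 * π) ^ (-(d : ℝ) / 2) * Real.exp (-(nsq g) / 2))) with hφ
  have hφm : Measurable φ := by rw [hφ]; fun_prop
  set F : (Fin d → ℝ) → ℝ → ENNReal := fun g s => φ g * (ENNReal.ofReal (√(nsq g)) *
    (ENNReal.ofReal (wdens C L γ β (√(nsq g) * s)) * D.indicator 1 (s • g))) with hF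
  have hFm : Measurable (Function.uncurry F) := by
    rw [hF]; unfold Function.uncurry; fun_prop
  rw [pi_gaussian_density, lintegral_withDensity_eq_lintegral_mul₀ hφm.aemeasurable]
  swap
  · refine Measurable.aemeasurable ?_
    refine Measurable.lintegral_prod_right' (f := fun p : (Fin d → ℝ) × ℝ =>
      ENNReal.ofReal (wdens C L γ β p.2) *
        D.indicator (1 : (Fin d → ℝ) → ENNReal) ((p.2 / √(nsq p.1)) • p.1)) ?_
    fun_prop
  have s1 : ∫⁻ g, (φ * fun g => ∫⁻ r in Set.Ioi 0, ENNReal.ofReal (wdens C L γ β r) *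
        D.indicator 1 ((r / √(nsq g)) • g)) g = ∫⁻ g, ∫⁻ s in Set.Ioi 0, F g s := by
    refine lintegral_congr_ae ?_
    filter_upwards [hne] with g hg
    have ha : 0 < √(nsq g) := Real.sqrt_pos.2 (nsq_pos hg)
    simp only [Pi.mul_apply, hF]
    rw [lintegral_const_mul _ (by fun_prop), lintegral_Ioi_scale ha]
    congr 1
    refine lintegral_congr fun s => ?_
    rw [mul_div_cancel_left₀ _ ha.ne']
  rw [s1, lintegral_lintegral_swap hFm.aemeasurable]
  have s2 : ∫⁻ s in Set.Ioi (0:ℝ), ∫⁻ g, F g s = ∫⁻ s in Set.Ioi (0:ℝ), ∫⁻ y,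
      (ENNReal.ofReal (wdens C L γ β (√(nsq y))) * D.indicator 1 y) *
      ENNReal.ofReal (s⁻¹ ^ d * ((2 * π) ^ (-(d : ℝ) / 2) *
        Real.exp (-(s⁻¹ ^ 2 * (√(nsq y)) ^ 2) / 2)) * (s⁻¹ * √(nsq y))) := by
    refine setLIntegral_congr_fun measurableSet_Ioi fun s hs => ?_
    have hs' : 0 < s := hs
    have hFs : Measurable fun g => F g s := by
      simp only [hF]; fun_prop
    rw [lintegral_scale hs' _ hFs, ← lintegral_const_mul _ (by fun_prop)]
    refine lintegral_congr fun y => ?_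
    simp only [hF, hφ]
    rw [nsq_smul, Real.sqrt_mul (by positivity), Real.sqrt_sq (by positivity), smul_smul,
      mul_inv_cancel₀ hs'.ne', one_smul, Real.sq_sqrt (nsq_nonneg y)]
    have : s⁻¹ * √(nsq y) * s = √(nsq y) := by field_simp
    rw [this, ENNReal.ofReal_mul (p := s⁻¹ ^ d * _) (by positivity),
      ENNReal.ofReal_mul (p := s⁻¹ ^ d) (by positivity)]
    ring
  rw [s2, lintegral_lintegral_swap (by
    refine Measurable.aemeasurable ?_
    unfold Function.uncurry
    fun_prop)]
  rw [← lintegral_indicator hD, ← lintegral_const_mul _ (by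
    refine Measurable.indicator ?_ hD
    unfold psi; fun_prop)]
  refine lintegral_congr_ae ?_
  filter_upwards [hne] with y hy
  have ha : 0 < √(nsq y) := Real.sqrt_pos.2 (nsq_pos hy)
  rw [lintegral_const_mul _ (by fun_prop), radial_inner hd ha]
  by_cases hyD : y ∈ D
  · simp only [Set.indicator_of_mem hyD, Pi.one_apply, mul_one]
    rw [← ENNReal.ofReal_mul (wdens_nonneg hC hγ hL ha), ← ENNReal.ofReal_mul (cd_pos hd).le]
    congr 1
    rw [← Real.sq_sqrt (nsq_nonneg y), ← psi_eq ha, Real.sqrt_sq ha.le]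
    ring
  · simp [Set.indicator_of_notMem hyD]

lemma slice_compare {d : ℕ} {ρ0 : ℝ} (μ : Measure ℝ) (hμ : μ (Set.Iic 0) = 0)
    {w : ℝ → ENNReal} {D : Set (Fin d → ℝ)} (hD : IsOpen D)
    (hstar : ∀ y ∈ D, ∀ s : ℝ, 1 ≤ s → s • y ∈ D) (hfar : ∀ y ∈ D, ρ0 ^ 2 ≤ nsq y)
    (θ : ENNReal)
    (hcmp : ∀ a ≥ ρ0, μ (Set.Ioi a) ≤ θ * ∫⁻ r in Set.Ioi a, w r ∧
      ∫⁻ r in Set.Ioi a, w r ≤ θ * μ (Set.Ioi a)) (g : Fin d → ℝ) :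
    μ {r | (r / √(nsq g)) • g ∈ D} ≤
      θ * ∫⁻ r in Set.Ioi 0, w r * D.indicator 1 ((r / √(nsq g)) • g) ∧
    ∫⁻ r in Set.Ioi 0, w r * D.indicator 1 ((r / √(nsq g)) • g) ≤
      θ * μ {r | (r / √(nsq g)) • g ∈ D} := by
  have hcont : Continuous fun r : ℝ => (r / √(nsq g)) • g := by fun_prop
  set J : Set ℝ := Set.Ioi 0 ∩ {r | (r / √(nsq g)) • g ∈ D} with hJ
  have hJo : IsOpen J := isOpen_Ioi.inter (hD.preimage hcont)
  have e1 : μ {r | (r / √(nsq g)) • g ∈ D} = μ J := by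
    refine le_antisymm ?_ (measure_mono Set.inter_subset_right)
    calc μ {r | (r / √(nsq g)) • g ∈ D} ≤ μ (Set.Iic 0 ∪ J) := by
          refine measure_mono fun r hr => ?_
          rcases le_or_gt r 0 with h | h
          · exact Or.inl h
          · exact Or.inr ⟨h, hr⟩
      _ ≤ μ (Set.Iic 0) + μ J := measure_union_le _ _
      _ = μ J := by rw [hμ, zero_add]
  have e2 : ∫⁻ r in Set.Ioi 0, w r * D.indicator 1 ((r / √(nsq g)) • g) = ∫⁻ r in J, w r := by
    rw [← lintegral_indicator hJo.measurableSet, ← lintegral_indicator measurableSet_Ioi]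
    refine lintegral_congr fun r => ?_
    by_cases h0 : r ∈ Set.Ioi (0:ℝ) <;> by_cases h1 : (r / √(nsq g)) • g ∈ D <;>
      simp [hJ, Set.indicator, h0, h1]
  rw [e1, e2]
  rcases J.eq_empty_or_nonempty with hne | hne
  · simp [hne]
  · have hlow : ∀ r ∈ J, ρ0 ≤ r := by
      rintro r ⟨h0, h1⟩
      have h0' : 0 < r := h0
      have h2 := hfar _ h1
      have h3 : nsq ((r / √(nsq g)) • g) ≤ r ^ 2 := by
        rw [nsq_smul, div_pow, Real.sq_sqrt (nsq_nonneg g)]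
        rcases eq_or_lt_of_le (nsq_nonneg g) with h | h
        · rw [← h]; simp; positivity
        · field_simp; rfl
      exact le_of_sq_le_sq (h2.trans h3) h0'.le
    have hup : ∀ a ∈ J, ∀ b, a ≤ b → b ∈ J := by
      rintro a ⟨h0, h1⟩ b hab
      have h0' : 0 < a := h0
      refine ⟨h0'.trans_le hab, ?_⟩
      have := hstar _ h1 (b / a) ((one_le_div h0').2 hab)
      rw [smul_smul] at this
      have e : b / a * (a / √(nsq g)) = b / √(nsq g) := by field_simp
      rw [e] at this
      exact this
    have hbd : BddBelow J := ⟨ρ0, hlow⟩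
    have := upset_eq hJo hup hbd hne
    have h5 : ρ0 ≤ sInf J := le_csInf hne hlow
    rw [this]
    exact hcmp _ h5

lemma master_compare {C L γ β : ℝ} (hC : 0 < C) (hγ : 0 < γ) (hL : 0 < L) {d : ℕ} (hd : 0 < d)
    {Ω : Type*} [MeasurableSpace Ω] (P : Measure Ω) [IsProbabilityMeasure P]
    (R : Ω → ℝ) (G : Ω → Fin d → ℝ)
    (hRmeas : Measurable R) (hGmeas : Measurable G)
    (hRpos : P {ω | 0 < R ω} = 1)
    (hGlaw : Measure.map G P = Measure.pi (fun _ : Fin d => gaussianReal 0 1))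
    (hindep : IndepFun R G P)
    (htail :
      Tendsto (fun u => (P {ω | u < R ω}).toReal / (C * u ^ β * Real.exp (-L * u ^ γ)))
        atTop (nhds 1)) {θ : ℝ} (hθ : 1 < θ) :
    ∃ ρ0 > (0:ℝ), ∀ D : Set (Fin d → ℝ), IsOpen D → (∀ y ∈ D, ∀ s : ℝ, 1 ≤ s → s • y ∈ D) →
      (∀ y ∈ D, ρ0 ^ 2 ≤ nsq y) →
      P {ω | (R ω / √(nsq (G ω))) • G ω ∈ D} ≤ ENNReal.ofReal θ *
        (ENNReal.ofReal (cd d) * ∫⁻ y in D, ENNReal.ofReal (psi C L γ β d (nsq y))) ∧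
      ENNReal.ofReal (cd d) * ∫⁻ y in D, ENNReal.ofReal (psi C L γ β d (nsq y)) ≤
        ENNReal.ofReal θ * P {ω | (R ω / √(nsq (G ω))) • G ω ∈ D} := by
  have hPm : IsProbabilityMeasure (P.map R) := Measure.isProbabilityMeasure_map hRmeas.aemeasurable
  have hPg : IsProbabilityMeasure (P.map G) := Measure.isProbabilityMeasure_map hGmeas.aemeasurable
  have hmap : ∀ u, (P.map R) (Set.Ioi u) = P {ω | u < R ω} := fun u =>
    Measure.map_apply hRmeas measurableSet_Ioi
  obtain ⟨ρ0, hρ0, hcmp⟩ := tail_compare (β := β) hC hγ hL (P.map R)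
    (by simp only [hmap]; exact htail) hθ
  have hμ0 : (P.map R) (Set.Iic 0) = 0 := by
    rw [← Set.compl_Ioi, prob_compl_eq_zero_iff measurableSet_Ioi, hmap]; exact hRpos
  refine ⟨ρ0, hρ0, fun D hD hstar hfar => ?_⟩
  have hsl := slice_compare (P.map R) hμ0 hD hstar hfar _ hcmp
  have hprod := (indepFun_iff_map_prod_eq_prod_map_map hRmeas.aemeasurable
    hGmeas.aemeasurable).1 hindep
  have hSm : MeasurableSet {p : ℝ × (Fin d → ℝ) | (p.1 / √(nsq p.2)) • p.2 ∈ D} :=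
    measurableSet_preimage (by fun_prop) hD.measurableSet
  have e1 : P {ω | (R ω / √(nsq (G ω))) • G ω ∈ D} =
      ∫⁻ g, (P.map R) {r | (r / √(nsq g)) • g ∈ D} ∂(P.map G) := by
    have : P {ω | (R ω / √(nsq (G ω))) • G ω ∈ D} = (P.map (fun ω => (R ω, G ω)))
        {p : ℝ × (Fin d → ℝ) | (p.1 / √(nsq p.2)) • p.2 ∈ D} := by
      rw [Measure.map_apply (hRmeas.prodMk hGmeas) hSm]; rfl
    rw [this, hprod, Measure.prod_apply_symm hSm]
    rfl
  have hm2 : Measurable fun g => (P.map R) {r | (r / √(nsq g)) • g ∈ D} :=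
    measurable_measure_prodMk_right hSm
  rw [← polar_formula hC hγ hL hd hD.measurableSet, ← hGlaw, e1,
    ← lintegral_const_mul' _ _ ENNReal.ofReal_ne_top, ← lintegral_const_mul' _ _ ENNReal.ofReal_ne_top]
  exact ⟨lintegral_mono fun g => (hsl g).1, lintegral_mono fun g => (hsl g).2⟩

lemma master_tendsto {C L γ β : ℝ} (hC : 0 < C) (hγ : 0 < γ) (hL : 0 < L) {d : ℕ} (hd : 0 < d)
    {Ω : Type*} [MeasurableSpace Ω] (P : Measure Ω) [IsProbabilityMeasure P]
    (R : Ω → ℝ) (G : Ω → Fin d → ℝ)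
    (hRmeas : Measurable R) (hGmeas : Measurable G)
    (hRpos : P {ω | 0 < R ω} = 1)
    (hGlaw : Measure.map G P = Measure.pi (fun _ : Fin d => gaussianReal 0 1))
    (hindep : IndepFun R G P)
    (htail :
      Tendsto (fun u => (P {ω | u < R ω}).toReal / (C * u ^ β * Real.exp (-L * u ^ γ)))
        atTop (nhds 1))
    (D : ℝ → Set (Fin d → ℝ)) (hDo : ∀ t, IsOpen (D t))
    (hstar : ∀ᶠ t in atTop, ∀ y ∈ D t, ∀ s : ℝ, 1 ≤ s → s • y ∈ D t)
    (hfar : ∀ ρ : ℝ, ∀ᶠ t in atTop, ∀ y ∈ D t, ρ ^ 2 ≤ nsq y)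
    (I : ℝ → ℝ) (hI : ∀ᶠ t in atTop, 0 < I t ∧
      ∫⁻ y in D t, ENNReal.ofReal (psi C L γ β d (nsq y)) = ENNReal.ofReal (I t)) :
    Tendsto (fun t => (P {ω | (R ω / √(nsq (G ω))) • G ω ∈ D t}).toReal / (cd d * I t))
      atTop (nhds 1) := by
  have hcd := cd_pos hd
  have key : ∀ θ : ℝ, 1 < θ → ∀ᶠ t in atTop,
      (P {ω | (R ω / √(nsq (G ω))) • G ω ∈ D t}).toReal / (cd d * I t) ≤ θ ∧
      θ⁻¹ ≤ (P {ω | (R ω / √(nsq (G ω))) • G ω ∈ D t}).toReal / (cd d * I t) := by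
    intro θ hθ
    obtain ⟨ρ0, hρ0, h⟩ := master_compare (β := β) hC hγ hL hd P R G hRmeas hGmeas hRpos hGlaw
      hindep htail hθ
    filter_upwards [hstar, hfar ρ0, hI] with t h1 h2 h3
    obtain ⟨h4, h5⟩ := h (D t) (hDo t) h1 h2
    have hpos : 0 < cd d * I t := mul_pos hcd h3.1
    rw [h3.2, ← ENNReal.ofReal_mul hcd.le] at h4 h5
    rw [← ENNReal.ofReal_mul (by linarith)] at h4
    rw [← ENNReal.ofReal_toReal (measure_ne_top P _), ← ENNReal.ofReal_mul (by linarith)] at h5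
    have h6 := ENNReal.toReal_le_of_le_ofReal (by positivity) h4
    have h7 := (ENNReal.ofReal_le_ofReal_iff (by positivity)).1 h5
    constructor
    · rwa [div_le_iff₀ hpos]
    · rw [le_div_iff₀ hpos, inv_mul_le_iff₀ (by linarith)]; exact h7
  refine tendsto_order.2 ⟨fun a ha => ?_, fun a ha => ?_⟩
  · set b := max a (1 / 2) with hb
    have hb1 : b < 1 := max_lt ha (by norm_num)
    have hb0 : 0 < b := lt_of_lt_of_le (by norm_num) (le_max_right _ _)
    set e := (b + 1) / 2 with he
    have : 1 < e⁻¹ := (one_lt_inv₀ (by positivity)).2 (by rw [he]; linarith)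
    filter_upwards [key _ this] with t ht
    have h8 := ht.2
    rw [inv_inv] at h8
    have : a ≤ b := le_max_left _ _
    linarith
  · filter_upwards [key ((1 + a) / 2) (by linarith)] with t ht
    linarith [ht.1]

/-- normalised Laplace integrand -/
noncomputable def lap (κ L p M E : ℝ) : ℝ :=
  (1 + 2 * E / M) ^ κ * Real.exp (-(L * (M * ((1 + 2 * E / M) ^ p - 1))))

lemma lap_bound (κ : ℝ) {L p : ℝ} (hL : 0 < L) (hp : 0 < p) (N : ℕ) :
    ∃ K : ℝ, ∀ M E : ℝ, 1 ≤ M → 0 ≤ E → lap κ L p M E ≤ K * ((1 + E) ^ N)⁻¹ := by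
  set q := min p 1 with hq
  have hq0 : 0 < q := lt_min hp one_pos
  have hq1 : q ≤ 1 := min_le_right _ _
  set c := L * q with hc
  have hc0 : 0 < c := by positivity
  obtain ⟨m, hm⟩ := exists_nat_ge ((|κ| + N) / q)
  refine ⟨Real.exp c * (m.factorial / c ^ m), fun M E hM hE => ?_⟩
  have hM0 : 0 < M := by linarith
  set y := 1 + 2 * E / M with hy
  have hdiv : 0 ≤ 2 * E / M := by positivity
  have hy1 : 1 ≤ y := by linarith
  have hy0 : 0 < y := by linarith
  set v := 1 + 2 * E with hv
  have hv1 : 1 ≤ v := by linarith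
  have hv0 : 0 < v := by linarith
  have hyv : y ≤ v := by
    have : 2 * E / M ≤ 2 * E := div_le_self (by linarith) hM
    linarith
  have h1 : y ^ κ ≤ v ^ |κ| := by
    calc y ^ κ ≤ y ^ |κ| := Real.rpow_le_rpow_of_exponent_le hy1 (le_abs_self _)
      _ ≤ v ^ |κ| := Real.rpow_le_rpow hy0.le hyv (abs_nonneg _)
  have h2 : q * (v ^ q - 1) ≤ M * (y ^ p - 1) := by
    have a1 : y ^ q ≤ y ^ p := Real.rpow_le_rpow_of_exponent_le hy1 (min_le_left _ _)
    have a2 : (1 + (y⁻¹ - 1)) ^ q ≤ 1 + q * (y⁻¹ - 1) :=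
      rpow_one_add_le_one_add_mul_self (by have := inv_pos.2 hy0; linarith) hq0.le hq1
    have a3 : (1 + (y⁻¹ - 1)) ^ q = (y ^ q)⁻¹ := by
      rw [add_sub_cancel, Real.inv_rpow hy0.le]
    rw [a3] at a2
    have hyq : 0 < y ^ q := Real.rpow_pos_of_pos hy0 _
    have a4 : q * (y ^ q * y⁻¹ * (y - 1)) ≤ y ^ q - 1 := by
      have := mul_le_mul_of_nonneg_left a2 hyq.le
      rw [mul_inv_cancel₀ hyq.ne'] at this
      have e : y ^ q * y⁻¹ * (y - 1) = y ^ q * (1 - y⁻¹) := by field_simp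
      rw [e]; nlinarith
    have a5 : v ^ q * v⁻¹ ≤ y ^ q * y⁻¹ := by
      rw [← div_eq_mul_inv, ← div_eq_mul_inv, ← Real.rpow_sub_one hv0.ne',
        ← Real.rpow_sub_one hy0.ne']
      exact Real.rpow_le_rpow_of_nonpos hy0 hyv (by linarith)
    have a6 : M * (y - 1) = v - 1 := by rw [hy, hv]; field_simp; ring
    have hvq : v ^ q * v⁻¹ ≤ 1 := by
      rw [← div_eq_mul_inv, ← Real.rpow_sub_one hv0.ne']
      exact Real.rpow_le_one_of_one_le_of_nonpos hv1 (by linarith)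
    calc q * (v ^ q - 1) ≤ q * (v ^ q * v⁻¹ * (v - 1)) := by
          gcongr
          have : v ^ q * v⁻¹ * (v - 1) = v ^ q - v ^ q * v⁻¹ := by field_simp
          rw [this]; linarith
      _ ≤ q * (y ^ q * y⁻¹ * (v - 1)) := by
          gcongr
      _ = M * (q * (y ^ q * y⁻¹ * (y - 1))) := by rw [← a6]; ring
      _ ≤ M * (y ^ p - 1) := by gcongr; linarith
  have h3 : (1 + E) ^ N ≤ v ^ (N : ℝ) := by
    rw [Real.rpow_natCast]
    gcongr; linarith
  have h4 : v ^ (|κ| + N) * Real.exp (-(c * v ^ q)) ≤ m.factorial / c ^ m := by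
    have b1 : v ^ (|κ| + N) ≤ (v ^ q) ^ m := by
      rw [← Real.rpow_mul_natCast hv0.le]
      refine Real.rpow_le_rpow_of_exponent_le hv1 ?_
      rw [div_le_iff₀ hq0] at hm; linarith
    have b2 := Real.pow_div_factorial_le_exp (c * v ^ q) (by positivity) m
    have hf : (0:ℝ) < m.factorial := by exact_mod_cast m.factorial_pos
    rw [div_le_iff₀ hf, mul_pow] at b2
    rw [Real.exp_neg, ← div_eq_mul_inv, div_le_div_iff₀ (Real.exp_pos _) (by positivity)]
    calc v ^ (|κ| + N) * c ^ m ≤ (v ^ q) ^ m * c ^ m := by gcongr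
      _ ≤ _ := by linarith
  have hE1 : 0 < (1 + E) ^ N := by positivity
  rw [← div_eq_mul_inv, le_div_iff₀ hE1]
  have h5 : Real.exp (-(L * (M * (y ^ p - 1)))) ≤ Real.exp c * Real.exp (-(c * v ^ q)) := by
    rw [← Real.exp_add]
    refine Real.exp_le_exp.2 ?_
    have := mul_le_mul_of_nonneg_left h2 hL.le
    rw [hc]; linarith
  calc lap κ L p M E * (1 + E) ^ N ≤
      (v ^ |κ| * (Real.exp c * Real.exp (-(c * v ^ q)))) * v ^ (N:ℝ) := by
        unfold lap; gcongr
    _ = Real.exp c * (v ^ (|κ| + N) * Real.exp (-(c * v ^ q))) := by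
        rw [Real.rpow_add hv0]; ring
    _ ≤ _ := by gcongr

lemma lap_nonneg (κ L p : ℝ) {M E : ℝ} (hM : 0 < M) (hE : 0 ≤ E) : 0 ≤ lap κ L p M E := by
  unfold lap; positivity

lemma lap_tendsto (κ L p : ℝ) {M E : ℝ → ℝ} {e : ℝ} (hM : Tendsto M atTop atTop)
    (hE : Tendsto E atTop (nhds e)) :
    Tendsto (fun t => lap κ L p (M t) (E t)) atTop (nhds (Real.exp (-(2 * p * L * e)))) := by
  have h0 : Tendsto (fun t => 2 * E t / M t) atTop (nhds 0) :=
    (hE.const_mul 2).div_atTop hM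
  have h1 : Tendsto (fun t => 1 + 2 * E t / M t) atTop (nhds 1) := by
    simpa using h0.const_add 1
  have h2 : Tendsto (fun t => (1 + 2 * E t / M t) ^ κ) atTop (nhds 1) := by
    simpa using h1.rpow_const (p := κ) (Or.inl one_ne_zero)
  have hder : HasDerivAt (fun x : ℝ => x ^ p) p 1 := by
    simpa using Real.hasDerivAt_rpow_const (x := 1) (p := p) (Or.inl one_ne_zero)
  have h3 : Tendsto (fun t => M t * ((1 + 2 * E t / M t) ^ p - 1)) atTop (nhds (2 * e * p)) := by
    have := hder.hasFDerivAt.hasFDerivWithinAt (s := Set.univ) |>.lim (l := atTop) (c := M)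
      (d := fun t => 2 * E t / M t) (v := 2 * e) h0 (Eventually.of_forall fun _ => Set.mem_univ _)
      (by
        refine (hE.const_mul 2).congr' ?_
        filter_upwards [hM.eventually_gt_atTop 0] with t ht
        simp only [smul_eq_mul]; field_simp)
    simpa using this
  have h4 := h2.mul ((Real.continuous_exp.tendsto _).comp (h3.const_mul L).neg)
  rw [one_mul] at h4
  have e1 : -(2 * p * L * e) = -(L * (2 * e * p)) := by ring
  rw [e1]
  exact h4

lemma laplace {d : ℕ} {S : Set (Fin d → ℝ)} (hS : MeasurableSet S) (κ : ℝ) {L p : ℝ}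
    (hL : 0 < L) (hp : 0 < p) {M : ℝ → ℝ} (hM : Tendsto M atTop atTop)
    (E : ℝ → (Fin d → ℝ) → ℝ) (Einf : (Fin d → ℝ) → ℝ) (hEm : ∀ t, Measurable (E t))
    {c : ℝ} (hc : 0 < c)
    (hE : ∀ᶠ t in atTop, ∀ ξ ∈ S, 0 ≤ E t ξ ∧ ∀ j, 1 + c * ξ j ^ 2 ≤ (1 + E t ξ) ^ 2)
    (hlim : ∀ ξ ∈ S, Tendsto (fun t => E t ξ) atTop (nhds (Einf ξ))) :
    Tendsto (fun t => ∫ ξ in S, lap κ L p (M t) (E t ξ)) atTop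
      (nhds (∫ ξ in S, Real.exp (-(2 * p * L * Einf ξ)))) ∧
    ∀ᶠ t in atTop, IntegrableOn (fun ξ => lap κ L p (M t) (E t ξ)) S := by
  obtain ⟨K, hK⟩ := lap_bound κ hL hp (2 * d)
  have hK0 : 0 ≤ K := by
    have h1 := hK 1 0 le_rfl le_rfl
    have h2 := lap_nonneg κ L p one_pos (le_refl (0:ℝ))
    simp at h1; linarith
  set bound : (Fin d → ℝ) → ℝ := fun ξ => K * ∏ j, (1 + c * ξ j ^ 2)⁻¹ with hb
  have hbi : Integrable bound := by
    refine Integrable.const_mul ?_ _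
    rw [volume_pi]
    refine Integrable.fintype_prod (f := fun _ x => (1 + c * x ^ 2)⁻¹) fun j => ?_
    have := integrable_inv_one_add_sq.comp_mul_left' (R := √c) (Real.sqrt_pos.2 hc).ne'
    refine this.congr (Eventually.of_forall fun x => ?_)
    simp only [mul_pow, Real.sq_sqrt hc.le]
  have hmeas : ∀ t, Measurable fun ξ => lap κ L p (M t) (E t ξ) := by
    intro t; unfold lap; have := hEm t; fun_prop
  have hbd : ∀ᶠ t in atTop, ∀ ξ ∈ S, ‖lap κ L p (M t) (E t ξ)‖ ≤ bound ξ := by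
    filter_upwards [hE, hM.eventually_ge_atTop 1] with t ht hMt ξ hξ
    obtain ⟨h0, h1⟩ := ht ξ hξ
    rw [Real.norm_of_nonneg (lap_nonneg κ L p (by linarith) h0)]
    refine (hK _ _ hMt h0).trans ?_
    simp only [hb]
    gcongr
    rw [Finset.prod_inv_distrib]
    refine inv_anti₀ (Finset.prod_pos fun j _ => by positivity) ?_
    calc ∏ j, (1 + c * ξ j ^ 2) ≤ ∏ _j : Fin d, (1 + E t ξ) ^ 2 :=
          Finset.prod_le_prod (fun j _ => by positivity) fun j _ => h1 j
      _ = _ := by simp [← pow_mul]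
  constructor
  · refine tendsto_integral_filter_of_dominated_convergence bound
      (Eventually.of_forall fun t => (hmeas t).aestronglyMeasurable) ?_ hbi.restrict ?_
    · filter_upwards [hbd] with t ht
      exact (ae_restrict_iff' hS).2 (Eventually.of_forall ht)
    · exact (ae_restrict_iff' hS).2 (Eventually.of_forall fun ξ hξ => lap_tendsto κ L p hM (hlim ξ hξ))
  · filter_upwards [hbd] with t ht
    exact Integrable.mono' hbi.restrict (hmeas t).aestronglyMeasurable
      ((ae_restrict_iff' hS).2 (Eventually.of_forall ht))

lemma psi_lap {C L γ β : ℝ} {d : ℕ} {s0 E : ℝ}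
    (hs : 0 < s0) (hE : 0 ≤ E) :
    psi C L γ β d (s0 + 2 * s0 ^ (1 - γ / 2) * E) =
      psi C L γ β d s0 * lap ((β + γ - d) / 2) L (γ / 2) (s0 ^ (γ / 2)) E := by
  unfold psi lap
  have hM : 0 < s0 ^ (γ / 2) := Real.rpow_pos_of_pos hs _
  have e1 : s0 + 2 * s0 ^ (1 - γ / 2) * E = s0 * (1 + 2 * E / s0 ^ (γ / 2)) := by
    rw [Real.rpow_sub hs, Real.rpow_one]; field_simp
  have hy : 0 < 1 + 2 * E / s0 ^ (γ / 2) := by positivity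
  rw [e1, Real.mul_rpow hs.le hy.le, Real.mul_rpow hs.le hy.le]
  have e2 : Real.exp (-L * (s0 ^ (γ / 2) * (1 + 2 * E / s0 ^ (γ / 2)) ^ (γ / 2))) =
      Real.exp (-L * s0 ^ (γ / 2)) * Real.exp (-(L * (s0 ^ (γ / 2) *
        ((1 + 2 * E / s0 ^ (γ / 2)) ^ (γ / 2) - 1)))) := by
    rw [← Real.exp_add]; congr 1; ring
  rw [e2]; ring

lemma region_tendsto {C L γ β : ℝ} (hC : 0 < C) (hγ : 0 < γ) (hL : 0 < L) {d : ℕ} (hd : 0 < d)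
    {Ω : Type*} [MeasurableSpace Ω] (P : Measure Ω) [IsProbabilityMeasure P]
    (R : Ω → ℝ) (G : Ω → Fin d → ℝ)
    (hRmeas : Measurable R) (hGmeas : Measurable G)
    (hRpos : P {ω | 0 < R ω} = 1)
    (hGlaw : Measure.map G P = Measure.pi (fun _ : Fin d => gaussianReal 0 1))
    (hindep : IndepFun R G P)
    (htail :
      Tendsto (fun u => (P {ω | u < R ω}).toReal / (C * u ^ β * Real.exp (-L * u ^ γ)))
        atTop (nhds 1))
    (D : ℝ → Set (Fin d → ℝ)) (hDo : ∀ t, IsOpen (D t))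
    (hstar : ∀ᶠ t in atTop, ∀ y ∈ D t, ∀ s : ℝ, 1 ≤ s → s • y ∈ D t)
    (B : ℝ → Matrix (Fin d) (Fin d) ℝ) (b : ℝ → Fin d → ℝ) (S : Set (Fin d → ℝ))
    (hS : MeasurableSet S) (s0 : ℝ → ℝ) (hs0 : Tendsto s0 atTop atTop)
    (E : ℝ → (Fin d → ℝ) → ℝ) (Einf : (Fin d → ℝ) → ℝ) (hEm : ∀ t, Measurable (E t))
    (hB : ∀ᶠ t in atTop, (B t).det ≠ 0 ∧ ∀ ξ, (B t *ᵥ ξ + b t ∈ D t ↔ ξ ∈ S) ∧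
      nsq (B t *ᵥ ξ + b t) = s0 t + 2 * (s0 t) ^ (1 - γ / 2) * E t ξ)
    {c : ℝ} (hc : 0 < c)
    (hE : ∀ᶠ t in atTop, ∀ ξ ∈ S, 0 ≤ E t ξ ∧ ∀ j, 1 + c * ξ j ^ 2 ≤ (1 + E t ξ) ^ 2)
    (hlim : ∀ ξ ∈ S, Tendsto (fun t => E t ξ) atTop (nhds (Einf ξ)))
    (I : ℝ) (hI : ∫ ξ in S, Real.exp (-(γ * L * Einf ξ)) = I) (hIpos : 0 < I) :
    Tendsto (fun t => (P {ω | (R ω / √(nsq (G ω))) • G ω ∈ D t}).toReal /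
      (cd d * (|(B t).det| * psi C L γ β d (s0 t) * I))) atTop (nhds 1) := by
  have hM : Tendsto (fun t => (s0 t) ^ (γ / 2)) atTop atTop :=
    (tendsto_rpow_atTop (by positivity)).comp hs0
  obtain ⟨h1, h2⟩ := laplace hS ((β + γ - d) / 2) hL (half_pos hγ) hM E Einf hEm hc hE hlim
  have e0 : ∀ ξ, 2 * (γ / 2) * L * Einf ξ = γ * L * Einf ξ := fun ξ => by ring
  simp only [e0] at h1
  rw [hI] at h1
  set J : ℝ → ℝ := fun t => ∫ ξ in S, lap ((β + γ - d) / 2) L (γ / 2) ((s0 t) ^ (γ / 2)) (E t ξ)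
    with hJ
  have hpsi : ∀ᶠ t in atTop, 0 < psi C L γ β d (s0 t) := by
    filter_upwards [hs0.eventually_gt_atTop 0] with t ht
    unfold psi; positivity
  have hmain := master_tendsto (β := β) hC hγ hL hd P R G hRmeas hGmeas hRpos hGlaw hindep htail
    D hDo hstar ?_ (fun t => |(B t).det| * psi C L γ β d (s0 t) * J t) ?_
  · have hr : Tendsto (fun t => J t / I) atTop (nhds 1) := by
      have := h1.div_const I
      rwa [div_self hIpos.ne'] at this
    have h3 := hmain.mul hr
    rw [mul_one] at h3
    refine h3.congr' ?_
    filter_upwards [hpsi, hB, h1.eventually (lt_mem_nhds hIpos)] with t ht1 ht2 ht3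
    have : 0 < |(B t).det| := abs_pos.2 ht2.1
    have := cd_pos hd
    field_simp
  · intro ρ
    filter_upwards [hB, hE, hs0.eventually_ge_atTop (ρ ^ 2), hs0.eventually_gt_atTop 0]
      with t ht1 ht2 ht3 ht4 y hy
    obtain ⟨hdet, hξ⟩ := ht1
    have hu : IsUnit (B t).det := isUnit_iff_ne_zero.2 hdet
    have e : B t *ᵥ ((B t)⁻¹ *ᵥ (y - b t)) + b t = y := by
      rw [Matrix.mulVec_mulVec, Matrix.mul_nonsing_inv _ hu, Matrix.one_mulVec, sub_add_cancel]
    obtain ⟨h5, h6⟩ := hξ ((B t)⁻¹ *ᵥ (y - b t))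
    rw [e] at h5 h6
    have h7 := (ht2 _ (h5.1 hy)).1
    rw [h6]
    have : 0 ≤ 2 * (s0 t) ^ (1 - γ / 2) * E t ((B t)⁻¹ *ᵥ (y - b t)) := by positivity
    linarith
  · filter_upwards [hB, hE, hs0.eventually_gt_atTop 0, hpsi, h2,
      h1.eventually (lt_mem_nhds hIpos)] with t ht1 ht2 ht3 ht4 ht5 ht6
    have hdet : 0 < |(B t).det| := abs_pos.2 ht1.1
    refine ⟨by positivity, ?_⟩
    rw [← lintegral_indicator (hDo t).measurableSet,
      lintegral_affine (B t) ht1.1 (b t) _ (by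
        refine Measurable.indicator ?_ (hDo t).measurableSet
        unfold psi; fun_prop)]
    rw [mul_assoc, ENNReal.ofReal_mul hdet.le]
    congr 1
    rw [ENNReal.ofReal_mul ht4.le, hJ]
    simp only
    rw [ofReal_integral_eq_lintegral_ofReal ht5
      ((ae_restrict_iff' hS).2 (Eventually.of_forall fun ξ hξ =>
        lap_nonneg _ _ _ (by positivity) (ht2 ξ hξ).1)),
      ← lintegral_const_mul' _ _ ENNReal.ofReal_ne_top, ← lintegral_indicator hS]
    refine lintegral_congr fun ξ => ?_
    obtain ⟨h5, h6⟩ := ht1.2 ξ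
    by_cases hξ : ξ ∈ S
    · rw [Set.indicator_of_mem hξ, Set.indicator_of_mem (h5.2 hξ), h6,
        psi_lap ht3 (ht2 ξ hξ).1, ENNReal.ofReal_mul ht4.le]
    · rw [Set.indicator_of_notMem hξ, Set.indicator_of_notMem (fun h => hξ (h5.1 h))]

lemma nsq_eq_dot {d : ℕ} (y : Fin d → ℝ) : nsq y = y ⬝ᵥ y := by
  simp [nsq, dotProduct, sq]

lemma nsq_add {d : ℕ} (x y : Fin d → ℝ) : nsq (x + y) = nsq y + 2 * (y ⬝ᵥ x) + nsq x := by
  simp only [nsq, dotProduct, Pi.add_apply, Finset.mul_sum, ← Finset.sum_add_distrib]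
  exact Finset.sum_congr rfl fun j _ => by ring

lemma dot_inv {d : ℕ} (A S : Matrix (Fin d) (Fin d) ℝ) (hS : S = A * Aᵀ)
    (x y : Fin d → ℝ) : (A⁻¹ *ᵥ x) ⬝ᵥ (A⁻¹ *ᵥ y) = (S⁻¹ *ᵥ x) ⬝ᵥ y := by
  rw [hS, Matrix.mul_inv_rev, ← Matrix.mulVec_mulVec, Matrix.dotProduct_mulVec,
    ← Matrix.transpose_nonsing_inv, ← Matrix.mulVec_transpose]

lemma orthant_integral {d : ℕ} (a : Fin d → ℝ) (ha : ∀ j, 0 < a j) :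
    ∫ ξ in {ξ : Fin d → ℝ | ∀ j, 0 < ξ j}, Real.exp (-(a ⬝ᵥ ξ)) = ∏ j, (a j)⁻¹ := by
  have e : {ξ : Fin d → ℝ | ∀ j, 0 < ξ j} = Set.univ.pi fun _ => Set.Ioi (0:ℝ) := by
    ext; simp
  rw [e, volume_pi, Measure.restrict_pi_pi]
  have e2 : ∀ ξ : Fin d → ℝ, Real.exp (-(a ⬝ᵥ ξ)) = ∏ j, Real.exp (-(a j) * ξ j) := by
    intro ξ
    rw [← Real.exp_sum, dotProduct, ← Finset.sum_neg_distrib]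
    simp
  simp_rw [e2]
  rw [integral_fintype_prod_eq_prod (fun j (x : ℝ) => Real.exp (-(a j) * x))]
  refine Finset.prod_congr rfl fun j _ => ?_
  rw [integral_exp_mul_Ioi (by linarith [ha j])]
  simp [neg_div]

lemma joint_tendsto {C L γ β : ℝ} (hC : 0 < C) (hγ : 0 < γ) (hL : 0 < L) {d : ℕ} (hd : 0 < d)
    {Ω : Type*} [MeasurableSpace Ω] (P : Measure Ω) [IsProbabilityMeasure P]
    (R : Ω → ℝ) (G : Ω → Fin d → ℝ)
    (hRmeas : Measurable R) (hGmeas : Measurable G)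
    (hRpos : P {ω | 0 < R ω} = 1)
    (hGlaw : Measure.map G P = Measure.pi (fun _ : Fin d => gaussianReal 0 1))
    (hindep : IndepFun R G P)
    (htail :
      Tendsto (fun u => (P {ω | u < R ω}).toReal / (C * u ^ β * Real.exp (-L * u ^ γ)))
        atTop (nhds 1))
    (A : Matrix (Fin d) (Fin d) ℝ) (hA : IsUnit A.det)
    (S : Matrix (Fin d) (Fin d) ℝ) (hSdef : S = A * Aᵀ)
    (hSpos : ∀ i, 0 < (S⁻¹ *ᵥ (1 : Fin d → ℝ)) i)
    (lam : ℝ) (hlam : lam = (1 : Fin d → ℝ) ⬝ᵥ (S⁻¹ *ᵥ (1 : Fin d → ℝ)))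
    (z : ℝ → Fin d → ℝ) (T : ℝ → ℝ) (hT : Tendsto T atTop atTop)
    (hz : ∀ j, Tendsto (fun t => z t j / T t) atTop (nhds 1)) :
    0 < lam ∧ Tendsto (fun t => nsq (A⁻¹ *ᵥ z t) / T t ^ 2) atTop (nhds lam) ∧
    Tendsto (fun t => (P {ω | (R ω / √(nsq (G ω))) • G ω ∈ {y | ∀ j, z t j < (A *ᵥ y) j}}).toReal /
      (cd d * ((T t ^ (1 - γ)) ^ d * |A.det|⁻¹ * psi C L γ β d (nsq (A⁻¹ *ᵥ z t)) *
        ∏ j, (γ * L * lam ^ (γ / 2 - 1) * (S⁻¹ *ᵥ (1 : Fin d → ℝ)) j)⁻¹))) atTop (nhds 1) := by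
  set h : Fin d → ℝ := S⁻¹ *ᵥ (1 : Fin d → ℝ) with hh
  have hlam0 : 0 < lam := by
    rw [hlam]
    simp only [dotProduct, Pi.one_apply, one_mul]
    have : Nonempty (Fin d) := ⟨⟨0, hd⟩⟩
    exact Finset.sum_pos (fun j _ => hSpos j) Finset.univ_nonempty
  have hAi : A * A⁻¹ = 1 := Matrix.mul_nonsing_inv _ hA
  have hTpos := hT.eventually_gt_atTop 0
  -- normalised vector
  set n : ℝ → Fin d → ℝ := fun t => (T t)⁻¹ • z t with hn
  have hnlim : Tendsto n atTop (nhds (1 : Fin d → ℝ)) := by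
    refine tendsto_pi_nhds.2 fun j => (hz j).congr fun t => ?_
    simp [hn, div_eq_inv_mul]
  have hzn : ∀ᶠ t in atTop, z t = T t • n t := by
    filter_upwards [hTpos] with t ht
    rw [hn]; simp [smul_smul, mul_inv_cancel₀ ht.ne']
  have hnA : Tendsto (fun t => nsq (A⁻¹ *ᵥ n t)) atTop (nhds lam) := by
    have hc : Continuous fun v : Fin d → ℝ => nsq (A⁻¹ *ᵥ v) :=
      continuous_nsq.comp (Continuous.matrix_mulVec continuous_const continuous_id)
    have h1 := (hc.tendsto 1).comp hnlim
    have e : nsq (A⁻¹ *ᵥ (1 : Fin d → ℝ)) = lam := by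
      rw [nsq_eq_dot, dot_inv A S hSdef, hlam, dotProduct_comm]
    rw [e] at h1
    exact h1
  have hnS : ∀ j, Tendsto (fun t => (S⁻¹ *ᵥ n t) j) atTop (nhds (h j)) := by
    have hc : Continuous fun v : Fin d → ℝ => S⁻¹ *ᵥ v :=
      (Continuous.matrix_mulVec continuous_const continuous_id)
    exact fun j => tendsto_pi_nhds.1 ((hc.tendsto 1).comp hnlim) j
  have hs0e : ∀ᶠ t in atTop, nsq (A⁻¹ *ᵥ z t) = T t ^ 2 * nsq (A⁻¹ *ᵥ n t) := by
    filter_upwards [hzn] with t ht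
    rw [ht, Matrix.mulVec_smul, nsq_smul]
  set r : ℝ → ℝ := fun t => (nsq (A⁻¹ *ᵥ n t)) ^ (γ / 2 - 1) with hr
  have hrlim : Tendsto r atTop (nhds (lam ^ (γ / 2 - 1))) := hnA.rpow_const (Or.inl hlam0.ne')
  have hlp : 0 < lam ^ (γ / 2 - 1) := by positivity
  refine ⟨hlam0, ?_, ?_⟩
  · refine hnA.congr' ?_
    filter_upwards [hs0e, hTpos] with t h1 h2
    rw [h1]; field_simp
  have hs0 : Tendsto (fun t => nsq (A⁻¹ *ᵥ z t)) atTop atTop := by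
    have : Tendsto (fun t => T t ^ 2 * nsq (A⁻¹ *ᵥ n t)) atTop atTop :=
      ((tendsto_pow_atTop two_ne_zero).comp hT).atTop_mul_pos hlam0 hnA
    refine this.congr' ?_
    filter_upwards [hs0e] with t ht using ht.symm
  -- lower bound constant
  obtain ⟨c0, hc0, hc0h⟩ : ∃ c0 > (0:ℝ), ∀ j, c0 < lam ^ (γ / 2 - 1) * h j := by
    have : Nonempty (Fin d) := ⟨⟨0, hd⟩⟩
    obtain ⟨j0, hj0⟩ := Finite.exists_min h
    refine ⟨lam ^ (γ / 2 - 1) * h j0 / 2, by have := hSpos j0; positivity, fun j => ?_⟩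
    have h1 : 0 < lam ^ (γ / 2 - 1) * h j0 := mul_pos hlp (hSpos j0)
    have h2 : lam ^ (γ / 2 - 1) * h j0 ≤ lam ^ (γ / 2 - 1) * h j :=
      mul_le_mul_of_nonneg_left (hj0 j) hlp.le
    linarith
  have hlow : ∀ᶠ t in atTop, ∀ j, c0 < r t * (S⁻¹ *ᵥ n t) j :=
    eventually_all.2 fun j => (hrlim.mul (hnS j)).eventually (lt_mem_nhds (hc0h j))
  set E : ℝ → (Fin d → ℝ) → ℝ := fun t ξ =>
    r t * ((S⁻¹ *ᵥ n t) ⬝ᵥ ξ) + r t * T t ^ (-γ) * nsq (A⁻¹ *ᵥ ξ) / 2 with hE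
  have hint : ∫ ξ in {ξ : Fin d → ℝ | ∀ j, 0 < ξ j},
      Real.exp (-(γ * L * (lam ^ (γ / 2 - 1) * (h ⬝ᵥ ξ)))) =
      ∏ j, (γ * L * lam ^ (γ / 2 - 1) * h j)⁻¹ := by
    rw [← orthant_integral (fun j => γ * L * lam ^ (γ / 2 - 1) * h j)
      (fun j => by have := hSpos j; positivity)]
    congr 1; ext ξ; congr 2
    simp only [dotProduct, Finset.mul_sum]
    exact Finset.sum_congr rfl fun j _ => by ring
  have hmain := region_tendsto (β := β) hC hγ hL hd P R G hRmeas hGmeas hRpos hGlaw hindep htail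
    (fun t => {y | ∀ j, z t j < (A *ᵥ y) j}) ?_ ?_ (fun t => (T t ^ (1 - γ)) • A⁻¹)
    (fun t => A⁻¹ *ᵥ z t) {ξ | ∀ j, 0 < ξ j} ?_ (fun t => nsq (A⁻¹ *ᵥ z t)) hs0 E
    (fun ξ => lam ^ (γ / 2 - 1) * (h ⬝ᵥ ξ)) ?_ ?_ (c := c0 ^ 2) (by positivity) ?_ ?_ _ hint
    (Finset.prod_pos fun j _ => by have := hSpos j; positivity)
  · refine hmain.congr' ?_
    filter_upwards [hTpos] with t ht
    rw [Matrix.det_smul, abs_mul, Matrix.det_nonsing_inv, Ring.inverse_eq_inv', abs_inv,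
      Fintype.card_fin, abs_of_pos (show 0 < (T t ^ (1 - γ)) ^ d by positivity)]
  · intro t
    have : {y : Fin d → ℝ | ∀ j, z t j < (A *ᵥ y) j} = ⋂ j, {y | z t j < (A *ᵥ y) j} := by
      ext; simp
    rw [this]
    refine isOpen_iInter_of_finite fun j => isOpen_lt continuous_const ?_
    exact (continuous_apply j).comp (Continuous.matrix_mulVec continuous_const continuous_id)
  · have : ∀ᶠ t in atTop, ∀ j, 0 < z t j := by
      refine eventually_all.2 fun j => ?_
      filter_upwards [(hz j).eventually (lt_mem_nhds one_pos), hTpos] with t h1 h2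
      exact (div_pos_iff_of_pos_right h2).1 h1
    filter_upwards [this] with t ht y hy s hs j
    have h1 : z t j < (A *ᵥ y) j := hy j
    rw [Matrix.mulVec_smul, Pi.smul_apply, smul_eq_mul]
    nlinarith [ht j]
  · have : {y : Fin d → ℝ | ∀ j, 0 < y j} = Set.univ.pi fun _ => Set.Ioi (0:ℝ) := by
      ext; simp
    rw [this]
    exact MeasurableSet.univ_pi fun _ => measurableSet_Ioi
  · intro t
    have c1 : Continuous fun ξ : Fin d → ℝ => nsq (A⁻¹ *ᵥ ξ) :=
      continuous_nsq.comp (Continuous.matrix_mulVec continuous_const continuous_id)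
    have c2 : Continuous fun ξ : Fin d → ℝ => (S⁻¹ *ᵥ n t) ⬝ᵥ ξ := by
      unfold dotProduct; fun_prop
    simp only [hE]
    exact Continuous.measurable (by fun_prop)
  · filter_upwards [hTpos, hzn, hs0e, hnA.eventually (lt_mem_nhds hlam0)] with t ht h1 h2 h3
    refine ⟨?_, fun ξ => ⟨?_, ?_⟩⟩
    · rw [Matrix.det_smul, Matrix.det_nonsing_inv, Ring.inverse_eq_inv']
      have : A.det ≠ 0 := hA.ne_zero
      positivity
    · have hp : 0 < T t ^ (1 - γ) := by positivity
      change (∀ j, z t j < (A *ᵥ (((T t ^ (1 - γ)) • A⁻¹) *ᵥ ξ + A⁻¹ *ᵥ z t)) j) ↔ ∀ j, 0 < ξ j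
      refine forall_congr' fun j => ?_
      rw [Matrix.mulVec_add, Matrix.smul_mulVec, Matrix.mulVec_smul, Matrix.mulVec_mulVec,
        Matrix.mulVec_mulVec, hAi, Matrix.one_mulVec, Matrix.one_mulVec]
      simp only [Pi.add_apply, Pi.smul_apply, smul_eq_mul, lt_add_iff_pos_left]
      exact mul_pos_iff_of_pos_left hp
    · rw [nsq_add, Matrix.smul_mulVec, nsq_smul, dotProduct_smul, dot_inv A S hSdef]
      have e1 : (nsq (A⁻¹ *ᵥ z t)) ^ (1 - γ / 2) * r t = T t ^ (2 - γ) := by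
        rw [h2, hr, Real.mul_rpow (by positivity) h3.le, mul_assoc, ← Real.rpow_add h3,
          ← Real.rpow_two, ← Real.rpow_mul ht.le]
        rw [show 1 - γ / 2 + (γ / 2 - 1) = 0 by ring, Real.rpow_zero, mul_one]
        congr 1; ring
      have e2 : (S⁻¹ *ᵥ z t) ⬝ᵥ ξ = T t * ((S⁻¹ *ᵥ n t) ⬝ᵥ ξ) := by
        conv_lhs => rw [h1]
        rw [Matrix.mulVec_smul, smul_dotProduct, smul_eq_mul]
      rw [e2, smul_eq_mul]
      have e3 : T t ^ (2 - γ) = T t ^ (1 - γ) * T t := by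
        rw [← Real.rpow_add_one ht.ne']; congr 1; ring
      have e4 : T t ^ (2 - γ) * T t ^ (-γ) = (T t ^ (1 - γ)) ^ 2 := by
        rw [← Real.rpow_add ht, ← Real.rpow_mul_natCast ht.le]; congr 1; push_cast; ring
      simp only [hE]
      calc _ = nsq (A⁻¹ *ᵥ z t) + 2 * (T t ^ (1 - γ) * T t) * ((S⁻¹ *ᵥ n t) ⬝ᵥ ξ)
            + (T t ^ (1 - γ)) ^ 2 * nsq (A⁻¹ *ᵥ ξ) := by ring
        _ = nsq (A⁻¹ *ᵥ z t) + 2 * ((nsq (A⁻¹ *ᵥ z t)) ^ (1 - γ / 2) * r t) * ((S⁻¹ *ᵥ n t) ⬝ᵥ ξ)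
            + ((nsq (A⁻¹ *ᵥ z t)) ^ (1 - γ / 2) * r t) * T t ^ (-γ) * nsq (A⁻¹ *ᵥ ξ) := by
          rw [e1, ← e3, e4]
        _ = _ := by ring
  · filter_upwards [hlow, hTpos, hnA.eventually (lt_mem_nhds hlam0)] with t h1 ht h3 ξ hξ
    have hξ' : ∀ j, 0 < ξ j := hξ
    have hr0 : 0 < r t := Real.rpow_pos_of_pos h3 _
    have g1 : ∀ j, c0 * ξ j ≤ r t * ((S⁻¹ *ᵥ n t) ⬝ᵥ ξ) := by
      intro j
      rw [dotProduct, Finset.mul_sum]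
      calc c0 * ξ j ≤ r t * ((S⁻¹ *ᵥ n t) j * ξ j) := by
            rw [← mul_assoc]; exact mul_le_mul_of_nonneg_right (h1 j).le (hξ' j).le
        _ ≤ _ := Finset.single_le_sum (f := fun i => r t * ((S⁻¹ *ᵥ n t) i * ξ i))
            (fun i _ => by
              rw [← mul_assoc]; exact mul_nonneg (hc0.trans (h1 i)).le (hξ' i).le)
            (Finset.mem_univ j)
    have g2 : 0 ≤ r t * T t ^ (-γ) * nsq (A⁻¹ *ᵥ ξ) / 2 := by
      have := nsq_nonneg (A⁻¹ *ᵥ ξ); positivity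
    have g3 : ∀ j, c0 * ξ j ≤ E t ξ := fun j => by
      simp only [hE]; linarith [g1 j]
    have g0 : 0 ≤ E t ξ := (mul_pos hc0 (hξ' ⟨0, hd⟩)).le.trans (g3 _)
    refine ⟨g0, fun j => ?_⟩
    have := g3 j
    have h6 : 0 ≤ c0 * ξ j := (mul_pos hc0 (hξ' j)).le
    nlinarith
  · intro ξ hξ
    simp only [hE]
    have t1 : Tendsto (fun t => (S⁻¹ *ᵥ n t) ⬝ᵥ ξ) atTop (nhds (h ⬝ᵥ ξ)) := by
      unfold dotProduct
      exact tendsto_finsetSum _ fun j _ => (hnS j).mul_const _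
    have t2 : Tendsto (fun t => T t ^ (-γ)) atTop (nhds 0) := (tendsto_rpow_neg_atTop hγ).comp hT
    have := (hrlim.mul t1).add (((hrlim.mul t2).mul_const (nsq (A⁻¹ *ᵥ ξ))).div_const 2)
    simpa using this

lemma exists_orth {d : ℕ} (i0 : Fin d) (a : Fin d → ℝ) (ha : a ⬝ᵥ a = 1) :
    ∃ Q : Matrix (Fin d) (Fin d) ℝ, Q * Qᵀ = 1 ∧ Q i0 = a := by
  have hon : Orthonormal ℝ (({i0} : Set (Fin d)).domRestrict
      (fun _ : Fin d => (WithLp.toLp 2 a : EuclideanSpace ℝ (Fin d)))) := by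
    constructor
    · intro i
      rw [← sq_eq_sq₀ (norm_nonneg _) zero_le_one, Set.domRestrict_apply, EuclideanSpace.norm_sq_eq]
      simpa [dotProduct, sq] using ha
    · intro i j hij
      exact absurd (Subsingleton.elim i j) hij
  obtain ⟨b, hb⟩ := hon.exists_orthonormalBasis_extension_of_card_eq (by simp)
  refine ⟨Matrix.of fun i j => b i j, ?_, ?_⟩
  · ext i k
    have := orthonormal_iff_ite.1 b.orthonormal k i
    rw [PiLp.inner_apply] at this
    simp only [Matrix.mul_apply, Matrix.of_apply, Matrix.transpose_apply, Matrix.one_apply]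
    simp only [RCLike.inner_apply, conj_trivial] at this
    rw [this]
    simp only [eq_comm]
  · have := hb i0 rfl
    funext j
    simp [Matrix.of_apply, this]

lemma prod_ite_i0 {d : ℕ} (i0 : Fin d) (p q : ℝ) :
    ∏ j, (if j = i0 then p else q) = p * q ^ (d - 1) := by
  rw [← Finset.mul_prod_erase _ _ (Finset.mem_univ i0)]
  rw [if_pos rfl, Finset.prod_congr rfl (g := fun _ => q)]
  · simp
  · intro j hj
    rw [if_neg (Finset.ne_of_mem_erase hj)]

lemma marg_integral {d : ℕ} (i0 : Fin d) {k : ℝ} (hk : 0 < k) :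
    ∫ ξ in {ξ : Fin d → ℝ | 0 < ξ i0},
      Real.exp (-(k * ∑ j, (if j = i0 then ξ j else ξ j ^ 2 / 2))) =
      k⁻¹ * √(π / (k / 2)) ^ (d - 1) := by
  have e : {ξ : Fin d → ℝ | 0 < ξ i0} =
      Set.univ.pi fun j => if j = i0 then Set.Ioi (0:ℝ) else Set.univ := by
    ext ξ
    constructor
    · intro h j _
      by_cases hj : j = i0
      · subst hj; simpa using h
      · simp [hj]
    · intro h
      simpa using h i0 (Set.mem_univ _)
  rw [e, volume_pi, Measure.restrict_pi_pi]
  have e2 : ∀ ξ : Fin d → ℝ, Real.exp (-(k * ∑ j, (if j = i0 then ξ j else ξ j ^ 2 / 2))) =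
      ∏ j, (fun (j : Fin d) (x : ℝ) => if j = i0 then Real.exp (-k * x) else
        Real.exp (-(k/2) * x ^ 2)) j (ξ j) := by
    intro ξ
    rw [Finset.mul_sum, ← Finset.sum_neg_distrib, Real.exp_sum]
    refine Finset.prod_congr rfl fun j _ => ?_
    dsimp only
    split_ifs
    · congr 1; ring
    · congr 1; ring
  rw [funext e2, integral_fintype_prod_eq_prod (fun (j : Fin d) (x : ℝ) =>
    if j = i0 then Real.exp (-k * x) else Real.exp (-(k/2) * x ^ 2)), ← prod_ite_i0 i0]
  refine Finset.prod_congr rfl fun j _ => ?_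
  split_ifs with hj
  · rw [integral_exp_mul_Ioi (by linarith)]
    simp [neg_div]
  · rw [Measure.restrict_univ, integral_gaussian]

lemma marg_const {C L γ β : ℝ} (hC : 0 < C) (hL : 0 < L) (hγ : 0 < γ) {d : ℕ} (hd : 0 < d)
    {u : ℝ} (hu : 0 < u) :
    cd d * (u ^ (1 - γ) * (u ^ (1 - γ / 2)) ^ (d - 1) * psi C L γ β d (u ^ 2) *
      ((γ * L)⁻¹ * √(π / (γ * L / 2)) ^ (d - 1))) =
    (Real.Gamma ((d : ℝ) / 2) / (2 * Real.Gamma (1 / 2))) * C *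
        (γ * L / 2) ^ (-((d : ℝ) - 1) / 2) * u ^ (β - γ * ((d : ℝ) - 1) / 2) *
        Real.exp (-L * u ^ γ) := by
  have hdc : ((d - 1 : ℕ) : ℝ) = (d : ℝ) - 1 := by
    rw [Nat.cast_sub hd]; simp
  have hk : 0 < γ * L / 2 := by positivity
  have p1 : (u ^ (1 - γ / 2)) ^ (d - 1) = u ^ ((1 - γ / 2) * ((d : ℝ) - 1)) := by
    rw [← hdc, Real.rpow_mul_natCast hu.le]
  have p2 : √(π / (γ * L / 2)) ^ (d - 1) =
      π ^ (((d : ℝ) - 1) / 2) * (γ * L / 2) ^ (-((d : ℝ) - 1) / 2) := by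
    rw [Real.sqrt_eq_rpow, ← Real.rpow_mul_natCast (by positivity), hdc,
      Real.div_rpow pi_pos.le hk.le, div_eq_mul_inv, ← Real.rpow_neg hk.le]
    congr 2 <;> ring
  have p3 : (u ^ 2) ^ (γ / 2) = u ^ γ := by
    rw [← Real.rpow_two, ← Real.rpow_mul hu.le]; congr 1; ring
  have p4 : (u ^ 2) ^ ((β + γ - d) / 2) = u ^ (β + γ - d) := by
    rw [← Real.rpow_two, ← Real.rpow_mul hu.le]; congr 1; ring
  have p5 : u ^ (1 - γ) * u ^ ((1 - γ / 2) * ((d : ℝ) - 1)) * u ^ (β + γ - d) =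
      u ^ (β - γ * ((d : ℝ) - 1) / 2) := by
    rw [← Real.rpow_add hu, ← Real.rpow_add hu]; congr 1; ring
  have p6 : cd d * π ^ (((d : ℝ) - 1) / 2) =
      Real.Gamma ((d : ℝ) / 2) / (2 * Real.Gamma (1 / 2)) := by
    rw [cd, Real.Gamma_one_half_eq, Real.mul_rpow (by positivity) pi_pos.le]
    have q1 : (2:ℝ) ^ (-(d:ℝ)/2) * 2 ^ ((d:ℝ)/2 - 1) = 2⁻¹ := by
      rw [← Real.rpow_add two_pos, ← Real.rpow_neg_one]; congr 1; ring
    have q2 : π ^ (-(d:ℝ)/2) * π ^ (((d:ℝ) - 1)/2) = (√π)⁻¹ := by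
      rw [Real.sqrt_eq_rpow, ← Real.rpow_neg pi_pos.le, ← Real.rpow_add pi_pos]; congr 1; ring
    calc _ = (2:ℝ) ^ (-(d:ℝ)/2) * 2 ^ ((d:ℝ)/2 - 1) *
          (π ^ (-(d:ℝ)/2) * π ^ (((d:ℝ) - 1)/2)) * Real.Gamma ((d : ℝ) / 2) := by ring
      _ = _ := by rw [q1, q2]; field_simp
  rw [p1, p2, psi, p3, p4, ← p6, ← p5, neg_mul]
  field_simp

lemma marginal_tendsto {C L γ β : ℝ} (hC : 0 < C) (hγ : 0 < γ) (hL : 0 < L) {d : ℕ} (hd : 0 < d)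
    {Ω : Type*} [MeasurableSpace Ω] (P : Measure Ω) [IsProbabilityMeasure P]
    (R : Ω → ℝ) (G : Ω → Fin d → ℝ)
    (hRmeas : Measurable R) (hGmeas : Measurable G)
    (hRpos : P {ω | 0 < R ω} = 1)
    (hGlaw : Measure.map G P = Measure.pi (fun _ : Fin d => gaussianReal 0 1))
    (hindep : IndepFun R G P)
    (htail :
      Tendsto (fun u => (P {ω | u < R ω}).toReal / (C * u ^ β * Real.exp (-L * u ^ γ)))
        atTop (nhds 1))
    (i0 : Fin d) (a : Fin d → ℝ) (ha : a ⬝ᵥ a = 1) :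
    Tendsto (fun u => (P {ω | (R ω / √(nsq (G ω))) • G ω ∈ {y | u < a ⬝ᵥ y}}).toReal /
      ((Real.Gamma ((d : ℝ) / 2) / (2 * Real.Gamma (1 / 2))) * C *
        (γ * L / 2) ^ (-((d : ℝ) - 1) / 2) * u ^ (β - γ * ((d : ℝ) - 1) / 2) *
        Real.exp (-L * u ^ γ))) atTop (nhds 1) := by
  obtain ⟨Q, hQ, hQa⟩ := exists_orth i0 a ha
  have hQ' : Qᵀ * Q = 1 := mul_eq_one_comm.1 hQ
  have hdet : |Qᵀ.det| = 1 := by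
    have : Q.det * Q.det = 1 := by
      have := congrArg Matrix.det hQ
      rwa [Matrix.det_mul, Matrix.det_transpose, Matrix.det_one] at this
    rw [Matrix.det_transpose, ← sq_eq_sq₀ (abs_nonneg _) zero_le_one, sq_abs, sq, this, one_pow]
  set δ : ℝ → Fin d → ℝ := fun u j => if j = i0 then u ^ (1 - γ) else u ^ (1 - γ / 2) with hδ
  set w : ℝ → (Fin d → ℝ) → Fin d → ℝ := fun u ξ j => δ u j * ξ j + (if j = i0 then u else 0)
    with hw
  have hy : ∀ u ξ, (Qᵀ * Matrix.diagonal (δ u)) *ᵥ ξ + u • a = Qᵀ *ᵥ w u ξ := by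
    intro u ξ
    have h1 : w u ξ = Matrix.diagonal (δ u) *ᵥ ξ + u • Pi.single i0 1 := by
      funext j
      simp [hw, Matrix.mulVec_diagonal, Pi.single_apply]
    have h2 : Qᵀ *ᵥ (Pi.single i0 1) = a := by
      rw [Matrix.mulVec_single_one, ← hQa]; rfl
    rw [h1, Matrix.mulVec_add, Matrix.mulVec_smul, h2, Matrix.mulVec_mulVec]
  have hay : ∀ u ξ, a ⬝ᵥ (Qᵀ *ᵥ w u ξ) = w u ξ i0 := by
    intro u ξ
    have : (Q *ᵥ (Qᵀ *ᵥ w u ξ)) i0 = w u ξ i0 := by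
      rw [Matrix.mulVec_mulVec, hQ, Matrix.one_mulVec]
    rw [← this, ← hQa]; rfl
  have hnsq : ∀ v, nsq (Qᵀ *ᵥ v) = nsq v := by
    intro v
    rw [nsq_eq_dot, nsq_eq_dot, Matrix.dotProduct_mulVec, Matrix.vecMul_transpose,
      Matrix.mulVec_mulVec, hQ, Matrix.one_mulVec]
  set e : ℝ → (Fin d → ℝ) → Fin d → ℝ := fun u ξ j =>
    if j = i0 then ξ j + u ^ (-γ) * ξ j ^ 2 / 2 else ξ j ^ 2 / 2 with he
  have hk : 0 < γ * L := by positivity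
  have hmain := region_tendsto (β := β) hC hγ hL hd P R G hRmeas hGmeas hRpos hGlaw hindep htail
    (fun u => {y | u < a ⬝ᵥ y}) ?_ ?_ (fun u => Qᵀ * Matrix.diagonal (δ u))
    (fun u => u • a) {ξ | 0 < ξ i0} ?_ (fun u => u ^ 2) (tendsto_pow_atTop two_ne_zero)
    (fun u ξ => ∑ j, e u ξ j)
    (fun ξ => ∑ j, (if j = i0 then ξ j else ξ j ^ 2 / 2)) ?_ ?_ (c := 1) one_pos ?_ ?_ _
    (marg_integral i0 hk) (by positivity)
  · refine hmain.congr' ?_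
    filter_upwards [eventually_gt_atTop 0] with u hu
    rw [Matrix.det_mul, abs_mul, hdet, one_mul, Matrix.det_diagonal, prod_ite_i0,
      abs_of_pos (by positivity), marg_const hC hL hγ hd hu]
  · intro t
    refine isOpen_lt continuous_const ?_
    unfold dotProduct; fun_prop
  · filter_upwards [eventually_gt_atTop 0] with u hu y hy s hs
    have h1 : u < a ⬝ᵥ y := hy
    change u < a ⬝ᵥ (s • y)
    rw [dotProduct_smul, smul_eq_mul]
    nlinarith
  · exact measurableSet_lt measurable_const (measurable_pi_apply i0)
  · intro t
    simp only [he]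
    refine Finset.measurable_sum _ fun j _ => ?_
    split_ifs <;> fun_prop
  · filter_upwards [eventually_gt_atTop 0] with u hu
    refine ⟨?_, fun ξ => ⟨?_, ?_⟩⟩
    · rw [← abs_pos, Matrix.det_mul, abs_mul, hdet, one_mul, Matrix.det_diagonal, prod_ite_i0]
      positivity
    · rw [hy]
      rw [hay]
      simp only [hw, hδ, if_true, lt_add_iff_pos_left]
      exact mul_pos_iff_of_pos_left (by positivity)
    · rw [hy, hnsq]
      have h0 : (u ^ 2) ^ (1 - γ / 2) = u ^ (2 - γ) := by
        rw [← Real.rpow_two, ← Real.rpow_mul hu.le]; congr 1; ring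
      have h1 : u ^ (1 - γ) * u = u ^ (2 - γ) := by
        rw [← Real.rpow_add_one hu.ne']; congr 1; ring
      have h2 : (u ^ (1 - γ)) ^ 2 = u ^ (2 - γ) * u ^ (-γ) := by
        rw [← Real.rpow_add hu, ← Real.rpow_mul_natCast hu.le]; congr 1; push_cast; ring
      have h3 : (u ^ (1 - γ / 2)) ^ 2 = u ^ (2 - γ) := by
        rw [← Real.rpow_mul_natCast hu.le]; congr 1; push_cast; ring
      have h4 : u ^ 2 = ∑ j, if j = i0 then u ^ 2 else 0 := by simp
      rw [h0]
      conv_rhs => rw [h4]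
      rw [Finset.mul_sum, ← Finset.sum_add_distrib, nsq]
      refine Finset.sum_congr rfl fun j _ => ?_
      simp only [hw, hδ, he]
      split_ifs
      · linear_combination (2 * ξ j) * h1 + ξ j ^ 2 * h2
      · linear_combination ξ j ^ 2 * h3
  · filter_upwards [eventually_gt_atTop 0] with u hu ξ hξ
    have hξ' : 0 < ξ i0 := hξ
    have hn : ∀ j, 0 ≤ e u ξ j := by
      intro j
      simp only [he]
      split_ifs with hj
      · subst hj; positivity
      · positivity
    have hs : ∀ j, e u ξ j ≤ ∑ j, e u ξ j := fun j =>
      Finset.single_le_sum (fun i _ => hn i) (Finset.mem_univ j)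
    have h0 : 0 ≤ ∑ j, e u ξ j := Finset.sum_nonneg fun i _ => hn i
    refine ⟨h0, fun j => ?_⟩
    have h1 := hs j
    by_cases hj : j = i0
    · subst hj
      have : ξ j ≤ e u ξ j := by
        simp only [he, if_true]
        have : 0 ≤ u ^ (-γ) * ξ j ^ 2 / 2 := by positivity
        linarith
      nlinarith
    · have : e u ξ j = ξ j ^ 2 / 2 := by simp only [he, if_neg hj]
      nlinarith
  · intro ξ hξ
    refine tendsto_finsetSum _ fun j _ => ?_
    simp only [he]
    split_ifs
    · have := (((tendsto_rpow_neg_atTop hγ).mul_const (ξ j ^ 2)).div_const 2).const_add (ξ j)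
      simpa using this
    · exact tendsto_const_nhds

lemma lim_pow {Y p : ℝ → ℝ} (hY : Tendsto Y atTop atTop) {a : ℝ} (q : ℝ)
    (h : Tendsto (fun t => Y t * (p t - 1)) atTop (nhds a)) :
    Tendsto (fun t => Y t * (p t ^ q - 1)) atTop (nhds (q * a)) := by
  have hd : HasDerivAt (fun x : ℝ => x ^ q) q 1 := by
    simpa using Real.hasDerivAt_rpow_const (x := 1) (p := q) (Or.inl one_ne_zero)
  have hc : ContinuousAt (dslope (fun x : ℝ => x ^ q) 1) 1 :=
    continuousAt_dslope_same.2 hd.differentiableAt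
  have hp : Tendsto p atTop (nhds 1) := by
    have h1 := (h.mul (tendsto_inv_atTop_zero.comp hY)).add_const 1
    simp only [mul_zero, zero_add] at h1
    refine h1.congr' ?_
    filter_upwards [hY.eventually_gt_atTop 0] with t ht
    simp only [Function.comp]
    field_simp; ring
  have h2 := (hc.tendsto.comp hp)
  rw [dslope_same, hd.deriv] at h2
  refine (h2.mul h).congr fun t => ?_
  have := sub_smul_dslope (fun x : ℝ => x ^ q) 1 (p t)
  simp only [smul_eq_mul, Real.one_rpow] at this
  simp only [Function.comp]
  rw [← this]; ring

lemma quantile {C' L γ β' α c x : ℝ} (hC' : 0 < C') (hL : 0 < L) (hγ : 1 < γ) (hα : 0 < α)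
    (hc : 0 < c) (hx : 0 < x) (Gm ℓ z : ℝ → ℝ)
    (hG : Tendsto (fun u => Gm u / (C' * u ^ β' * Real.exp (-L * u ^ γ))) atTop (nhds 1))
    (hℓpos : ∀ t > (0 : ℝ), 0 < ℓ t)
    (hℓslow : ∀ y > (0 : ℝ), Tendsto (fun t => ℓ (t * y) / ℓ t) atTop (nhds 1))
    (hℓlog : Tendsto (fun t => Real.log (ℓ t) / Real.log t) atTop (nhds 0))
    (hz : Tendsto z atTop atTop)
    (hzq : ∀ᶠ t in atTop, Gm (z t) = c * ((t * x) ^ α * ℓ (t * x))⁻¹) :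
    Tendsto (fun t => z t / (α / L * Real.log t) ^ (1 / γ)) atTop (nhds 1) ∧
    Tendsto (fun t => L * z t ^ γ - (α * Real.log t + Real.log (ℓ t) + Real.log C' +
      β' / γ * Real.log (α / L * Real.log t))) atTop (nhds (α * Real.log x - Real.log c)) := by
  have hγ0 : 0 < γ := by linarith
  have hlogt := Real.tendsto_log_atTop
  have hD : Tendsto (fun t => L * z t ^ γ - β' * Real.log (z t) - Real.log C' - α * Real.log t
      - Real.log (ℓ t)) atTop (nhds (α * Real.log x - Real.log c)) := by
    have h1 := ((hG.comp hz).log one_ne_zero)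
    have h2 := (hℓslow x hx).log one_ne_zero
    have h3 := (h1.add h2).add_const (α * Real.log x - Real.log c)
    rw [Real.log_one, add_zero, zero_add] at h3
    refine h3.congr' ?_
    filter_upwards [hzq, hz.eventually_gt_atTop 0, eventually_gt_atTop 0] with t e1 e2 e3
    have p1 := hℓpos t e3
    have p2 := hℓpos (t * x) (by positivity)
    simp only [Function.comp]
    rw [e1, Real.log_div (by positivity) (by positivity), Real.log_mul hc.ne' (by positivity),
      Real.log_inv, Real.log_mul (by positivity) p2.ne', Real.log_rpow (by positivity),
      Real.log_mul e3.ne' hx.ne', Real.log_mul (by positivity) (Real.exp_pos _).ne',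
      Real.log_mul hC'.ne' (by positivity), Real.log_rpow e2, Real.log_exp,
      Real.log_div p2.ne' p1.ne']
    ring
  have hzl : Tendsto (fun t => L - β' * (Real.log (z t) / z t ^ γ)) atTop (nhds L) := by
    have h1 : Tendsto (fun u => Real.log u / u ^ γ) atTop (nhds 0) :=
      (isLittleO_log_rpow_atTop hγ0).tendsto_div_nhds_zero
    simpa using ((h1.comp hz).const_mul β').const_sub L
  have hinv : Tendsto (fun t => (Real.log t)⁻¹) atTop (nhds 0) :=
    tendsto_inv_atTop_zero.comp hlogt
  have hr : Tendsto (fun t => z t ^ γ / Real.log t) atTop (nhds (α / L)) := by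
    have h1 := (((hD.add_const (Real.log C')).mul hinv).add_const α).add hℓlog
    rw [mul_zero, zero_add, add_zero] at h1
    refine (h1.div hzl hL.ne').congr' ?_
    filter_upwards [hz.eventually_gt_atTop 0, hlogt.eventually_gt_atTop 0,
      hzl.eventually (lt_mem_nhds hL)] with t e2 e3 e4
    have p : 0 < z t ^ γ := by positivity
    simp only [Pi.div_apply]
    rw [div_eq_iff e4.ne']
    field_simp
    ring
  have hzT : Tendsto (fun t => z t / (α / L * Real.log t) ^ (1 / γ)) atTop (nhds 1) := by
    have h1 := (hr.div_const (α / L)).rpow_const (p := 1 / γ) (Or.inl (by positivity))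
    rw [div_self (by positivity), Real.one_rpow] at h1
    refine h1.congr' ?_
    filter_upwards [hz.eventually_gt_atTop 0, hlogt.eventually_gt_atTop 0] with t e2 e3
    rw [div_div, mul_comm (Real.log t), Real.div_rpow (by positivity) (by positivity),
      ← Real.rpow_mul e2.le, mul_one_div_cancel hγ0.ne', Real.rpow_one]
  refine ⟨hzT, ?_⟩
  have h1 := hD.add ((hzT.log one_ne_zero).const_mul β')
  rw [Real.log_one, mul_zero, add_zero] at h1
  refine h1.congr' ?_
  filter_upwards [hz.eventually_gt_atTop 0, hlogt.eventually_gt_atTop 0] with t e2 e3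
  rw [Real.log_div e2.ne' (by positivity), Real.log_rpow (by positivity)]
  ring

lemma expansion {L γ : ℝ} (hL : 0 < L) (hγ : 0 < γ) {d : ℕ}
    (A S : Matrix (Fin d) (Fin d) ℝ) (hSdef : S = A * Aᵀ)
    (lam : ℝ) (hlam : lam = (1 : Fin d → ℝ) ⬝ᵥ (S⁻¹ *ᵥ (1 : Fin d → ℝ))) (hlam0 : 0 < lam)
    (z : ℝ → Fin d → ℝ) (Y : ℝ → ℝ) (hY : Tendsto Y atTop atTop) (a : Fin d → ℝ)
    (hzpos : ∀ j, ∀ᶠ t in atTop, 0 < z t j)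
    (hz : ∀ j, Tendsto (fun t => L * z t j ^ γ - Y t) atTop (nhds (a j))) :
    Tendsto (fun t => L * (nsq (A⁻¹ *ᵥ z t)) ^ (γ / 2) - lam ^ (γ / 2) * Y t) atTop
      (nhds (lam ^ (γ / 2 - 1) * ((S⁻¹ *ᵥ (1 : Fin d → ℝ)) ⬝ᵥ a))) := by
  set n : ℝ → Fin d → ℝ := fun t j => (L * z t j ^ γ / Y t) ^ (1 / γ) with hn
  have hYpos := hY.eventually_gt_atTop 0
  have hzn : ∀ᶠ t in atTop, z t = ((Y t / L) ^ (1 / γ)) • n t := by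
    filter_upwards [hYpos, eventually_all.2 hzpos] with t h1 h2
    funext j
    have := h2 j
    rw [Pi.smul_apply, smul_eq_mul, hn]
    simp only
    rw [← Real.mul_rpow (by positivity) (by positivity),
      show Y t / L * (L * z t j ^ γ / Y t) = z t j ^ γ by field_simp,
      ← Real.rpow_mul this.le, mul_one_div_cancel hγ.ne', Real.rpow_one]
  have hm : Tendsto (fun t => Y t • (n t - 1)) atTop (nhds ((1 / γ) • a)) := by
    refine tendsto_pi_nhds.2 fun j => ?_
    have := lim_pow (p := fun t => L * z t j ^ γ / Y t) hY (1 / γ) (a := a j) ?_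
    · exact this
    · refine (hz j).congr' ?_
      filter_upwards [hYpos] with t ht
      field_simp
  have hQ : Tendsto (fun t => Y t * (nsq (A⁻¹ *ᵥ n t) / lam - 1)) atTop
      (nhds (2 / γ / lam * ((S⁻¹ *ᵥ (1 : Fin d → ℝ)) ⬝ᵥ a))) := by
    have c1 : Continuous fun v : Fin d → ℝ => nsq (A⁻¹ *ᵥ v) :=
      continuous_nsq.comp (Continuous.matrix_mulVec continuous_const continuous_id)
    have c2 : Continuous fun v : Fin d → ℝ => (S⁻¹ *ᵥ (1 : Fin d → ℝ)) ⬝ᵥ v := by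
      unfold dotProduct; fun_prop
    have h1 := (((c2.tendsto _).comp hm).const_mul 2).add
      ((tendsto_inv_atTop_zero.comp hY).mul ((c1.tendsto _).comp hm))
    have h2 := h1.div_const lam
    rw [zero_mul, add_zero, dotProduct_smul, smul_eq_mul] at h2
    convert h2.congr' ?_ using 2
    · field_simp
    · filter_upwards [hYpos] with t ht
      have e : nsq (A⁻¹ *ᵥ n t) = lam + 2 * ((S⁻¹ *ᵥ (1 : Fin d → ℝ)) ⬝ᵥ (n t - 1)) +
          nsq (A⁻¹ *ᵥ (n t - 1)) := by
        have : n t = (n t - 1) + 1 := by simp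
        conv_lhs => rw [this]
        rw [Matrix.mulVec_add, nsq_add, dot_inv A S hSdef, nsq_eq_dot (A⁻¹ *ᵥ 1),
          dot_inv A S hSdef, hlam, dotProduct_comm 1]
      simp only [Function.comp]
      rw [e, dotProduct_smul, smul_eq_mul, Matrix.mulVec_smul, nsq_smul]
      field_simp
      ring
  have hfin := (lim_pow hY (γ / 2) hQ).const_mul (lam ^ (γ / 2))
  convert hfin.congr' ?_ using 2
  · rw [Real.rpow_sub_one hlam0.ne']; field_simp
  · filter_upwards [hYpos, hzn] with t ht hzt
    have hq := nsq_nonneg (A⁻¹ *ᵥ n t)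
    rw [hzt, Matrix.mulVec_smul, nsq_smul, Real.mul_rpow (by positivity) hq, ← Real.rpow_two,
      ← Real.rpow_mul (by positivity), ← Real.rpow_mul (by positivity),
      show 1 / γ * (2 * (γ / 2)) = 1 by field_simp, Real.rpow_one, Real.div_rpow hq hlam0.le]
    field_simp

lemma exp_const {d : ℕ} {α L X t l C' b Λ q : ℝ} (hα : 0 < α) (hL : 0 < L) (hX : 0 < X)
    (hXt : X = Real.log t) (ht : 0 < t)
    (hl : 0 < l) (hC' : 0 < C') (h x c : Fin d → ℝ) (hx : ∀ j, 0 < x j) (hc : ∀ j, 0 < c j) :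
    Real.exp (-(Λ * (α * X + Real.log l + Real.log C' + b * Real.log (α / L * X)) +
      q * (h ⬝ᵥ fun j => α * Real.log (x j) - Real.log (c j)))) =
    X ^ (-(b * Λ)) * (t ^ α * l) ^ (-Λ) * (C' * α ^ b * L ^ (-b)) ^ (-Λ) *
      ∏ j, ((c j)⁻¹ * (x j) ^ α) ^ (-(h j * q)) := by
  have e : ∀ j, ((c j)⁻¹ * (x j) ^ α) ^ (-(h j * q)) =
      Real.exp (-(q * (h j * (α * Real.log (x j) - Real.log (c j))))) := by
    intro j
    have h1 := hx j
    have h2 := hc j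
    rw [Real.rpow_def_of_pos (by positivity), Real.log_mul (by positivity) (by positivity),
      Real.log_inv, Real.log_rpow h1]
    congr 1; ring
  simp_rw [e]
  rw [← Real.exp_sum, Real.rpow_def_of_pos hX, Real.rpow_def_of_pos (x := t ^ α * l) (by positivity),
    Real.rpow_def_of_pos (x := C' * α ^ b * L ^ (-b)) (by positivity),
    ← Real.exp_add, ← Real.exp_add, ← Real.exp_add,
    Real.log_mul (by positivity) hl.ne', Real.log_rpow ht,
    Real.log_mul (x := C' * α ^ b) (by positivity) (by positivity),
    Real.log_mul hC'.ne' (by positivity),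
    Real.log_rpow hα, Real.log_rpow hL, Real.log_mul (by positivity) hX.ne',
    Real.log_div hα.ne' hL.ne', Finset.sum_neg_distrib, ← Finset.mul_sum, ← hXt]
  simp only [dotProduct]
  congr 1; ring

lemma pre_const {d : ℕ} {C L γ β lam T y Δ : ℝ} (hL : 0 < L) (hγ : 0 < γ)
    (hlam : 0 < lam) (hy : 0 < y) (hT : T = y ^ (1 / γ)) (h : Fin d → ℝ) (hh : ∀ j, 0 < h j)
    (hΔ : 0 < Δ) :
    cd d * ((T ^ (1 - γ)) ^ d * Δ⁻¹ * (C * γ * L * (lam * T ^ 2) ^ ((β + γ - d) / 2)) *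
        ∏ j, (γ * L * lam ^ (γ / 2 - 1) * h j)⁻¹) =
    C * (γ * L) ^ ((1 : ℝ) - d) * Real.Gamma ((d : ℝ) / 2) *
        2 ^ ((d : ℝ) / 2 - 1) / ((2 * Real.pi) ^ ((d : ℝ) / 2) * Δ * ∏ j, h j) *
      lam ^ ((β + d + γ * (1 - d)) / 2) * y ^ (β / γ + 1 - d) := by
  have hTp : 0 < T := by rw [hT]; positivity
  have hk : 0 < γ * L := by positivity
  have hP : 0 < ∏ j, h j := Finset.prod_pos fun j _ => hh j
  have p1 : ∏ j, (γ * L * lam ^ (γ / 2 - 1) * h j)⁻¹ =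
      (γ * L) ^ (-(d:ℝ)) * lam ^ (-(γ / 2 - 1) * d) * (∏ j, h j)⁻¹ := by
    rw [Finset.prod_inv_distrib, Finset.prod_mul_distrib, Finset.prod_const, Finset.card_univ,
      Fintype.card_fin, mul_inv, mul_pow, mul_inv, Real.rpow_neg hk.le, Real.rpow_natCast,
      neg_mul, Real.rpow_neg hlam.le, Real.rpow_mul_natCast hlam.le]
  have p2 : (lam * T ^ 2) ^ ((β + γ - d) / 2) = lam ^ ((β + γ - d) / 2) * T ^ (β + γ - d) := by
    rw [Real.mul_rpow hlam.le (by positivity), ← Real.rpow_two, ← Real.rpow_mul hTp.le]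
    congr 2; ring
  have p3 : (T ^ (1 - γ)) ^ d * T ^ (β + γ - d) = y ^ (β / γ + 1 - d) := by
    rw [← Real.rpow_mul_natCast hTp.le, ← Real.rpow_add hTp, hT, ← Real.rpow_mul hy.le]
    congr 1; field_simp; ring
  have p4 : lam ^ ((β + γ - d) / 2) * lam ^ (-(γ / 2 - 1) * d) =
      lam ^ ((β + d + γ * (1 - d)) / 2) := by
    rw [← Real.rpow_add hlam]; congr 1; ring
  have p5 : γ * L * (γ * L) ^ (-(d:ℝ)) = (γ * L) ^ ((1:ℝ) - d) := by
    rw [sub_eq_add_neg, Real.rpow_add hk, Real.rpow_one]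
  have p6 : (2 * π) ^ (-(d:ℝ) / 2) = ((2 * π) ^ ((d:ℝ) / 2))⁻¹ := by
    rw [neg_div, Real.rpow_neg (by positivity)]
  rw [p1, p2, ← p3, ← p4, ← p5, cd, p6]
  field_simp

/-- Tail asymptotics (Theorem 3.1 of the paper, case `S = {1,…,d}`, `I_S = S`) for the
joint exceedance probability of heavy-tailed risks with elliptical copula: with
regularly varying margins `F̄_j(t) = c_j (t^α ℓ(t))⁻¹` transformed to the elliptical
vector `Z` through the thresholds `z_j(t) = Ḡ₁^←(F̄_j(t x_j))`. -/
theorem heavy_tail_elliptical_copula_tail_asymptotics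
    (d : ℕ) (hd : 2 ≤ d)
    (Ω : Type*) [MeasurableSpace Ω] (P : Measure Ω) [IsProbabilityMeasure P]
    (R : Ω → ℝ) (G : Ω → Fin d → ℝ)
    (hRmeas : Measurable R) (hGmeas : Measurable G)
    (hRpos : P {ω | 0 < R ω} = 1)
    (hGlaw : Measure.map G P = Measure.pi (fun _ : Fin d => gaussianReal 0 1))
    (hindep : IndepFun R G P)
    (C L γ β : ℝ) (hC : 0 < C) (hL : 0 < L) (hγ : 1 < γ)
    (htail :
      Tendsto (fun u => (P {ω | u < R ω}).toReal / (C * u ^ β * Real.exp (-L * u ^ γ)))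
        atTop (nhds 1))
    (A : Matrix (Fin d) (Fin d) ℝ) (hA : IsUnit A.det)
    (S : Matrix (Fin d) (Fin d) ℝ) (hSdef : S = A * Aᵀ)
    (hdiag : ∀ i, S i i = 1)
    (hSpos : ∀ i, 0 < (S⁻¹ *ᵥ (1 : Fin d → ℝ)) i)
    (Z : Ω → Fin d → ℝ)
    (hZ : ∀ ω i, Z ω i = (R ω / Real.sqrt (∑ j, (G ω j) ^ 2)) * (A *ᵥ G ω) i)
    (lam K C' β' : ℝ)
    (hlam : lam = (1 : Fin d → ℝ) ⬝ᵥ (S⁻¹ *ᵥ (1 : Fin d → ℝ)))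
    (hK : K = C * (γ * L) ^ ((1 : ℝ) - d) * Real.Gamma ((d : ℝ) / 2) *
        2 ^ ((d : ℝ) / 2 - 1) /
        ((2 * Real.pi) ^ ((d : ℝ) / 2) * Real.sqrt S.det *
          ∏ j, (S⁻¹ *ᵥ (1 : Fin d → ℝ)) j))
    (hC' : C' = (Real.Gamma ((d : ℝ) / 2) / (2 * Real.Gamma (1 / 2))) * C *
        (γ * L / 2) ^ (-((d : ℝ) - 1) / 2))
    (hβ' : β' = β - γ * ((d : ℝ) - 1) / 2)
    (G₁ : ℝ → ℝ) (hG₁ : ∀ u, G₁ u = (P {ω | u < Z ω ⟨0, by omega⟩}).toReal)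
    (α : ℝ) (hα : 0 < α)
    (ℓ : ℝ → ℝ)
    (hℓpos : ∀ t > (0 : ℝ), 0 < ℓ t)
    (hℓslow : ∀ y > (0 : ℝ), Tendsto (fun t => ℓ (t * y) / ℓ t) atTop (nhds 1))
    (hℓlog : Tendsto (fun t => Real.log (ℓ t) / (Real.log t) ^ (1 - 1 / γ)) atTop (nhds 0))
    (x c : Fin d → ℝ) (hx : ∀ j, 0 < x j) (hc : ∀ j, 0 < c j)
    (z : Fin d → ℝ → ℝ)
    (hztop : ∀ j, Tendsto (z j) atTop atTop)
    (hzq : ∀ j, ∀ᶠ t in atTop, G₁ (z j t) = c j * ((t * x j) ^ α * ℓ (t * x j))⁻¹) :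
    Tendsto
      (fun t =>
        (P {ω | ∀ j, z j t < Z ω j}).toReal /
          (K * lam ^ ((β + d + γ * (1 - d)) / 2) * (α / L) ^ (β / γ + 1 - d) *
            (Real.log t) ^ (β / γ + 1 - d - (β' / γ) * lam ^ (γ / 2)) *
            (t ^ α * ℓ t) ^ (-lam ^ (γ / 2)) *
            (C' * α ^ (β' / γ) * L ^ (-(β' / γ))) ^ (-lam ^ (γ / 2)) *
            ∏ j, ((c j)⁻¹ * (x j) ^ α) ^
              (-((S⁻¹ *ᵥ (1 : Fin d → ℝ)) j * lam ^ (γ / 2 - 1)))))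
      atTop (nhds 1) := by
  have hd0 : 0 < d := by omega
  have hγ0 : 0 < γ := by linarith
  have hdR : (0:ℝ) < d := by exact_mod_cast hd0
  have hC'0 : 0 < C' := by
    rw [hC']
    have h1 := Real.Gamma_pos_of_pos (show 0 < (d:ℝ) / 2 by positivity)
    have h2 := Real.Gamma_pos_of_pos (show (0:ℝ) < 1 / 2 by norm_num)
    positivity
  have hZG : ∀ ω i, Z ω i = (A *ᵥ ((R ω / √(nsq (G ω))) • G ω)) i := by
    intro ω i
    rw [hZ, Matrix.mulVec_smul, Pi.smul_apply, smul_eq_mul, nsq]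
  -- marginal tail
  have hG : Tendsto (fun u => G₁ u / (C' * u ^ β' * Real.exp (-L * u ^ γ))) atTop (nhds 1) := by
    have ha : A ⟨0, hd0⟩ ⬝ᵥ A ⟨0, hd0⟩ = 1 := by
      rw [← hdiag ⟨0, hd0⟩, hSdef]; rfl
    have := marginal_tendsto (β := β) hC hγ0 hL hd0 P R G hRmeas hGmeas hRpos hGlaw hindep htail
      ⟨0, hd0⟩ _ ha
    refine this.congr fun u => ?_
    rw [hG₁, hC', hβ']
    simp only [hZG]
    rfl
  have hlogt := Real.tendsto_log_atTop
  have hℓ0 : Tendsto (fun t => Real.log (ℓ t) / Real.log t) atTop (nhds 0) := by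
    have h1 : Tendsto (fun t => (Real.log t) ^ (-(1 / γ))) atTop (nhds 0) :=
      (tendsto_rpow_neg_atTop (by positivity)).comp hlogt
    have h2 := hℓlog.mul h1
    rw [mul_zero] at h2
    refine h2.congr' ?_
    filter_upwards [hlogt.eventually_gt_atTop 0] with t ht
    rw [sub_eq_add_neg, Real.rpow_add ht, Real.rpow_one]
    have : 0 < Real.log t ^ (-(1 / γ)) := by positivity
    field_simp
  have hq := fun j => quantile hC'0 hL hγ hα (hc j) (hx j) G₁ ℓ (z j) hG hℓpos hℓslow hℓ0
    (hztop j) (hzq j)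
  set T : ℝ → ℝ := fun t => (α / L * Real.log t) ^ (1 / γ) with hTdef
  have hal : Tendsto (fun t => α / L * Real.log t) atTop atTop :=
    hlogt.const_mul_atTop (by positivity)
  have hT : Tendsto T atTop atTop := (tendsto_rpow_atTop (by positivity)).comp hal
  set Y : ℝ → ℝ := fun t => α * Real.log t + Real.log (ℓ t) + Real.log C' +
      β' / γ * Real.log (α / L * Real.log t) with hYdef
  have hY : Tendsto Y atTop atTop := by
    have h1 : Tendsto (fun u => Real.log u / u) atTop (nhds 0) := by
      simpa using (isLittleO_log_rpow_atTop one_pos).tendsto_div_nhds_zero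
    have h2 := ((h1.comp hal).mul_const (α / L)).const_mul (β' / γ)
    have h3 : Tendsto (fun t => (Real.log t)⁻¹) atTop (nhds 0) :=
      tendsto_inv_atTop_zero.comp hlogt
    have h4 := ((hℓ0.const_add α).add (h3.const_mul (Real.log C'))).add h2
    simp only [zero_mul, mul_zero, add_zero] at h4
    refine (hlogt.atTop_mul_pos hα h4).congr' ?_
    filter_upwards [hlogt.eventually_gt_atTop 0] with t ht
    simp only [hYdef, Function.comp]
    field_simp
  obtain ⟨hlam0, hs, hmain⟩ := joint_tendsto (β := β) hC hγ0 hL hd0 P R G hRmeas hGmeas hRpos hGlaw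
    hindep htail A hA S hSdef hSpos lam hlam (fun t j => z j t) T hT (fun j => (hq j).1)
  set h : Fin d → ℝ := S⁻¹ *ᵥ (1 : Fin d → ℝ) with hh
  set s : ℝ → ℝ := fun t => nsq (A⁻¹ *ᵥ fun j => z j t) with hsdef
  have hexp := expansion hL hγ0 A S hSdef lam hlam hlam0 (fun t j => z j t) Y hY
    (fun j => α * Real.log (x j) - Real.log (c j)) (fun j => (hztop j).eventually_gt_atTop 0)
    (fun j => (hq j).2)
  have hexp1 : Tendsto (fun t => Real.exp (-(L * s t ^ (γ / 2))) /
      Real.exp (-(lam ^ (γ / 2) * Y t + lam ^ (γ / 2 - 1) *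
        (h ⬝ᵥ fun j => α * Real.log (x j) - Real.log (c j))))) atTop (nhds 1) := by
    have h1 := (hexp.const_sub (lam ^ (γ / 2 - 1) *
        (h ⬝ᵥ fun j => α * Real.log (x j) - Real.log (c j)))).rexp
    rw [sub_self, Real.exp_zero] at h1
    refine h1.congr fun t => ?_
    rw [← Real.exp_sub]
    congr 1; ring
  have hpow1 : Tendsto (fun t => s t ^ ((β + γ - d) / 2) / (lam * T t ^ 2) ^ ((β + γ - d) / 2))
      atTop (nhds 1) := by
    have h1 := (hs.div_const lam).rpow_const (p := (β + γ - d) / 2)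
      (Or.inl (by rw [div_self hlam0.ne']; exact one_ne_zero))
    rw [div_self hlam0.ne', Real.one_rpow] at h1
    refine h1.congr' ?_
    filter_upwards [hT.eventually_gt_atTop 0] with t ht
    rw [div_div, mul_comm (T t ^ 2), Real.div_rpow (nsq_nonneg _) (by positivity)]
  have hdetS : |A.det| = Real.sqrt S.det := by
    rw [hSdef, Matrix.det_mul, Matrix.det_transpose, Real.sqrt_mul_self_eq_abs]
  have hΔ : 0 < |A.det| := abs_pos.2 hA.ne_zero
  have hcd := cd_pos hd0
  have hP : 0 < ∏ j, (γ * L * lam ^ (γ / 2 - 1) * h j)⁻¹ :=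
    Finset.prod_pos fun j _ => by have := hSpos j; positivity
  have hfin := (hmain.mul hexp1).mul hpow1
  rw [mul_one, mul_one] at hfin
  refine hfin.congr' ?_
  filter_upwards [hlogt.eventually_gt_atTop 0, eventually_gt_atTop 0, hT.eventually_gt_atTop 0,
    hs.eventually (lt_mem_nhds hlam0)] with t h1 h2 h3 h4
  have hs0 : 0 < s t := (div_pos_iff_of_pos_right (by positivity)).1 h4
  have hset : {ω | ∀ j, z j t < Z ω j} =
      {ω | (R ω / √(nsq (G ω))) • G ω ∈ {y | ∀ j, z j t < (A *ᵥ y) j}} := by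
    ext ω
    simp only [hZG]
    rfl
  have hden : K * lam ^ ((β + d + γ * (1 - d)) / 2) * (α / L) ^ (β / γ + 1 - d) *
            (Real.log t) ^ (β / γ + 1 - d - (β' / γ) * lam ^ (γ / 2)) *
            (t ^ α * ℓ t) ^ (-lam ^ (γ / 2)) *
            (C' * α ^ (β' / γ) * L ^ (-(β' / γ))) ^ (-lam ^ (γ / 2)) *
            ∏ j, ((c j)⁻¹ * (x j) ^ α) ^ (-(h j * lam ^ (γ / 2 - 1))) =
      cd d * ((T t ^ (1 - γ)) ^ d * |A.det|⁻¹ *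
        (C * γ * L * (lam * T t ^ 2) ^ ((β + γ - d) / 2)) *
        ∏ j, (γ * L * lam ^ (γ / 2 - 1) * h j)⁻¹) *
      Real.exp (-(lam ^ (γ / 2) * Y t + lam ^ (γ / 2 - 1) *
        (h ⬝ᵥ fun j => α * Real.log (x j) - Real.log (c j)))) := by
    rw [pre_const hL hγ0 hlam0 (show 0 < α / L * Real.log t by positivity) rfl h hSpos hΔ,
      hYdef]
    simp only
    rw [exp_const hα hL h1 rfl h2 (hℓpos t h2) hC'0 h x c hx hc, hdetS, ← hK,
      Real.mul_rpow (by positivity) h1.le, sub_eq_add_neg _ (β' / γ * lam ^ (γ / 2)),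
      Real.rpow_add h1]
    ring
  rw [hset, hden, psi]
  have e1 := Real.exp_pos (-(L * s t ^ (γ / 2)))
  have e2 : 0 < s t ^ ((β + γ - d) / 2) := by positivity
  have e3 : 0 < (lam * T t ^ 2) ^ ((β + γ - d) / 2) := by positivity
  have e4 := Real.exp_pos (-(lam ^ (γ / 2) * Y t + lam ^ (γ / 2 - 1) *
        (h ⬝ᵥ fun j => α * Real.log (x j) - Real.log (c j))))
  have e5 : 0 < (T t ^ (1 - γ)) ^ d := by positivity
  simp only [neg_mul]
  generalize Real.exp (-(L * s t ^ (γ / 2))) = x1 at *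
  generalize s t ^ ((β + γ - d) / 2) = x2 at *
  generalize (lam * T t ^ 2) ^ ((β + γ - d) / 2) = x3 at *
  generalize Real.exp (-(lam ^ (γ / 2) * Y t + lam ^ (γ / 2 - 1) *
        (h ⬝ᵥ fun j => α * Real.log (x j) - Real.log (c j)))) = x4 at *
  generalize (T t ^ (1 - γ)) ^ d = x5 at *
  generalize ∏ j, (γ * L * lam ^ (γ / 2 - 1) * h j)⁻¹ = x6 at *
  field_simp
  rfl
end
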